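/- Let G ∈ 𝒢₄ (G has girth 9 and no odd hole of length at least 11) and assume G has no 2-edge-cut and no K2-cut. Then at least one of the following holds: (1) G has an odd K4-subdivision; (2) G contains a balanced K4-subdivision of type (1, 2); (3) G has a P3-cut; (4) G has a vertex of degree 2. -/

import Mathlib

open SimpleGraph

variable {V : Type*}

/-- The set of internal vertices of a walk from `x` to `y`. -/
def wInterior {G : SimpleGraph V} {x y : V} (P : G.Walk x y) : Set V :=
  {a | a ∈ P.support ∧ a ≠ x ∧ a ≠ y}

/-- `P` is an induced path of `G`. -/
def IsInducedPath (G : SimpleGraph V) {x y : V} (P : G.Walk x y) : Prop :=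
  P.IsPath ∧ ∀ a ∈ P.support, ∀ b ∈ P.support, G.Adj a b → s(a, b) ∈ P.edges

/-- A hole of `G`: an induced cycle of length at least 4. -/
def IsHole (G : SimpleGraph V) {v : V} (w : G.Walk v v) : Prop :=
  w.IsCycle ∧ 4 ≤ w.length ∧
    ∀ a ∈ w.support, ∀ b ∈ w.support, G.Adj a b → s(a, b) ∈ w.edges

/-- An odd hole of `G`. -/
def IsOddHole (G : SimpleGraph V) {v : V} (w : G.Walk v v) : Prop :=
  IsHole G w ∧ Odd w.length

/-- `G` belongs to the family `𝒢ₗ`: it has girth `2l+1` and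
no odd hole of length at least `2l+3`. -/
def MemGFam (G : SimpleGraph V) (l : ℕ) : Prop :=
  G.girth = (2 * l + 1 : ℕ) ∧
    ∀ (v : V) (w : G.Walk v v), IsOddHole G w → w.length < 2 * l + 3

/-- `G` is `k`-vertex-critical. -/
def IsVertexCritical (G : SimpleGraph V) (k : ℕ) : Prop :=
  G.chromaticNumber = k ∧
    ∀ v : V, (G.induce {u | u ≠ v}).chromaticNumber < k

/-- `S` is a vertex cut of `G`: deleting `S` leaves a disconnected graph. -/
def IsVertexCut (G : SimpleGraph V) (S : Set V) : Prop :=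
  ¬ (G.induce Sᶜ).Preconnected

/-- `G` has a `K2`-cut. -/
def HasK2Cut (G : SimpleGraph V) : Prop :=
  ∃ u v : V, G.Adj u v ∧ IsVertexCut G {u, v}

/-- `G` has a `P3`-cut. -/
def HasP3Cut (G : SimpleGraph V) : Prop :=
  ∃ u v w : V, u ≠ w ∧ G.Adj u v ∧ G.Adj v w ∧ ¬ G.Adj u w ∧ IsVertexCut G {u, v, w}

/-- `G` has a 2-edge-cut: two edges whose removal disconnects the graph. -/
def Has2EdgeCut (G : SimpleGraph V) : Prop :=
  ∃ e f : Sym2 V, e ≠ f ∧ e ∈ G.edgeSet ∧ f ∈ G.edgeSet ∧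
    ¬ (G.deleteEdges {e, f}).Preconnected

/-- `Q1`, `Q2` are the two internally disjoint `(x,y)`-paths of the cycle `w`. -/
def ArcsOf (G : SimpleGraph V) {v x y : V} (w : G.Walk v v) (Q1 Q2 : G.Walk x y) : Prop :=
  x ∈ w.support ∧ y ∈ w.support ∧ x ≠ y ∧ Q1.IsPath ∧ Q2.IsPath ∧
    ({a | a ∈ Q1.support} ∩ {a | a ∈ Q2.support} = {x, y}) ∧
    ({e | e ∈ w.edges} = {e | e ∈ Q1.edges} ∪ {e | e ∈ Q2.edges})

/-- `P` is a chordal path of the hole `w`: `w ∪ P` is an induced theta-subgraph of `G`. -/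
def IsChordalPath (G : SimpleGraph V) {v x y : V} (w : G.Walk v v) (P : G.Walk x y) : Prop :=
  IsHole G w ∧ P.IsPath ∧ 2 ≤ P.length ∧ x ∈ w.support ∧ y ∈ w.support ∧ x ≠ y ∧
    (∀ a ∈ wInterior P, a ∉ w.support) ∧
    (∀ a, (a ∈ w.support ∨ a ∈ P.support) → ∀ b, (b ∈ w.support ∨ b ∈ P.support) →
      G.Adj a b → (s(a, b) ∈ w.edges ∨ s(a, b) ∈ P.edges))

/-- `P` is an `(s,t)`-jump over the hole `w`. -/
def IsJump (G : SimpleGraph V) {v s t : V} (w : G.Walk v v) (P : G.Walk s t) : Prop :=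
  IsHole G w ∧ s ∈ w.support ∧ t ∈ w.support ∧ s ≠ t ∧ ¬ G.Adj s t ∧
    IsInducedPath G P ∧ ∀ a ∈ wInterior P, a ∉ w.support

/-- `P` is a local jump over `w` across the interior of the arc `Q1`
(`Q1`, `Q2` being the two arcs of `w` between the ends of `P`). -/
def IsLocalJumpAcross (G : SimpleGraph V) {v s t : V} (w : G.Walk v v)
    (P Q1 Q2 : G.Walk s t) : Prop :=
  IsJump G w P ∧ ArcsOf G w Q1 Q2 ∧
    (∃ a ∈ wInterior Q1, ∃ b ∈ wInterior P, G.Adj a b) ∧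
    (∀ a ∈ wInterior Q2, ∀ b ∈ wInterior P, ¬ G.Adj a b)

/-- `P` is a local jump over `w`. -/
def IsLocalJump (G : SimpleGraph V) {v s t : V} (w : G.Walk v v) (P : G.Walk s t) : Prop :=
  ∃ Q1 Q2 : G.Walk s t, IsLocalJumpAcross G w P Q1 Q2

/-- `P` is a local jump over `w` across one vertex. -/
def IsLocalJumpAcrossOne (G : SimpleGraph V) {v s t : V} (w : G.Walk v v)
    (P : G.Walk s t) : Prop :=
  ∃ Q1 Q2 : G.Walk s t, IsLocalJumpAcross G w P Q1 Q2 ∧ Q1.length = 2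

/-- `P` is a short jump over `w`: no internal vertex of either arc of `w`
has a neighbour among the internal vertices of `P`. -/
def IsShortJump (G : SimpleGraph V) {v s t : V} (w : G.Walk v v) (P : G.Walk s t) : Prop :=
  IsJump G w P ∧
    ∀ a ∈ w.support, a ≠ s → a ≠ t → ∀ b ∈ wInterior P, ¬ G.Adj a b

/-- `P` is a short jump over `w` across the interior of `Q1`, i.e. `P ∪ Q1` is an
odd hole (a jump hole over `w`). -/
def IsShortJumpAcross (G : SimpleGraph V) {v s t : V} (w : G.Walk v v)
    (P Q1 Q2 : G.Walk s t) : Prop :=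
  IsShortJump G w P ∧ ArcsOf G w Q1 Q2 ∧ IsOddHole G (P.append Q1.reverse)

/-- `x` lies in some jump hole over `w`. -/
def InJumpHoleOver (G : SimpleGraph V) {v : V} (w : G.Walk v v) (x : V) : Prop :=
  ∃ (s t : V) (P Q1 Q2 : G.Walk s t),
    IsShortJumpAcross G w P Q1 Q2 ∧ (x ∈ P.support ∨ x ∈ Q1.support)

/-- `a`, `b`, `c`, `d` appear on the cycle `w` in this cyclic order. -/
def CyclicOrder4 (G : SimpleGraph V) {v : V} (w : G.Walk v v) (a b c d : V) : Prop :=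
  ∃ n : ℕ, List.Sublist [a, b, c, d] (w.support.tail.rotate n)

/-- A `K4`-subdivision in `G`: four distinct branch vertices joined by six
internally disjoint paths (the arrises). -/
structure K4Sub (G : SimpleGraph V) where
  u1 : V
  u2 : V
  u3 : V
  u4 : V
  P1 : G.Walk u1 u2
  P2 : G.Walk u3 u4
  Q1 : G.Walk u2 u3
  Q2 : G.Walk u1 u4
  L1 : G.Walk u1 u3
  L2 : G.Walk u2 u4
  hu : List.Nodup [u1, u2, u3, u4]
  hP1 : P1.IsPath
  hP2 : P2.IsPath
  hQ1 : Q1.IsPath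
  hQ2 : Q2.IsPath
  hL1 : L1.IsPath
  hL2 : L2.IsPath
  hP : ∀ a ∈ P1.support, a ∉ P2.support
  hQ : ∀ a ∈ Q1.support, a ∉ Q2.support
  hL : ∀ a ∈ L1.support, a ∉ L2.support

namespace K4Sub

variable {G : SimpleGraph V}

/-- The face cycle `C1 = P1 ∪ Q1 ∪ L1`. -/
def C1 (H : K4Sub G) : G.Walk H.u1 H.u1 := (H.P1.append H.Q1).append H.L1.reverse
/-- The face cycle `C2 = P1 ∪ Q2 ∪ L2`. -/
def C2 (H : K4Sub G) : G.Walk H.u1 H.u1 := (H.P1.append H.L2).append H.Q2.reverse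
/-- The face cycle `C3 = P2 ∪ Q1 ∪ L2`. -/
def C3 (H : K4Sub G) : G.Walk H.u2 H.u2 := (H.Q1.append H.P2).append H.L2.reverse
/-- The face cycle `C4 = C1 △ C2 △ C3 = P2 ∪ Q2 ∪ L1`. -/
def C4 (H : K4Sub G) : G.Walk H.u1 H.u1 := (H.L1.append H.P2).append H.Q2.reverse

/-- The vertex set of the subdivision. -/
def verts (H : K4Sub G) : Set V :=
  {a | a ∈ H.P1.support ∨ a ∈ H.P2.support ∨ a ∈ H.Q1.support ∨
       a ∈ H.Q2.support ∨ a ∈ H.L1.support ∨ a ∈ H.L2.support}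

/-- The edge set of the subdivision. -/
def edges (H : K4Sub G) : Set (Sym2 V) :=
  {e | e ∈ H.P1.edges ∨ e ∈ H.P2.edges ∨ e ∈ H.Q1.edges ∨
       e ∈ H.Q2.edges ∨ e ∈ H.L1.edges ∨ e ∈ H.L2.edges}

end K4Sub

/-- `H` is an odd `K4`-subdivision: all four face cycles are odd holes. -/
def IsOddK4 (G : SimpleGraph V) (H : K4Sub G) : Prop :=
  IsOddHole G H.C1 ∧ IsOddHole G H.C2 ∧ IsOddHole G H.C3 ∧ IsOddHole G H.C4

/-- `G` has an odd `K4`-subdivision. -/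
def HasOddK4 (G : SimpleGraph V) : Prop := ∃ H : K4Sub G, IsOddK4 G H

/-- `H` is a balanced `K4`-subdivision of type `(1,2)`. -/
def IsBalancedK4 (G : SimpleGraph V) (H : K4Sub G) : Prop :=
  IsOddHole G H.C1 ∧ IsOddHole G H.C2 ∧
    IsHole G H.C3 ∧ Even H.C3.length ∧ IsHole G H.C4 ∧ Even H.C4.length ∧
    H.Q1.length = 1 ∧ 2 ≤ H.L2.length

/-- `G` contains a balanced `K4`-subdivision of type `(1,2)`. -/
def HasBalancedK4 (G : SimpleGraph V) : Prop := ∃ H : K4Sub G, IsBalancedK4 G H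

/-- `P` is a direct connection linking the (vertex sets of) two disjoint induced
subgraphs `S1` and `S2`. -/
def IsDirectConnection (G : SimpleGraph V) (S1 S2 : Set V) {v1 v2 : V}
    (P : G.Walk v1 v2) : Prop :=
  IsInducedPath G P ∧ (∀ x ∈ P.support, x ∉ S1 ∧ x ∉ S2) ∧
    (∃ y ∈ S1, G.Adj v1 y) ∧ (∃ y ∈ S2, G.Adj v2 y) ∧
    (∀ x ∈ P.support, (∃ y ∈ S1, G.Adj x y) → x = v1) ∧
    (∀ x ∈ P.support, (∃ y ∈ S2, G.Adj x y) → x = v2)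

/-- `P` is a minimal direct connection linking `S1` and `S2`. -/
def IsMinimalDirectConnection (G : SimpleGraph V) (S1 S2 : Set V) {v1 v2 : V}
    (P : G.Walk v1 v2) : Prop :=
  IsDirectConnection G S1 S2 P ∧
    ∀ (w1 w2 : V) (P' : G.Walk w1 w2), IsDirectConnection G S1 S2 P' →
      (∀ x ∈ P'.support, x ∈ P.support) → ∀ x ∈ P.support, x ∈ P'.support

namespace NineHoles

variable {G : SimpleGraph V}

/-- `A` and `B` are disjoint and no edge of `G` joins them. -/
def Sep (G : SimpleGraph V) (A B : Set V) : Prop :=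
  ∀ a ∈ A, ∀ b ∈ B, a ≠ b ∧ ¬ G.Adj a b

theorem Sep.symm {A B : Set V} (h : Sep G A B) : Sep G B A :=
  fun a ha b hb => ⟨(h b hb a ha).1.symm, fun e => (h b hb a ha).2 e.symm⟩

theorem Sep.mono {A B A' B' : Set V} (h : Sep G A B) (hA : A' ⊆ A) (hB : B' ⊆ B) :
    Sep G A' B' :=
  fun a ha b hb => h a (hA ha) b (hB hb)

theorem sep_union_left {A B C : Set V} : Sep G (A ∪ B) C ↔ Sep G A C ∧ Sep G B C := by
  constructor
  · exact fun h => ⟨h.mono Set.subset_union_left subset_rfl,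
      h.mono Set.subset_union_right subset_rfl⟩
  · rintro ⟨h1, h2⟩ a (ha | ha) b hb
    exacts [h1 a ha b hb, h2 a ha b hb]

theorem sep_union_right {A B C : Set V} : Sep G C (A ∪ B) ↔ Sep G C A ∧ Sep G C B := by
  constructor
  · exact fun h => ⟨h.mono subset_rfl Set.subset_union_left,
      h.mono subset_rfl Set.subset_union_right⟩
  · rintro ⟨h1, h2⟩ a ha b (hb | hb)
    exacts [h1 a ha b hb, h2 a ha b hb]

theorem sep_empty_left {A : Set V} : Sep G ∅ A := fun _ ha => ha.elim

theorem sep_empty_right {A : Set V} : Sep G A ∅ := fun _ _ _ hb => hb.elim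

theorem sep_singleton_right {A : Set V} {x : V} :
    Sep G A {x} ↔ ∀ a ∈ A, a ≠ x ∧ ¬ G.Adj a x := by
  simp [Sep]

theorem sep_singleton_left {A : Set V} {x : V} :
    Sep G {x} A ↔ ∀ a ∈ A, x ≠ a ∧ ¬ G.Adj x a := by
  simp [Sep]

/-- `A` is a path between distinct vertices with interior `I`, induced except that its ends may be
adjacent. -/
structure IsArris {x y : V} (A : G.Walk x y) (I : Set V) : Prop where
  isPath : A.IsPath
  ne : x ≠ y
  left_notMem : x ∉ I
  right_notMem : y ∉ I
  mem_iff : ∀ a, a ∈ A.support ↔ a = x ∨ a = y ∨ a ∈ I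
  clean : ∀ a ∈ A.support, ∀ b ∈ A.support, G.Adj a b → s(a, b) ∈ A.edges ∨ s(a, b) = s(x, y)

theorem IsArris.one_le {x y : V} {A : G.Walk x y} {I : Set V} (h : IsArris A I) :
    1 ≤ A.length := by
  rcases Nat.eq_zero_or_pos A.length with h0 | h0
  · exact (h.ne (Walk.eq_of_length_eq_zero h0)).elim
  · exact h0

theorem IsArris.edge {x y : V} (h : G.Adj x y) : IsArris h.toWalk (∅ : Set V) where
  isPath := by simp [h.ne]
  ne := h.ne
  left_notMem := by simp
  right_notMem := by simp
  mem_iff := by simp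
  clean := by
    intro a ha b hb hab
    simp only [Adj.toWalk, Walk.support_cons, Walk.support_nil, List.mem_cons, List.not_mem_nil,
      or_false] at ha hb
    rcases ha with rfl | rfl <;> rcases hb with rfl | rfl
    · exact (hab.ne rfl).elim
    · exact Or.inr rfl
    · exact Or.inr Sym2.eq_swap
    · exact (hab.ne rfl).elim

theorem IsArris.symm {x y : V} {A : G.Walk x y} {I : Set V} (h : IsArris A I) :
    IsArris A.reverse I where
  isPath := h.isPath.reverse
  ne := h.ne.symm
  left_notMem := h.right_notMem
  right_notMem := h.left_notMem
  mem_iff := by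
    intro a
    rw [Walk.support_reverse, List.mem_reverse, h.mem_iff]
    tauto
  clean := by
    intro a ha b hb hab
    rw [Walk.support_reverse, List.mem_reverse] at ha hb
    rw [Walk.edges_reverse, List.mem_reverse, Sym2.eq_swap (a := y)]
    exact h.clean a ha b hb hab

theorem IsArris.edge_of_length_eq_one {x y : V} {A : G.Walk x y} (h : A.length = 1) :
    s(x, y) ∈ A.edges := by
  cases A with
  | nil => simp at h
  | cons e p =>
    cases p with
    | nil => simp
    | cons e' q => simp at h

theorem IsArris.append {x y z : V} {A : G.Walk x y} {B : G.Walk y z} {I J : Set V}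
    (hA : IsArris A I) (hB : IsArris B J) (hxz : x ≠ z) (hIJ : Sep G I J) (hIz : Sep G I {z})
    (hxJ : Sep G {x} J) (hxy : G.Adj x y → A.length = 1) (hyz : G.Adj y z → B.length = 1) :
    IsArris (A.append B) (I ∪ {y} ∪ J) where
  isPath := by
    rw [Walk.isPath_def, Walk.support_append, List.nodup_append']
    refine ⟨hA.isPath.support_nodup, hB.isPath.support_nodup.tail, ?_⟩
    intro a ha hb
    have hay : a ≠ y := by
      rintro rfl
      have := hB.isPath.support_nodup
      rw [← Walk.cons_tail_support] at this
      exact (List.nodup_cons.1 this).1 hb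
    have ha' := (hA.mem_iff a).1 ha
    have hb' := (hB.mem_iff a).1 (List.mem_of_mem_tail hb)
    rcases ha' with rfl | rfl | ha'
    · rcases hb' with h | h | h
      · exact hay h
      · exact hxz h
      · exact (hxJ a rfl a h).1 rfl
    · exact hay rfl
    · rcases hb' with h | h | h
      · exact hay h
      · exact (hIz a ha' z rfl).1 h
      · exact (hIJ a ha' a h).1 rfl
  ne := hxz
  left_notMem := by
    rintro ((h | h) | h)
    · exact hA.left_notMem h
    · exact hA.ne h
    · exact (hxJ x rfl x h).1 rfl
  right_notMem := by
    rintro ((h | h) | h)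
    · exact (hIz z h z rfl).1 rfl
    · exact hB.ne h.symm
    · exact hB.right_notMem h
  mem_iff := by
    intro a
    rw [Walk.mem_support_append_iff, hA.mem_iff, hB.mem_iff]
    simp only [Set.mem_union, Set.mem_singleton_iff]
    tauto
  clean := by
    have key : ∀ a ∈ A.support, ∀ b ∈ B.support, G.Adj a b →
        s(a, b) ∈ (A.append B).edges ∨ s(a, b) = s(x, z) := by
      intro a ha b hb hab
      rw [Walk.edges_append, List.mem_append]
      have ha' := (hA.mem_iff a).1 ha
      have hb' := (hB.mem_iff b).1 hb
      have cA : b = y → s(a, b) ∈ A.edges := by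
        rintro rfl
        rcases hA.clean a ha b A.end_mem_support hab with h | h
        · exact h
        · rw [h]
          have : a = x := by
            rcases Sym2.eq_iff.1 h with ⟨h, -⟩ | ⟨h, h'⟩
            exacts [h, h.trans h']
          subst this
          exact IsArris.edge_of_length_eq_one (hxy hab)
      have cB : a = y → s(a, b) ∈ B.edges := by
        rintro rfl
        rcases hB.clean a B.start_mem_support b hb hab with h | h
        · exact h
        · rw [h]
          have : b = z := by simpa [hB.ne] using h
          subst this
          exact IsArris.edge_of_length_eq_one (hyz hab)
      rcases ha' with rfl | rfl | ha'
      · rcases hb' with rfl | rfl | hb'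
        · exact Or.inl (Or.inl (cA rfl))
        · exact Or.inr rfl
        · exact ((hxJ a rfl b hb').2 hab).elim
      · exact Or.inl (Or.inr (cB rfl))
      · rcases hb' with rfl | rfl | hb'
        · exact Or.inl (Or.inl (cA rfl))
        · exact ((hIz a ha' b rfl).2 hab).elim
        · exact ((hIJ a ha' b hb').2 hab).elim
    intro a ha b hb hab
    rw [Walk.mem_support_append_iff] at ha hb
    rcases ha with ha | ha <;> rcases hb with hb | hb
    · rcases hA.clean a ha b hb hab with h | h
      · exact Or.inl (by simp [h])
      · have hb' : a = y ∨ b = y := by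
          rcases Sym2.eq_iff.1 h with ⟨-, h⟩ | ⟨h, -⟩
          exacts [Or.inr h, Or.inl h]
        rcases hb' with rfl | rfl
        · rw [Sym2.eq_swap]
          exact key b hb a B.start_mem_support hab.symm
        · exact key a ha b B.start_mem_support hab
    · exact key a ha b hb hab
    · rw [Sym2.eq_swap]
      exact key b hb a ha hab.symm
    · rcases hB.clean a ha b hb hab with h | h
      · exact Or.inl (by simp [h])
      · have hb' : a = y ∨ b = y := by
          rcases Sym2.eq_iff.1 h with ⟨h, -⟩ | ⟨-, h⟩
          exacts [Or.inl h, Or.inr h]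
        rcases hb' with rfl | rfl
        · exact key a A.end_mem_support b hb hab
        · rw [Sym2.eq_swap]
          exact key b A.end_mem_support a ha hab.symm

theorem IsArris.isHole_append_reverse {x y : V} {A D : G.Walk x y} {I J : Set V}
    (hA : IsArris A I) (hD : IsArris D J) (hIJ : Sep G I J)
    (hxy : G.Adj x y → A.length = 1 ∨ D.length = 1) (hlen : 4 ≤ A.length + D.length) :
    IsHole G (A.append D.reverse) := by
  have hdis : A.support.tail.Disjoint D.reverse.support.tail := by
    intro a ha hb
    have hax : a ≠ x := by
      rintro rfl
      have := hA.isPath.support_nodup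
      rw [← Walk.cons_tail_support] at this
      exact (List.nodup_cons.1 this).1 ha
    have hay : a ≠ y := by
      rintro rfl
      have := hD.isPath.reverse.support_nodup
      rw [← Walk.cons_tail_support] at this
      exact (List.nodup_cons.1 this).1 hb
    have ha' := (hA.mem_iff a).1 (List.mem_of_mem_tail ha)
    have hb' := (hD.symm.mem_iff a).1 (List.mem_of_mem_tail hb)
    rcases ha' with h | h | ha'
    · exact hax h
    · exact hay h
    · rcases hb' with h | h | hb'
      · exact hay h
      · exact hax h
      · exact (hIJ a ha' a hb').1 rfl
  have hx : G.Adj x y → s(x, y) ∈ (A.append D.reverse).edges := by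
    intro h
    rw [Walk.edges_append, Walk.edges_reverse, List.mem_append, List.mem_reverse]
    exact (hxy h).imp IsArris.edge_of_length_eq_one IsArris.edge_of_length_eq_one
  refine ⟨hA.isPath.isCycle_append hD.isPath.reverse hdis ?_, ?_, ?_⟩
  · rw [Walk.length_reverse]; omega
  · rw [Walk.length_append, Walk.length_reverse]; omega
  · have kA : ∀ a ∈ A.support, ∀ b ∈ A.support, G.Adj a b →
        s(a, b) ∈ (A.append D.reverse).edges := by
      intro a ha b hb hab
      rcases hA.clean a ha b hb hab with h | h
      · simp [h]
      · rw [h]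
        exact hx (by rwa [← mem_edgeSet, ← h, mem_edgeSet])
    have kD : ∀ a ∈ D.support, ∀ b ∈ D.support, G.Adj a b →
        s(a, b) ∈ (A.append D.reverse).edges := by
      intro a ha b hb hab
      rcases hD.clean a ha b hb hab with h | h
      · simp [h]
      · rw [h]
        exact hx (by rwa [← mem_edgeSet, ← h, mem_edgeSet])
    have key : ∀ a ∈ A.support, ∀ b ∈ D.support, G.Adj a b →
        s(a, b) ∈ (A.append D.reverse).edges := by
      intro a ha b hb hab
      by_cases h1 : a ∈ D.support
      · exact kD a h1 b hb hab
      by_cases h2 : b ∈ A.support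
      · exact kA a ha b h2 hab
      have ha' : a ∈ I := by
        rcases (hA.mem_iff a).1 ha with rfl | rfl | h
        · exact (h1 D.start_mem_support).elim
        · exact (h1 D.end_mem_support).elim
        · exact h
      have hb' : b ∈ J := by
        rcases (hD.mem_iff b).1 hb with rfl | rfl | h
        · exact (h2 A.start_mem_support).elim
        · exact (h2 A.end_mem_support).elim
        · exact h
      exact ((hIJ a ha' b hb').2 hab).elim
    intro a ha b hb hab
    simp only [Walk.mem_support_append_iff, Walk.support_reverse, List.mem_reverse] at ha hb
    rcases ha with ha | ha <;> rcases hb with hb | hb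
    · exact kA a ha b hb hab
    · exact key a ha b hb hab
    · rw [Sym2.eq_swap]
      exact key b hb a ha hab.symm
    · exact kD a ha b hb hab

/-- There is an `(x, y)`-path of length `n` with interior `I` which is induced except that its ends
may be adjacent. -/
def Arris (G : SimpleGraph V) (x y : V) (n : ℕ) (I : Set V) : Prop :=
  ∃ A : G.Walk x y, IsArris A I ∧ A.length = n

theorem Arris.ne {x y : V} {n : ℕ} {I : Set V} (h : Arris G x y n I) : x ≠ y := h.choose_spec.1.ne

theorem Arris.one_le {x y : V} {n : ℕ} {I : Set V} (h : Arris G x y n I) : 1 ≤ n := by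
  obtain ⟨A, hA, rfl⟩ := h
  exact hA.one_le

theorem Arris.left_notMem {x y : V} {n : ℕ} {I : Set V} (h : Arris G x y n I) : x ∉ I :=
  h.choose_spec.1.left_notMem

theorem Arris.right_notMem {x y : V} {n : ℕ} {I : Set V} (h : Arris G x y n I) : y ∉ I :=
  h.choose_spec.1.right_notMem

theorem Arris.symm {x y : V} {n : ℕ} {I : Set V} (h : Arris G x y n I) : Arris G y x n I := by
  obtain ⟨A, hA, rfl⟩ := h
  exact ⟨A.reverse, hA.symm, by simp⟩

theorem Arris.edge {x y : V} (h : G.Adj x y) : Arris G x y 1 ∅ :=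
  ⟨h.toWalk, IsArris.edge h, by simp⟩

theorem Arris.append {x y z : V} {n m : ℕ} {I J : Set V} (hA : Arris G x y n I)
    (hB : Arris G y z m J) (hxz : x ≠ z) (hIJ : Sep G I J) (hIz : Sep G I {z})
    (hxJ : Sep G {x} J) (hxy : G.Adj x y → n = 1) (hyz : G.Adj y z → m = 1) :
    Arris G x z (n + m) (I ∪ {y} ∪ J) := by
  obtain ⟨A, hA, rfl⟩ := hA
  obtain ⟨B, hB, rfl⟩ := hB
  exact ⟨A.append B, hA.append hB hxz hIJ hIz hxJ hxy hyz, by simp⟩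

theorem Arris.adj_of_one {x y : V} {I : Set V} (h : Arris G x y 1 I) : G.Adj x y := by
  obtain ⟨A, hA, hn⟩ := h
  exact Walk.adj_of_length_eq_one hn

theorem Arris.eq_empty_of_one {x y : V} {I : Set V} (h : Arris G x y 1 I) : I = ∅ := by
  obtain ⟨A, hA, hn⟩ := h
  ext a
  simp only [Set.mem_empty_iff_false, iff_false]
  intro ha
  have h1 := (hA.mem_iff a).2 (Or.inr (Or.inr ha))
  have h2 : a = x ∨ a = y := by
    clear hA ha
    cases A with
    | nil => simp at hn
    | cons e p =>
      cases p with
      | nil => simpa using h1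
      | cons e' q => simp at hn
  rcases h2 with rfl | rfl
  · exact hA.left_notMem ha
  · exact hA.right_notMem ha

end NineHoles

namespace NineHoles

variable {G : SimpleGraph V}

/-- The interior vertex `a` splits an arris from `x` to `y` into an arris from `x` to `a` and an
arris from `a` to `y`. -/
structure Split (G : SimpleGraph V) (x y a : V) (n : ℕ) (I : Set V) (n₁ n₂ : ℕ) (I₁ I₂ : Set V) :
    Prop where
  left : Arris G x a n₁ I₁
  right : Arris G a y n₂ I₂
  len : n = n₁ + n₂
  eq : I = I₁ ∪ {a} ∪ I₂
  sep : Sep G I₁ I₂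
  sep_right : Sep G I₁ {y}
  sep_left : Sep G {x} I₂
  adj_left : G.Adj x a → n₁ = 1
  adj_right : G.Adj a y → n₂ = 1

theorem Split.symm {x y a : V} {n : ℕ} {I : Set V} {n₁ n₂ : ℕ} {I₁ I₂ : Set V}
    (h : Split G x y a n I n₁ n₂ I₁ I₂) : Split G y x a n I n₂ n₁ I₂ I₁ where
  left := h.right.symm
  right := h.left.symm
  len := by rw [h.len, add_comm]
  eq := by rw [h.eq]; ext; simp; tauto
  sep := h.sep.symm
  sep_right := h.sep_left.symm
  sep_left := h.sep_right.symm
  adj_left := fun e => h.adj_right e.symm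
  adj_right := fun e => h.adj_left e.symm

theorem Split.left_subset {x y a : V} {n : ℕ} {I : Set V} {n₁ n₂ : ℕ} {I₁ I₂ : Set V}
    (h : Split G x y a n I n₁ n₂ I₁ I₂) : I₁ ⊆ I := by
  rw [h.eq]
  exact fun _ ha => Or.inl (Or.inl ha)

theorem Split.right_subset {x y a : V} {n : ℕ} {I : Set V} {n₁ n₂ : ℕ} {I₁ I₂ : Set V}
    (h : Split G x y a n I n₁ n₂ I₁ I₂) : I₂ ⊆ I := h.symm.left_subset

theorem Arris.split {x y a : V} {n : ℕ} {I : Set V} (h : Arris G x y n I) (ha : a ∈ I) :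
    ∃ n₁ n₂ I₁ I₂, Split G x y a n I n₁ n₂ I₁ I₂ := by
  obtain ⟨A, hA, rfl⟩ := h
  obtain ⟨T, D, rfl⟩ := Walk.mem_support_iff_exists_append.1 ((hA.mem_iff a).2 (Or.inr (Or.inr ha)))
  have hax : a ≠ x := fun e => hA.left_notMem (e ▸ ha)
  have hay : a ≠ y := fun e => hA.right_notMem (e ▸ ha)
  have hT := hA.isPath.of_append_left
  have hD := hA.isPath.of_append_right
  have both : ∀ p ∈ T.support, p ∈ D.support → p = a := by
    intro p hp hp'
    by_contra hne
    exact hA.isPath.ne_of_mem_support_of_append hne hp hp' rfl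
  have hxD : x ∉ D.support := fun h => hax (both x T.start_mem_support h).symm
  have hyT : y ∉ T.support := fun h => hay (both y h D.end_mem_support).symm
  have memI : ∀ p, p ∈ T.support ∨ p ∈ D.support → p ≠ x → p ≠ y → p ∈ I := by
    intro p hp h1 h2
    rcases (hA.mem_iff p).1 (by rwa [Walk.mem_support_append_iff]) with h | h | h
    exacts [(h1 h).elim, (h2 h).elim, h]
  have memT : ∀ p ∈ I, p ∈ T.support ∨ p ∈ D.support := by
    intro p hp
    rw [← Walk.mem_support_append_iff]
    exact (hA.mem_iff p).2 (Or.inr (Or.inr hp))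
  have cross : ∀ p ∈ T.support, ∀ q ∈ D.support, p ≠ a → q ≠ a → G.Adj p q → p = x ∧ q = y := by
    intro p hp q hq hpa hqa hpq
    have h := hA.clean p (by simp [Walk.mem_support_append_iff, hp]) q
      (by simp [Walk.mem_support_append_iff, hq]) hpq
    rw [Walk.edges_append, List.mem_append] at h
    rcases h with (h | h) | h
    · exact (hqa (both q (T.snd_mem_support_of_mem_edges h) hq)).elim
    · exact (hpa (both p hp (D.fst_mem_support_of_mem_edges h))).elim
    · rcases Sym2.eq_iff.1 h with h | ⟨h, -⟩
      · exact h
      · subst h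
        exact (hyT hp).elim
  have hTA : IsArris T {p | p ∈ T.support ∧ p ≠ x ∧ p ≠ a} := by
    refine ⟨hT, hax.symm, by simp, by simp, ?_, ?_⟩
    · intro p
      by_cases h1 : p = x
      · simp [h1]
      · by_cases h2 : p = a <;> simp [h1, h2]
    · intro p hp q hq hpq
      have h := hA.clean p (by simp [Walk.mem_support_append_iff, hp]) q
        (by simp [Walk.mem_support_append_iff, hq]) hpq
      rw [Walk.edges_append, List.mem_append] at h
      rcases h with (h | h) | h
      · exact Or.inl h
      · have h1 := both p hp (D.fst_mem_support_of_mem_edges h)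
        have h2 := both q hq (D.snd_mem_support_of_mem_edges h)
        exact (hpq.ne (h1.trans h2.symm)).elim
      · rcases Sym2.eq_iff.1 h with ⟨-, h⟩ | ⟨h, -⟩
        · exact (hyT (h ▸ hq)).elim
        · exact (hyT (h ▸ hp)).elim
  have hDA : IsArris D {p | p ∈ D.support ∧ p ≠ a ∧ p ≠ y} := by
    refine ⟨hD, hay, by simp, by simp, ?_, ?_⟩
    · intro p
      by_cases h1 : p = a
      · simp [h1]
      · by_cases h2 : p = y <;> simp [h1, h2]
    · intro p hp q hq hpq
      have h := hA.clean p (by simp [Walk.mem_support_append_iff, hp]) q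
        (by simp [Walk.mem_support_append_iff, hq]) hpq
      rw [Walk.edges_append, List.mem_append] at h
      rcases h with (h | h) | h
      · have h1 := both p (T.fst_mem_support_of_mem_edges h) hp
        have h2 := both q (T.snd_mem_support_of_mem_edges h) hq
        exact (hpq.ne (h1.trans h2.symm)).elim
      · exact Or.inl h
      · rcases Sym2.eq_iff.1 h with ⟨h, -⟩ | ⟨-, h⟩
        · exact (hxD (h ▸ hp)).elim
        · exact (hxD (h ▸ hq)).elim
  refine ⟨T.length, D.length, _, _, ⟨T, hTA, rfl⟩, ⟨D, hDA, rfl⟩, by simp, ?_, ?_, ?_, ?_, ?_, ?_⟩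
  · ext p
    simp only [Set.mem_union, Set.mem_ofPred_eq, Set.mem_singleton_iff]
    constructor
    · intro hp
      have h1 : p ≠ x := fun e => hA.left_notMem (e ▸ hp)
      have h2 : p ≠ y := fun e => hA.right_notMem (e ▸ hp)
      have := memT p hp
      tauto
    · rintro ((⟨h1, h2, h3⟩ | rfl) | ⟨h1, h2, h3⟩)
      · exact memI p (Or.inl h1) h2 (fun e => hyT (e ▸ h1))
      · exact ha
      · exact memI p (Or.inr h1) (fun e => hxD (e ▸ h1)) h3
  · rintro p ⟨hp, hpx, hpa⟩ q ⟨hq, hqa, hqy⟩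
    refine ⟨?_, fun h => hpx (cross p hp q hq hpa hqa h).1⟩
    rintro rfl
    exact hpa (both p hp hq)
  · rintro p ⟨hp, hpx, hpa⟩ q rfl
    refine ⟨?_, fun h => hpx (cross p hp q D.end_mem_support hpa hay.symm h).1⟩
    rintro rfl
    exact hyT hp
  · rintro p rfl q ⟨hq, hqa, hqy⟩
    refine ⟨?_, fun h => hqy (cross p T.start_mem_support q hq hax.symm hqa h).2⟩
    rintro rfl
    exact hxD hq
  · intro h
    have h'' := hA.clean x (Walk.start_mem_support _) a (by simp [Walk.mem_support_append_iff]) h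
    have : s(x, a) ∈ T.edges := by
      rw [Walk.edges_append, List.mem_append] at h''
      rcases h'' with (h | h) | h
      · exact h
      · exact (hxD (D.fst_mem_support_of_mem_edges h)).elim
      · rcases Sym2.eq_iff.1 h with ⟨-, h⟩ | ⟨h, -⟩
        · exact (hay h).elim
        · exact (hyT (h ▸ T.start_mem_support)).elim
    exact hT.length_eq_one_of_mem_edges this
  · intro h
    have h'' := hA.clean a (by simp [Walk.mem_support_append_iff]) y (Walk.end_mem_support _) h
    have : s(a, y) ∈ D.edges := by
      rw [Walk.edges_append, List.mem_append] at h''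
      rcases h'' with (h | h) | h
      · exact (hyT (T.snd_mem_support_of_mem_edges h)).elim
      · exact h
      · rcases Sym2.eq_iff.1 h with ⟨h, -⟩ | ⟨h, -⟩
        · exact (hax h).elim
        · exact (hay h).elim
    exact hD.length_eq_one_of_mem_edges this

/-- Along an arris whose interior meets a set, there is a first interior vertex in that set. -/
theorem Arris.exists_first {x y : V} {n : ℕ} {I : Set V} (h : Arris G x y n I) (Q : V → Prop)
    (hQ : ∃ a ∈ I, Q a) :
    ∃ a ∈ I, Q a ∧ ∃ n₁ n₂ I₁ I₂, Split G x y a n I n₁ n₂ I₁ I₂ ∧ ∀ b ∈ I₁, ¬ Q b := by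
  have key : ∀ N : ℕ, ∀ a ∈ I, Q a → ∀ n₁ n₂ I₁ I₂, Split G x y a n I n₁ n₂ I₁ I₂ → n₁ ≤ N →
      ∃ a ∈ I, Q a ∧ ∃ n₁ n₂ I₁ I₂, Split G x y a n I n₁ n₂ I₁ I₂ ∧ ∀ b ∈ I₁, ¬ Q b := by
    intro N
    induction N with
    | zero =>
      intro a _ _ n₁ n₂ I₁ I₂ hs hN
      have := hs.left.one_le
      omega
    | succ N ih =>
      intro a ha hQa n₁ n₂ I₁ I₂ hs hN
      by_cases hb : ∃ b ∈ I₁, Q b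
      · obtain ⟨b, hb, hQb⟩ := hb
        obtain ⟨m₁, m₂, J₁, J₂, ht⟩ := hs.left.split hb
        have hm := ht.right.one_le
        have hby := hs.sep_right b hb y rfl
        have hJ₂ : J₂ ⊆ I₁ := ht.right_subset
        have hJ₁ : J₁ ⊆ I₁ := ht.left_subset
        refine ih b (hs.left_subset hb) hQb m₁ (m₂ + n₂) J₁ (J₂ ∪ {a} ∪ I₂)
          ⟨ht.left, ?_, ?_, ?_, ?_, ?_, ?_, ht.adj_left, fun e => (hby.2 e).elim⟩ ?_
        · exact ht.right.append hs.right hby.1 (hs.sep.mono hJ₂ subset_rfl)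
            (hs.sep_right.mono hJ₂ subset_rfl)
            (hs.sep.mono (Set.singleton_subset_iff.2 hb) subset_rfl) ht.adj_right hs.adj_right
        · rw [hs.len, ht.len, add_assoc]
        · rw [hs.eq, ht.eq]
          ext
          simp
          tauto
        · rw [sep_union_right, sep_union_right]
          exact ⟨⟨ht.sep, ht.sep_right⟩, hs.sep.mono hJ₁ subset_rfl⟩
        · exact hs.sep_right.mono hJ₁ subset_rfl
        · rw [sep_union_right, sep_union_right]
          refine ⟨⟨ht.sep_left, ?_⟩, hs.sep_left⟩
          rintro _ rfl _ rfl
          refine ⟨hs.left.ne, fun e => ?_⟩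
          have h1 := hs.adj_left e
          have h2 := ht.len
          have h3 := ht.left.one_le
          omega
        · have := ht.len
          omega
      · exact ⟨a, ha, hQa, n₁, n₂, I₁, I₂, hs, by simpa using hb⟩
  obtain ⟨a, ha, hQa⟩ := hQ
  obtain ⟨n₁, n₂, I₁, I₂, hs⟩ := h.split ha
  exact key n₁ a ha hQa n₁ n₂ I₁ I₂ hs le_rfl

/-- `a` and `b` are joined by a walk inside `S`. -/
def Linked (G : SimpleGraph V) (S : Set V) (a b : V) : Prop :=
  ∃ p : G.Walk a b, ∀ v ∈ p.support, v ∈ S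

theorem Linked.refl {S : Set V} {a : V} (h : a ∈ S) : Linked G S a a :=
  ⟨Walk.nil, by simpa using h⟩

theorem Linked.symm {S : Set V} {a b : V} (h : Linked G S a b) : Linked G S b a := by
  obtain ⟨p, hp⟩ := h
  exact ⟨p.reverse, by simpa using hp⟩

theorem Linked.trans {S : Set V} {a b c : V} (h : Linked G S a b) (h' : Linked G S b c) :
    Linked G S a c := by
  obtain ⟨p, hp⟩ := h
  obtain ⟨q, hq⟩ := h'
  refine ⟨p.append q, fun v hv => ?_⟩
  rw [Walk.mem_support_append_iff] at hv
  exact hv.elim (hp v) (hq v)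

theorem Linked.mono {S T : Set V} {a b : V} (h : Linked G S a b) (hST : S ⊆ T) :
    Linked G T a b := by
  obtain ⟨p, hp⟩ := h
  exact ⟨p, fun v hv => hST (hp v hv)⟩

theorem Linked.left_mem {S : Set V} {a b : V} (h : Linked G S a b) : a ∈ S := by
  obtain ⟨p, hp⟩ := h
  exact hp _ p.start_mem_support

theorem Linked.right_mem {S : Set V} {a b : V} (h : Linked G S a b) : b ∈ S := h.symm.left_mem

theorem Linked.of_adj {S : Set V} {a b : V} (h : G.Adj a b) (ha : a ∈ S) (hb : b ∈ S) :
    Linked G S a b :=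
  ⟨h.toWalk, by simp [ha, hb]⟩

theorem Arris.linked {x y : V} {n : ℕ} {I S : Set V} (h : Arris G x y n I) (hx : x ∈ S)
    (hy : y ∈ S) (hI : I ⊆ S) : Linked G S x y := by
  obtain ⟨A, hA, -⟩ := h
  refine ⟨A, fun v hv => ?_⟩
  rcases (hA.mem_iff v).1 hv with rfl | rfl | h
  exacts [hx, hy, hI h]

/-- A shortest walk inside `S` between two vertices is an arris. -/
theorem Linked.exists_arris {S : Set V} {x y : V} (h : Linked G S x y) (hne : x ≠ y) :
    ∃ n I, I ⊆ S ∧ Arris G x y n I ∧ (G.Adj x y → n = 1) := by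
  classical
  let P : ℕ → Prop := fun n => ∃ p : G.Walk x y, (∀ v ∈ p.support, v ∈ S) ∧ p.length = n
  have hP : ∃ n, P n := by
    obtain ⟨p, hp⟩ := h
    exact ⟨_, p, hp, rfl⟩
  obtain ⟨p, hp, hlen⟩ := Nat.find_spec hP
  have hmin : ∀ q : G.Walk x y, (∀ v ∈ q.support, v ∈ S) → p.length ≤ q.length := by
    intro q hq
    rw [hlen]
    exact Nat.find_min' hP ⟨q, hq, rfl⟩
  have hpath : p.IsPath := by
    have h1 := hmin p.bypass fun v hv => hp v (p.support_bypass_subset_support hv)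
    rw [← p.bypass_eq_self_of_length_le_length_bypass h1]
    exact p.bypass_isPath
  have shortcut : ∀ (a b : V) (T : G.Walk x a) (M : G.Walk a b) (D : G.Walk b y),
      p = T.append (M.append D) → G.Adj a b → s(a, b) ∈ p.edges := by
    intro a b T M D hpe hab
    have h1 := hmin (T.append (Walk.cons hab D)) (by
      intro v hv
      apply hp v
      rw [hpe]
      simp only [Walk.mem_support_append_iff, Walk.support_cons, List.mem_cons] at hv ⊢
      rcases hv with hv | rfl | hv
      · exact Or.inl hv
      · exact Or.inl T.end_mem_support
      · exact Or.inr (Or.inr hv))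
    rw [hpe] at h1
    simp only [Walk.length_append, Walk.length_cons] at h1
    have h2 : M.length ≠ 0 := fun h0 => hab.ne (Walk.eq_of_length_eq_zero h0)
    have h3 : M.length = 1 := by omega
    rw [hpe]
    simp [IsArris.edge_of_length_eq_one h3]
  refine ⟨p.length, {v | v ∈ p.support ∧ v ≠ x ∧ v ≠ y}, fun v hv => hp v hv.1,
    ⟨p, ⟨hpath, hne, by simp, by simp, ?_, ?_⟩, rfl⟩, fun hadj => ?_⟩
  · intro a
    by_cases h1 : a = x
    · simp [h1]
    · by_cases h2 : a = y <;> simp [h1, h2]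
  · intro a ha b hb hab
    left
    obtain ⟨T, D, hTD⟩ := Walk.mem_support_iff_exists_append.1 ha
    rw [hTD, Walk.mem_support_append_iff] at hb
    rcases hb with hb | hb
    · obtain ⟨T₁, T₂, hT⟩ := Walk.mem_support_iff_exists_append.1 hb
      rw [Sym2.eq_swap]
      exact shortcut b a T₁ T₂ D (by rw [hTD, hT, Walk.append_assoc]) hab.symm
    · obtain ⟨D₁, D₂, hD⟩ := Walk.mem_support_iff_exists_append.1 hb
      exact shortcut a b T D₁ D₂ (by rw [hTD, hD]) hab
  · have h1 := hmin hadj.toWalk (by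
      simp only [Adj.toWalk, Walk.support_cons, Walk.support_nil, List.mem_cons, List.not_mem_nil,
        or_false]
      rintro v (rfl | rfl)
      exacts [h.left_mem, h.right_mem])
    have h2 : p.length ≠ 0 := fun h0 => hne (Walk.eq_of_length_eq_zero h0)
    simp only [Adj.toWalk, Walk.length_cons, Walk.length_nil] at h1
    omega

theorem Arris.exists_adj {x y : V} {n : ℕ} {I : Set V} (h : Arris G x y n I) (hn : n ≠ 1) :
    ∃ a ∈ I, G.Adj x a := by
  obtain ⟨A, hA, rfl⟩ := h
  cases A with
  | nil => exact (hA.ne rfl).elim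
  | @cons _ v _ e p =>
    refine ⟨v, ?_, e⟩
    rcases (hA.mem_iff v).1 (by simp) with h | rfl | h
    · exact (e.ne h.symm).elim
    · have hp := hA.isPath.of_cons
      rw [Walk.isPath_iff_nil, ← Walk.length_eq_zero_iff] at hp
      simp [hp] at hn
    · exact h

/-- All vertices of `D` are joined inside `D`. -/
def Conn (G : SimpleGraph V) (D : Set V) : Prop := ∀ a ∈ D, ∀ b ∈ D, Linked G D a b

/-- A shortest path leading from `x` through `D` to a vertex with the property `Q`. -/
theorem Linked.exists_first {D : Set V} {x a q : V} (h : Linked G D a q) (hx : x ∉ D)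
    (hxa : G.Adj x a) {Q : V → Prop} (hQ : Q q) :
    ∃ p ∈ D, Q p ∧ ∃ n I, I ⊆ D ∧ Arris G x p n I ∧ (G.Adj x p → n = 1) ∧ ∀ b ∈ I, ¬ Q b := by
  have hxq : x ≠ q := fun e => hx (e ▸ h.right_mem)
  obtain ⟨n, I, hI, hA, hadj⟩ := ((Linked.of_adj hxa (Set.mem_insert x D)
    (Set.mem_insert_of_mem x h.left_mem)).trans (h.mono (Set.subset_insert x D))).exists_arris hxq
  have hI' : I ⊆ D := fun b hb =>
    (hI hb).resolve_left fun e => hA.left_notMem (e ▸ hb)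
  by_cases hq : ∃ b ∈ I, Q b
  · obtain ⟨p, hp, hpQ, n₁, n₂, I₁, I₂, hs, hfirst⟩ := hA.exists_first Q hq
    exact ⟨p, hI' hp, hpQ, n₁, I₁, hs.left_subset.trans hI', hs.left, hs.adj_left, hfirst⟩
  · push Not at hq
    exact ⟨q, h.right_mem, hQ, n, I, hI', hA, hadj, hq⟩

/-- `f` parametrises an induced cycle of length nine. -/
structure IsNonagon (G : SimpleGraph V) (f : ZMod 9 → V) : Prop where
  inj : Function.Injective f
  adj_iff : ∀ i j, G.Adj (f i) (f j) ↔ j = i + 1 ∨ i = j + 1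

theorem exists_isNonagon {v : V} {w : G.Walk v v} (hw : IsHole G w) (h9 : w.length = 9) :
    ∃ f : ZMod 9 → V, IsNonagon G f ∧ ∀ a, a ∈ Set.range f ↔ a ∈ w.support := by
  have hper : ∀ i : ZMod 9, w.getVert (i + 1).val = w.getVert (i.val + 1) := by
    intro i
    by_cases hi : i = 8
    · subst hi
      have h1 : ((8 : ZMod 9) + 1).val = 0 := by decide
      have h2 : (8 : ZMod 9).val + 1 = w.length := by rw [h9]; decide
      rw [h1, h2, Walk.getVert_length, Walk.getVert_zero]
    · have : (i + 1).val = i.val + 1 := by revert i; decide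
      rw [this]
  have hlt : ∀ i : ZMod 9, i.val ≤ 8 := by decide
  have hinj : Function.Injective fun i : ZMod 9 => w.getVert i.val := by
    intro i j hij
    have := hw.1.getVert_injOn' (by rw [Set.mem_ofPred_eq, h9]; exact hlt i)
      (by rw [Set.mem_ofPred_eq, h9]; exact hlt j) hij
    exact ZMod.val_injective 9 this
  have hmem : ∀ i, w.getVert i ∈ w.support := fun i => w.getVert_mem_support i
  have hval : ∀ n, n < 9 → ((n : ℕ) : ZMod 9).val = n := fun n hn => ZMod.val_cast_of_lt hn
  refine ⟨fun i => w.getVert i.val, ⟨hinj, fun i j => ⟨fun h => ?_, ?_⟩⟩, fun a => ⟨?_, ?_⟩⟩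
  · have he := hw.2.2 _ (hmem i.val) _ (hmem j.val) h
    rw [Walk.mk_mem_edges_iff_exists] at he
    obtain ⟨n, hn, he⟩ := he
    rw [h9] at hn
    have e1 : w.getVert n = w.getVert ((n : ZMod 9)).val := by rw [hval n hn]
    have e2 : w.getVert (n + 1) = w.getVert ((n : ZMod 9) + 1).val := by rw [hper, hval n hn]
    rw [e1, e2] at he
    rcases Sym2.eq_iff.1 he with ⟨h1, h2⟩ | ⟨h1, h2⟩
    · left
      rw [← hinj h1, ← hinj h2]
    · right
      rw [← hinj h1, ← hinj h2]
  · rintro (rfl | rfl)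
    · simp only [hper]
      exact w.adj_getVert_succ (by have := hlt i; omega)
    · simp only [hper]
      exact (w.adj_getVert_succ (by have := hlt j; omega)).symm
  · rintro ⟨i, rfl⟩
    exact hmem _
  · intro ha
    obtain ⟨n, rfl, hn⟩ := Walk.mem_support_iff_exists_getVert.1 ha
    rw [h9] at hn
    rcases Nat.lt_or_ge n 9 with h | h
    · exact ⟨(n : ZMod 9), by simp only [hval n h]⟩
    · have : n = w.length := by omega
      subst this
      exact ⟨0, by simp⟩

end NineHoles

namespace NineHoles

variable {G : SimpleGraph V}

/-- Every cycle has length at least nine, every odd hole has length nine, and there is neither an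
odd `K4`-subdivision nor a balanced one of type `(1, 2)`. -/
structure Good (G : SimpleGraph V) : Prop where
  nine_le : ∀ (v : V) (w : G.Walk v v), w.IsCycle → 9 ≤ w.length
  eq_nine : ∀ (v : V) (w : G.Walk v v), IsOddHole G w → w.length = 9
  not_odd : ¬ HasOddK4 G
  not_balanced : ¬ HasBalancedK4 G

theorem Good.hole {x y : V} {n m : ℕ} {I J : Set V} (hG : Good G) (hA : Arris G x y n I)
    (hD : Arris G x y m J) (hIJ : Sep G I J) (hxy : G.Adj x y → n = 1 ∨ m = 1)
    (hlen : 4 ≤ n + m) :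
    9 ≤ n + m ∧ (Odd (n + m) → n + m = 9 ∧
      ∃ f, IsNonagon G f ∧ Set.range f = {x, y} ∪ I ∪ J) := by
  obtain ⟨A, hA, rfl⟩ := hA
  obtain ⟨D, hD, rfl⟩ := hD
  have hh := hA.isHole_append_reverse hD hIJ hxy hlen
  have hl : (A.append D.reverse).length = A.length + D.length := by simp
  refine ⟨hl ▸ hG.nine_le _ _ hh.1, fun ho => ?_⟩
  have h9 := hG.eq_nine _ _ ⟨hh, hl ▸ ho⟩
  refine ⟨hl ▸ h9, ?_⟩
  obtain ⟨f, hf, hr⟩ := exists_isNonagon hh h9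
  refine ⟨f, hf, ?_⟩
  ext a
  rw [hr, Walk.mem_support_append_iff, Walk.support_reverse, List.mem_reverse, hA.mem_iff,
    hD.mem_iff]
  simp only [Set.mem_union, Set.mem_insert_iff, Set.mem_singleton_iff]
  tauto

/-- Six arrises forming a `K4`-subdivision without further edges. -/
structure K4Cfg (G : SimpleGraph V) (u1 u2 u3 u4 : V) (p1 p2 q1 q2 l1 l2 : ℕ)
    (P1 P2 Q1 Q2 L1 L2 : Set V) : Prop where
  aP1 : Arris G u1 u2 p1 P1
  aP2 : Arris G u3 u4 p2 P2
  aQ1 : Arris G u2 u3 q1 Q1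
  aQ2 : Arris G u1 u4 q2 Q2
  aL1 : Arris G u1 u3 l1 L1
  aL2 : Arris G u2 u4 l2 L2
  eP1 : G.Adj u1 u2 → p1 = 1
  eP2 : G.Adj u3 u4 → p2 = 1
  eQ1 : G.Adj u2 u3 → q1 = 1
  eQ2 : G.Adj u1 u4 → q2 = 1
  eL1 : G.Adj u1 u3 → l1 = 1
  eL2 : G.Adj u2 u4 → l2 = 1
  cP1 : Sep G P1 {u3, u4}
  cP2 : Sep G P2 {u1, u2}
  cQ1 : Sep G Q1 {u1, u4}
  cQ2 : Sep G Q2 {u2, u3}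
  cL1 : Sep G L1 {u2, u4}
  cL2 : Sep G L2 {u1, u3}
  sP1P2 : Sep G P1 P2
  sP1Q1 : Sep G P1 Q1
  sP1Q2 : Sep G P1 Q2
  sP1L1 : Sep G P1 L1
  sP1L2 : Sep G P1 L2
  sP2Q1 : Sep G P2 Q1
  sP2Q2 : Sep G P2 Q2
  sP2L1 : Sep G P2 L1
  sP2L2 : Sep G P2 L2
  sQ1Q2 : Sep G Q1 Q2
  sQ1L1 : Sep G Q1 L1
  sQ1L2 : Sep G Q1 L2
  sQ2L1 : Sep G Q2 L1
  sQ2L2 : Sep G Q2 L2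
  sL1L2 : Sep G L1 L2

variable {u1 u2 u3 u4 : V} {p1 p2 q1 q2 l1 l2 : ℕ} {P1 P2 Q1 Q2 L1 L2 : Set V}

theorem K4Cfg.swap_ends (h : K4Cfg G u1 u2 u3 u4 p1 p2 q1 q2 l1 l2 P1 P2 Q1 Q2 L1 L2) :
    K4Cfg G u2 u1 u4 u3 p1 p2 q2 q1 l2 l1 P1 P2 Q2 Q1 L2 L1 where
  aP1 := h.aP1.symm
  aP2 := h.aP2.symm
  aQ1 := h.aQ2
  aQ2 := h.aQ1
  aL1 := h.aL2
  aL2 := h.aL1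
  eP1 := fun e => h.eP1 e.symm
  eP2 := fun e => h.eP2 e.symm
  eQ1 := h.eQ2
  eQ2 := h.eQ1
  eL1 := h.eL2
  eL2 := h.eL1
  cP1 := Set.pair_comm u3 u4 ▸ h.cP1
  cP2 := Set.pair_comm u1 u2 ▸ h.cP2
  cQ1 := h.cQ2
  cQ2 := h.cQ1
  cL1 := h.cL2
  cL2 := h.cL1
  sP1P2 := h.sP1P2
  sP1Q1 := h.sP1Q2
  sP1Q2 := h.sP1Q1
  sP1L1 := h.sP1L2
  sP1L2 := h.sP1L1
  sP2Q1 := h.sP2Q2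
  sP2Q2 := h.sP2Q1
  sP2L1 := h.sP2L2
  sP2L2 := h.sP2L1
  sQ1Q2 := h.sQ1Q2.symm
  sQ1L1 := h.sQ2L2
  sQ1L2 := h.sQ2L1
  sQ2L1 := h.sQ1L2
  sQ2L2 := h.sQ1L1
  sL1L2 := h.sL1L2.symm

theorem K4Cfg.swap_tail (h : K4Cfg G u1 u2 u3 u4 p1 p2 q1 q2 l1 l2 P1 P2 Q1 Q2 L1 L2) :
    K4Cfg G u1 u2 u4 u3 p1 p2 l2 l1 q2 q1 P1 P2 L2 L1 Q2 Q1 where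
  aP1 := h.aP1
  aP2 := h.aP2.symm
  aQ1 := h.aL2
  aQ2 := h.aL1
  aL1 := h.aQ2
  aL2 := h.aQ1
  eP1 := h.eP1
  eP2 := fun e => h.eP2 e.symm
  eQ1 := h.eL2
  eQ2 := h.eL1
  eL1 := h.eQ2
  eL2 := h.eQ1
  cP1 := Set.pair_comm u3 u4 ▸ h.cP1
  cP2 := h.cP2
  cQ1 := h.cL2
  cQ2 := h.cL1
  cL1 := h.cQ2
  cL2 := h.cQ1
  sP1P2 := h.sP1P2
  sP1Q1 := h.sP1L2
  sP1Q2 := h.sP1L1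
  sP1L1 := h.sP1Q2
  sP1L2 := h.sP1Q1
  sP2Q1 := h.sP2L2
  sP2Q2 := h.sP2L1
  sP2L1 := h.sP2Q2
  sP2L2 := h.sP2Q1
  sQ1Q2 := h.sL1L2.symm
  sQ1L1 := h.sQ2L2.symm
  sQ1L2 := h.sQ1L2.symm
  sQ2L1 := h.sQ2L1.symm
  sQ2L2 := h.sQ1L1.symm
  sL1L2 := h.sQ1Q2.symm

theorem sep_pair_right {A : Set V} {x y : V} : Sep G A {x, y} ↔ Sep G A {x} ∧ Sep G A {y} := by
  rw [← Set.singleton_union, sep_union_right]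

theorem isHole_triangle {x y z : V} {A : G.Walk x y} {B : G.Walk y z} {D : G.Walk x z}
    {I J K : Set V} (hA : IsArris A I) (hB : IsArris B J) (hD : IsArris D K) (hIJ : Sep G I J)
    (hIK : Sep G I K) (hJK : Sep G J K) (hI : Sep G I {z}) (hJ : Sep G J {x}) (hK : Sep G K {y})
    (eA : G.Adj x y → A.length = 1) (eB : G.Adj y z → B.length = 1)
    (eD : G.Adj x z → D.length = 1) (hlen : 4 ≤ A.length + B.length + D.length) :
    IsHole G ((A.append B).append D.reverse) := by
  refine (hA.append hB hD.ne hIJ hI hJ.symm eA eB).isHole_append_reverse hD ?_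
    (fun e => Or.inr (eD e)) (by simpa using hlen)
  rw [sep_union_left, sep_union_left]
  exact ⟨⟨hIK, hK.symm⟩, hJK⟩

theorem not_triangle (hG : Good G) {x y z : V} (h1 : G.Adj x y) (h2 : G.Adj y z)
    (h3 : G.Adj x z) : False := by
  have hp : ((Walk.cons h1 (Walk.cons h2 Walk.nil)).IsPath) := by
    simp only [Walk.cons_isPath_iff, Walk.IsPath.nil, Walk.support_cons, Walk.support_nil,
      List.mem_cons, List.not_mem_nil, or_false, true_and, not_or]
    exact ⟨h2.ne, h1.ne, h3.ne⟩
  have hc : ((Walk.cons h1 (Walk.cons h2 Walk.nil)).append h3.symm.toWalk).IsCycle := by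
    refine hp.isCycle_append (by simp [h3.ne.symm]) ?_ (by simp)
    simp [h1.ne, h3.ne]
  have := hG.nine_le _ _ hc
  simp at this

/-- In a good graph, a triangle of arrises that are pairwise far apart spans a hole. -/
theorem Good.triangle_length (hG : Good G) {x y z : V} {a b d : ℕ} {I J K : Set V}
    (hA : Arris G x y a I) (hB : Arris G y z b J) (hD : Arris G x z d K) :
    4 ≤ a + b + d := by
  by_contra hlt
  have h1 := hA.one_le
  have h2 := hB.one_le
  have h3 := hD.one_le
  have e1 : a = 1 := by omega
  have e2 : b = 1 := by omega
  have e3 : d = 1 := by omega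
  subst e1 e2 e3
  exact not_triangle hG hA.adj_of_one hB.adj_of_one hD.adj_of_one

theorem K4Cfg.faces (hG : Good G)
    (h : K4Cfg G u1 u2 u3 u4 p1 p2 q1 q2 l1 l2 P1 P2 Q1 Q2 L1 L2) :
    ∃ H : K4Sub G, IsHole G H.C1 ∧ IsHole G H.C2 ∧ IsHole G H.C3 ∧ IsHole G H.C4 ∧
      H.C1.length = p1 + q1 + l1 ∧ H.C2.length = p1 + l2 + q2 ∧ H.C3.length = q1 + p2 + l2 ∧
      H.C4.length = l1 + p2 + q2 ∧ H.Q1.length = q1 ∧ H.L2.length = l2 := by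
  have len1 := hG.triangle_length h.aP1 h.aQ1 h.aL1
  have len2 := hG.triangle_length h.aP1 h.aL2 h.aQ2
  have len3 := hG.triangle_length h.aQ1 h.aP2 h.aL2
  have len4 := hG.triangle_length h.aL1 h.aP2 h.aQ2
  have n1 := h.aP1.ne
  have n2 := h.aP2.ne
  have n3 := h.aQ1.ne
  have n4 := h.aQ2.ne
  have n5 := h.aL1.ne
  have n6 := h.aL2.ne
  obtain ⟨⟨A1, h1, r1⟩, ⟨A2, h2, r2⟩, ⟨A3, h3, r3⟩, ⟨A4, h4, r4⟩, ⟨A5, h5, r5⟩, ⟨A6, h6, r6⟩,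
    eP1, eP2, eQ1, eQ2, eL1, eL2, cP1, cP2, cQ1, cQ2, cL1, cL2, s1, s2, s3, s4, s5, s6, s7, s8, s9,
    s10, s11, s12, s13, s14, s15⟩ := h
  rw [sep_pair_right] at cP1 cP2 cQ1 cQ2 cL1 cL2
  have disj : ∀ {a b c d : V} {A : G.Walk a b} {B : G.Walk c d} {I J : Set V}, IsArris A I →
      IsArris B J → a ≠ c → a ≠ d → b ≠ c → b ≠ d → Sep G I J → Sep G I {c} → Sep G I {d} →
      Sep G J {a} → Sep G J {b} → ∀ p ∈ A.support, p ∉ B.support := by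
    intro a b c d A B I J hA hB e1 e2 e3 e4 e5 e6 e7 e8 e9 p hp hp'
    rcases (hA.mem_iff p).1 hp with h1 | h1 | h1 <;> rcases (hB.mem_iff p).1 hp' with h2 | h2 | h2
    · exact e1 (h1.symm.trans h2)
    · exact e2 (h1.symm.trans h2)
    · exact (e8 p h2 a rfl).1 h1
    · exact e3 (h1.symm.trans h2)
    · exact e4 (h1.symm.trans h2)
    · exact (e9 p h2 b rfl).1 h1
    · exact (e6 p h1 c rfl).1 h2
    · exact (e7 p h1 d rfl).1 h2
    · exact (e5 p h1 p h2).1 rfl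
  have d1 := disj h1 h2 n5 n4 n3 n6 s1 cP1.1 cP1.2 cP2.1 cP2.2
  have d2 := disj h3 h4 n1.symm n6 n5.symm n2 s10 cQ1.1 cQ1.2 cQ2.1 cQ2.2
  have d3 := disj h5 h6 n1 n4 n3.symm n2 s15 cL1.1 cL1.2 cL2.1 cL2.2
  have t1 : 4 ≤ A1.length + A3.length + A5.length := by omega
  have t2 : 4 ≤ A1.length + A6.length + A4.length := by omega
  have t3 : 4 ≤ A3.length + A2.length + A6.length := by omega
  have t4 : 4 ≤ A5.length + A2.length + A4.length := by omega
  refine ⟨⟨u1, u2, u3, u4, A1, A2, A3, A4, A5, A6, by simp [n1, n2, n3, n4, n5, n6], h1.isPath,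
    h2.isPath, h3.isPath, h4.isPath, h5.isPath, h6.isPath, d1, d2, d3⟩, ?_, ?_, ?_, ?_, ?_, ?_, ?_,
    ?_, r3, r6⟩
  · exact isHole_triangle h1 h3 h5 s2 s4 s11 cP1.1 cQ1.1 cL1.1 (fun e => r1.trans (eP1 e))
      (fun e => r3.trans (eQ1 e)) (fun e => r5.trans (eL1 e)) t1
  · exact isHole_triangle h1 h6 h4 s5 s3 s14.symm cP1.2 cL2.1 cQ2.1 (fun e => r1.trans (eP1 e))
      (fun e => r6.trans (eL2 e)) (fun e => r4.trans (eQ2 e)) t2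
  · exact isHole_triangle h3 h2 h6 s6.symm s12 s9 cQ1.2 cP2.2 cL2.2 (fun e => r3.trans (eQ1 e))
      (fun e => r2.trans (eP2 e)) (fun e => r6.trans (eL2 e)) t3
  · exact isHole_triangle h5 h2 h4 s8.symm s13.symm s7 cL1.2 cP2.1 cQ2.2
      (fun e => r5.trans (eL1 e)) (fun e => r2.trans (eP2 e)) (fun e => r4.trans (eQ2 e)) t4
  · simp [K4Sub.C1, r1, r3, r5]
  · simp [K4Sub.C2, r1, r6, r4]
  · simp [K4Sub.C3, r3, r2, r6]
  · simp [K4Sub.C4, r5, r2, r4]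

/-- Deleting the arris between `u1` and `u4` and the one between `u2` and `u3` leaves a hole, unless
one of them is an edge. -/
theorem K4Cfg.quad (hG : Good G)
    (h : K4Cfg G u1 u2 u3 u4 p1 p2 q1 q2 l1 l2 P1 P2 Q1 Q2 L1 L2) (h1 : 2 ≤ q1) (h2 : 2 ≤ q2)
    (ho : Odd (p1 + l2 + p2 + l1)) : p1 + l2 + p2 + l1 = 9 := by
  have n1 : ¬ G.Adj u2 u3 := fun e => by have := h.eQ1 e; omega
  have n2 : ¬ G.Adj u1 u4 := fun e => by have := h.eQ2 e; omega
  have b1 := sep_pair_right.1 h.cP1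
  have b2 := sep_pair_right.1 h.cP2
  have b3 := sep_pair_right.1 h.cL1
  have b4 := sep_pair_right.1 h.cL2
  have k1 := h.aP1.append h.aL2 h.aQ2.ne h.sP1L2 b1.2 b4.1.symm h.eP1 h.eL2
  have k2 := h.aL1.append h.aP2 h.aQ2.ne h.sP2L1.symm b3.2 b2.1.symm h.eL1 h.eP2
  have k3 := h.aP1.one_le
  have k4 := h.aP2.one_le
  have k5 := h.aL1.one_le
  have k6 := h.aL2.one_le
  have hs : Sep G (P1 ∪ {u2} ∪ L2) (L1 ∪ {u3} ∪ P2) := by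
    simp only [sep_union_left, sep_union_right]
    refine ⟨⟨⟨⟨h.sP1L1, b3.1.symm⟩, h.sL1L2.symm⟩, ⟨b1.1, ?_⟩, b4.2⟩,
      ⟨h.sP1P2, b2.2.symm⟩, h.sP2L2.symm⟩
    rintro _ rfl _ rfl
    exact ⟨h.aQ1.ne, n1⟩
  have := (hG.hole k1 k2 hs (fun e => (n2 e).elim) (by omega)).2 (by convert ho using 1; ring)
  omega

theorem K4Cfg.not_balanced (hG : Good G)
    (h : K4Cfg G u1 u2 u3 u4 p1 p2 q1 q2 l1 l2 P1 P2 Q1 Q2 L1 L2) (h1 : Odd (p1 + q1 + l1))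
    (h2 : Odd (p1 + q2 + l2)) (h3 : Even (q1 + p2 + l2)) (hq : q1 = 1) : l2 = 1 := by
  by_contra hl
  obtain ⟨H, a1, a2, a3, a4, e1, e2, e3, e4, e5, e6⟩ := h.faces hG
  refine hG.not_balanced ⟨H, ⟨a1, by rwa [e1]⟩, ⟨a2, ?_⟩, a3, by rwa [e3], a4, ?_, by omega, ?_⟩
  · rw [e2]; convert h2 using 1; ring
  · rw [e4]; grind
  · have := h.aL2.one_le; omega

/-- The key dichotomy for a `K4`-subdivision with two odd faces. -/
theorem K4Cfg.dichotomy (hG : Good G)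
    (h : K4Cfg G u1 u2 u3 u4 p1 p2 q1 q2 l1 l2 P1 P2 Q1 Q2 L1 L2) (h1 : Odd (p1 + q1 + l1))
    (h2 : Odd (p1 + q2 + l2)) : (q1 = 1 ∧ l2 = 1) ∨ (q2 = 1 ∧ l1 = 1) := by
  have hp2 := h.aP2.one_le
  have hq1 := h.aQ1.one_le
  have hq2 := h.aQ2.one_le
  have hl1 := h.aL1.one_le
  have hl2 := h.aL2.one_le
  obtain ⟨H, a1, a2, a3, a4, e1, e2, e3, e4, e5, e6⟩ := h.faces hG
  have g1 := hG.eq_nine _ _ ⟨a1, by rwa [e1]⟩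
  have g2 := hG.eq_nine _ _ ⟨a2, by rw [e2]; convert h2 using 1; ring⟩
  rcases Nat.even_or_odd (q1 + p2 + l2) with h3 | h3
  · have i1 := h.not_balanced hG h1 h2 h3
    have i2 := h.swap_ends.not_balanced hG (by grind) (by grind) (by grind)
    have i3 := h.swap_tail.not_balanced hG (by grind) (by grind) (by grind)
    have i4 := h.swap_tail.swap_ends.not_balanced hG (by grind) (by grind) (by grind)
    by_cases b : (2 ≤ q1 ∧ 2 ≤ q2) ∧ 2 ≤ l1 ∧ 2 ≤ l2
    · have j1 := h.quad hG b.1.1 b.1.2 (by grind)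
      have j2 := h.swap_tail.quad hG b.2.2 b.2.1 (by grind)
      omega
    · omega
  · exfalso
    refine hG.not_odd ⟨H, ⟨a1, by rwa [e1]⟩, ⟨a2, ?_⟩, ⟨a3, by rwa [e3]⟩, ⟨a4, ?_⟩⟩
    · rw [e2]; convert h2 using 1; ring
    · rw [e4]; grind

end NineHoles

namespace NineHoles

variable {G : SimpleGraph V} {f : ZMod 9 → V}

/-- The indices strictly between `i` and `j` in the positive direction. -/
def arc (i j : ZMod 9) : Set (ZMod 9) := {k | 0 < (k - i).val ∧ (k - i).val < (j - i).val}

/-- No index of `S` equals or is cyclically adjacent to an index of `T`. -/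
def Apart (S T : Set (ZMod 9)) : Prop := ∀ i ∈ S, ∀ j ∈ T, i ≠ j ∧ j ≠ i + 1 ∧ i ≠ j + 1

theorem IsNonagon.sep (hf : IsNonagon G f) {S T : Set (ZMod 9)} (h : Apart S T) :
    Sep G (f '' S) (f '' T) := by
  rintro _ ⟨i, hi, rfl⟩ _ ⟨j, hj, rfl⟩
  obtain ⟨h1, h2, h3⟩ := h i hi j hj
  refine ⟨fun e => h1 (hf.inj e), fun e => ?_⟩
  rcases (hf.adj_iff i j).1 e with h | h
  exacts [h2 h, h3 h]

theorem IsNonagon.sep_singleton (hf : IsNonagon G f) {S : Set (ZMod 9)} {j : ZMod 9}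
    (h : Apart S {j}) : Sep G (f '' S) {f j} := by
  have := hf.sep h
  rwa [Set.image_singleton] at this

theorem Apart.symm {S T : Set (ZMod 9)} (h : Apart S T) : Apart T S := by
  intro i hi j hj
  obtain ⟨h1, h2, h3⟩ := h j hj i hi
  exact ⟨h1.symm, h3, h2⟩

theorem Apart.mono {S T S' T' : Set (ZMod 9)} (h : Apart S T) (hS : S' ⊆ S) (hT : T' ⊆ T) :
    Apart S' T' := fun i hi j hj => h i (hS hi) j (hT hj)

theorem val_pos {i j : ZMod 9} (h : i ≠ j) : 0 < (j - i).val :=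
  Nat.pos_of_ne_zero fun e => h (sub_eq_zero.1 ((ZMod.val_eq_zero _).1 e)).symm

theorem IsNonagon.arris_arc (hf : IsNonagon G f) {i j : ZMod 9} (hij : i ≠ j) :
    Arris G (f i) (f j) (j - i).val (f '' arc i j) := by
  have key : ∀ n : ℕ, n ≤ 7 → Arris G (f i) (f (i + (n + 1 : ℕ))) (n + 1)
      (f '' {k | 0 < (k - i).val ∧ (k - i).val < n + 1}) := by
    intro n
    induction n with
    | zero =>
      intro _
      have e : {k : ZMod 9 | 0 < (k - i).val ∧ (k - i).val < 0 + 1} = ∅ := by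
        ext k
        simp only [Set.mem_ofPred_eq, Set.mem_empty_iff_false, iff_false]
        omega
      rw [e, Set.image_empty]
      exact Arris.edge ((hf.adj_iff _ _).2 (Or.inl (by simp)))
    | succ n ih =>
      intro hn
      have hA := ih (by omega)
      have hadj : G.Adj (f (i + (n + 1 : ℕ))) (f (i + (n + 1 + 1 : ℕ))) :=
        (hf.adj_iff _ _).2 (Or.inl (by push_cast; ring))
      have hn' : n ≤ 6 := by omega
      have := hA.append (Arris.edge hadj) (z := f (i + (n + 1 + 1 : ℕ))) ?_ sep_empty_right ?_
        sep_empty_right ?_ (fun _ => rfl)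
      · convert this using 1
        rw [Set.union_empty, ← Set.image_singleton, ← Set.image_union]
        congr 1
        ext k
        simp only [Set.mem_ofPred_eq, Set.mem_union, Set.mem_singleton_iff]
        have : ∀ n : Fin 7, ∀ i k : ZMod 9, (0 < (k - i).val ∧ (k - i).val < n + 1 + 1) ↔
          (0 < (k - i).val ∧ (k - i).val < n + 1) ∨ k = i + (n + 1 : ℕ) := by decide +kernel
        exact this ⟨n, by omega⟩ i k
      · intro e
        have := hf.inj e
        have h : ∀ n : Fin 7, ∀ i : ZMod 9, i ≠ i + ((n + 1 + 1 : ℕ) : ZMod 9) := by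
          decide +kernel
        exact h ⟨n, by omega⟩ i this
      · apply hf.sep_singleton
        have h : ∀ n : Fin 7, ∀ i k : ZMod 9, (0 < (k - i).val ∧ (k - i).val < n + 1) →
          k ≠ i + ((n + 1 + 1 : ℕ) : ZMod 9) ∧ i + ((n + 1 + 1 : ℕ) : ZMod 9) ≠ k + 1 ∧
          k ≠ i + ((n + 1 + 1 : ℕ) : ZMod 9) + 1 := by decide +kernel
        rintro k hk _ rfl
        exact h ⟨n, by omega⟩ i k hk
      · intro e
        have h : ∀ n : Fin 7, ∀ i : ZMod 9, (i + ((n + 1 : ℕ) : ZMod 9) = i + 1 ∨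
          i = i + ((n + 1 : ℕ) : ZMod 9) + 1) → (n : ℕ) + 1 = 1 := by decide +kernel
        exact h ⟨n, by omega⟩ i ((hf.adj_iff _ _).1 e)
  have h1 := val_pos hij
  have h2 := ZMod.val_lt (j - i)
  have h3 : (j - i).val - 1 + 1 = (j - i).val := by omega
  have := key ((j - i).val - 1) (by omega)
  rw [h3, ZMod.natCast_zmod_val, add_sub_cancel] at this
  exact this

theorem IsNonagon.arris_arc_symm (hf : IsNonagon G f) {i j : ZMod 9} (hij : i ≠ j) :
    Arris G (f i) (f j) (i - j).val (f '' arc j i) := (hf.arris_arc hij.symm).symm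

/-- The indices `a`, `b`, `c` are distinct and occur in this order. -/
def Tri (a b c : ZMod 9) : Prop := 0 < (b - a).val ∧ (b - a).val < (c - a).val

theorem Tri.rot {a b c : ZMod 9} (h : Tri a b c) : Tri b c a := by
  have : ∀ a b c : ZMod 9, 0 < (b - a).val → (b - a).val < (c - a).val →
    0 < (c - b).val ∧ (c - b).val < (a - b).val := by decide +kernel
  exact this a b c h.1 h.2

theorem Tri.sum {a b c : ZMod 9} (h : Tri a b c) :
    (b - a).val + (c - b).val + (a - c).val = 9 ∧ (c - a).val = (b - a).val + (c - b).val := by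
  have : ∀ a b c : ZMod 9, 0 < (b - a).val → (b - a).val < (c - a).val →
    (b - a).val + (c - b).val + (a - c).val = 9 ∧ (c - a).val = (b - a).val + (c - b).val := by
    decide +kernel
  exact this a b c h.1 h.2

theorem Tri.ne {a b c : ZMod 9} (h : Tri a b c) : a ≠ b := by
  rintro rfl
  simpa using h.1

theorem Tri.apart {a b c : ZMod 9} (h : Tri a b c) : Apart (arc a b) (arc b c) := by
  have : ∀ α β γ : ZMod 9, 0 < α.val → α.val < β.val → 0 < γ.val → γ.val + β.val < 9 →
    α ≠ β + γ ∧ β + γ ≠ α + 1 ∧ α ≠ β + γ + 1 := by decide +kernel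
  rintro i ⟨hi, hi'⟩ j ⟨hj, hj'⟩
  have hs := h.sum
  have := this (i - a) (b - a) (j - b) hi hi' hj (by omega)
  rw [show b - a + (j - b) = j - a by ring] at this
  simpa only [sub_add_eq_add_sub, ne_eq, sub_left_inj] using this

theorem Tri.apart_singleton {a b c : ZMod 9} (h : Tri a b c) : Apart (arc a b) {c} := by
  have : ∀ α β γ : ZMod 9, 0 < α.val → α.val < β.val → β.val < γ.val →
    α ≠ γ ∧ γ ≠ α + 1 ∧ α ≠ γ + 1 := by decide +kernel
  rintro i ⟨hi, hi'⟩ j rfl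
  have := this (i - a) (b - a) (j - a) hi hi' h.2
  simpa only [sub_add_eq_add_sub, ne_eq, sub_left_inj] using this

theorem arc_subset_right {a b c : ZMod 9} (h : Tri a b c) : arc b c ⊆ arc a c := by
  have : ∀ β γ : ZMod 9, 0 < γ.val → γ.val + β.val < 9 →
    (β + γ).val = β.val + γ.val := by decide +kernel
  rintro i ⟨hi, hi'⟩
  have hs := h.sum
  have := this (b - a) (i - b) hi (by omega)
  rw [show b - a + (i - b) = i - a by ring] at this
  constructor <;> omega

theorem IsNonagon.val_of_adj (hf : IsNonagon G f) {a b : ZMod 9} (h : G.Adj (f a) (f b)) :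
    (b - a).val = 1 ∨ (a - b).val = 1 := by
  have : ∀ a b : ZMod 9, b = a + 1 ∨ a = b + 1 → (b - a).val = 1 ∨ (a - b).val = 1 := by
    decide +kernel
  exact this a b ((hf.adj_iff a b).1 h)

theorem IsNonagon.tri_adj (hf : IsNonagon G f) {a b c : ZMod 9} (ht : Tri a b c)
    (h : G.Adj (f a) (f b)) : (b - a).val = 1 := by
  have h1 := ht.sum
  have h2 := ht.1
  have h3 := ht.rot.1
  have h4 := ht.rot.rot.1
  have h5 : ∀ a b : ZMod 9, 0 < (b - a).val → (b - a).val + (a - b).val = 9 := by decide +kernel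
  have h6 := h5 a b ht.1
  rcases hf.val_of_adj h with h | h <;> omega

/-- The branches of a star attached to three vertices of a nonagon satisfy the dichotomy. -/
theorem Good.star (hG : Good G) (hf : IsNonagon G f) {a b c : ZMod 9} (ht : Tri a b c) {n : V}
    {ra rb rc : ℕ} {Ra Rb Rc : Set V} (ha : Arris G n (f a) ra Ra) (hb : Arris G n (f b) rb Rb)
    (hc : Arris G n (f c) rc Rc) (hab : Sep G Ra Rb) (hac : Sep G Ra Rc) (hbc : Sep G Rb Rc)
    (hn : n ∉ Set.range f) (ea : ∀ i, G.Adj n (f i) → (i = a ∧ ra = 1) ∨ (i = b ∧ rb = 1) ∨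
      (i = c ∧ rc = 1))
    (fa : ∀ i ≠ a, Sep G Ra {f i}) (fb : ∀ i ≠ b, Sep G Rb {f i}) (fc : ∀ i ≠ c, Sep G Rc {f i})
    (hodd : Odd ((b - a).val + rb + ra)) :
    (rb = 1 ∧ (c - b).val = 1) ∨ ((a - c).val = 1 ∧ ra = 1) := by
  have nab := ht.ne
  have nbc := ht.rot.ne
  have nca := ht.rot.rot.ne
  have arcR : ∀ {x y z : ZMod 9} {R : Set V}, (∀ i ≠ z, Sep G R {f i}) → z ∉ arc x y →
      Sep G (f '' arc x y) R := by
    rintro x y z R hR hz _ ⟨i, hi, rfl⟩ r hr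
    have := hR i (fun e => hz (e ▸ hi)) r hr (f i) rfl
    exact ⟨this.1.symm, fun e => this.2 e.symm⟩
  have arcn : ∀ {x y : ZMod 9}, a ∉ arc x y → b ∉ arc x y → c ∉ arc x y →
      Sep G (f '' arc x y) {n} := by
    rintro x y h1 h2 h3 _ ⟨i, hi, rfl⟩ _ rfl
    refine ⟨fun e => hn ⟨i, e⟩, fun e => ?_⟩
    rcases ea i e.symm with h | h | h
    · exact h1 (h.1 ▸ hi)
    · exact h2 (h.1 ▸ hi)
    · exact h3 (h.1 ▸ hi)
  have out1 : ∀ {x y z : ZMod 9}, Tri x y z → x ∉ arc x y ∧ y ∉ arc x y ∧ z ∉ arc x y := by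
    intro x y z h
    refine ⟨fun e => ?_, fun e => lt_irrefl _ e.2, fun e => ?_⟩
    · simpa using e.1
    · have := e.2
      have := h.2
      omega
  obtain ⟨o1, o2, o3⟩ := out1 ht
  obtain ⟨o4, o5, o6⟩ := out1 ht.rot
  obtain ⟨o7, o8, o9⟩ := out1 ht.rot.rot
  have cfg : K4Cfg G (f a) (f b) n (f c) (b - a).val rc rb (a - c).val ra (c - b).val
      (f '' arc a b) Rc Rb (f '' arc c a) Ra (f '' arc b c) := {
    aP1 := hf.arris_arc nab
    aP2 := hc
    aQ1 := hb.symm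
    aQ2 := hf.arris_arc_symm nca.symm
    aL1 := ha.symm
    aL2 := hf.arris_arc nbc
    eP1 := hf.tri_adj ht
    eP2 := fun e => by
      rcases ea c e with h | h | h
      exacts [(nca h.1).elim, (nbc h.1.symm).elim, h.2]
    eQ1 := fun e => by
      rcases ea b e.symm with h | h | h
      exacts [(nab h.1.symm).elim, h.2, (nbc h.1).elim]
    eQ2 := fun e => hf.tri_adj ht.rot.rot e.symm
    eL1 := fun e => by
      rcases ea a e.symm with h | h | h
      exacts [h.2, (nab h.1).elim, (nca h.1.symm).elim]
    eL2 := hf.tri_adj ht.rot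
    cP1 := sep_pair_right.2 ⟨arcn o1 o2 o3, hf.sep_singleton ht.apart_singleton⟩
    cP2 := sep_pair_right.2 ⟨fc a nca.symm, fc b nbc⟩
    cQ1 := sep_pair_right.2 ⟨fb a nab, fb c nbc.symm⟩
    cQ2 := sep_pair_right.2 ⟨hf.sep_singleton ht.rot.rot.apart_singleton, arcn o8 o9 o7⟩
    cL1 := sep_pair_right.2 ⟨fa b nab.symm, fa c nca⟩
    cL2 := sep_pair_right.2 ⟨hf.sep_singleton ht.rot.apart_singleton, arcn o6 o4 o5⟩
    sP1P2 := arcR fc o3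
    sP1Q1 := arcR fb o2
    sP1Q2 := hf.sep ht.rot.rot.apart.symm
    sP1L1 := arcR fa o1
    sP1L2 := hf.sep ht.apart
    sP2Q1 := hbc.symm
    sP2Q2 := (arcR fc o7).symm
    sP2L1 := hac.symm
    sP2L2 := (arcR fc o5).symm
    sQ1Q2 := (arcR fb o9).symm
    sQ1L1 := hab.symm
    sQ1L2 := (arcR fb o4).symm
    sQ2L1 := arcR fa o8
    sQ2L2 := hf.sep ht.rot.apart.symm
    sL1L2 := (arcR fa o6).symm }
  refine cfg.dichotomy hG hodd ?_
  have := ht.sum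
  rw [show (b - a).val + (a - c).val + (c - b).val = 9 by omega]
  decide

end NineHoles

namespace NineHoles

variable {G : SimpleGraph V} {f : ZMod 9 → V}

theorem Good.nine_le_of_arris (hG : Good G) {x y : V} {n m : ℕ} {I J : Set V}
    (hA : Arris G x y n I) (hD : Arris G x y m J) (hIJ : ∀ a ∈ I, a ∉ J) (hlen : 3 ≤ n + m) :
    9 ≤ n + m := by
  obtain ⟨A, hA, rfl⟩ := hA
  obtain ⟨D, hD, rfl⟩ := hD
  have hdis : A.support.tail.Disjoint D.reverse.support.tail := by
    intro a ha hb
    have hax : a ≠ x := by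
      rintro rfl
      have := hA.isPath.support_nodup
      rw [← Walk.cons_tail_support] at this
      exact (List.nodup_cons.1 this).1 ha
    have hay : a ≠ y := by
      rintro rfl
      have := hD.isPath.reverse.support_nodup
      rw [← Walk.cons_tail_support] at this
      exact (List.nodup_cons.1 this).1 hb
    have ha' := (hA.mem_iff a).1 (List.mem_of_mem_tail ha)
    have hb' := (hD.symm.mem_iff a).1 (List.mem_of_mem_tail hb)
    rcases ha' with h | h | ha'
    · exact hax h
    · exact hay h
    · rcases hb' with h | h | hb'
      · exact hay h
      · exact hax h
      · exact hIJ a ha' hb'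
  have hc := hA.isPath.isCycle_append hD.isPath.reverse hdis
    (by rw [Walk.length_reverse]; omega)
  simpa using hG.nine_le _ _ hc

theorem Arris.two {x v y : V} (h : G.Adj x v) (h' : G.Adj v y) (hxy : x ≠ y) :
    Arris G x y 2 {v} := by
  have := (Arris.edge h).append (Arris.edge h') hxy sep_empty_left sep_empty_left sep_empty_right
    (fun _ => rfl) (fun _ => rfl)
  simpa using this

/-- Arcs of a nonagon of length at most four join any two of its vertices. -/
theorem IsNonagon.exists_short (hf : IsNonagon G f) {i j : ZMod 9} (hij : i ≠ j) :
    ∃ n S, n ≤ 4 ∧ Arris G (f i) (f j) n (f '' S) := by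
  have : ∀ i j : ZMod 9, (j - i).val ≤ 4 ∨ (i - j).val ≤ 4 := by decide +kernel
  rcases this i j with h | h
  · exact ⟨_, _, h, hf.arris_arc hij⟩
  · exact ⟨_, _, h, hf.arris_arc_symm hij⟩

/-- A vertex outside a nonagon has at most one neighbour on it. -/
theorem Good.unique_adj (hG : Good G) (hf : IsNonagon G f) {v : V} (hv : v ∉ Set.range f)
    {i j : ZMod 9} (hi : G.Adj v (f i)) (hj : G.Adj v (f j)) : i = j := by
  by_contra hij
  obtain ⟨n, S, hn, hA⟩ := hf.exists_short hij
  have := hG.nine_le_of_arris hA (Arris.two hi.symm hj hA.ne) (by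
    rintro _ ⟨k, -, rfl⟩ h
    exact hv ⟨k, h⟩) (by have := hA.one_le; omega)
  omega

/-- An arris joining two vertices of a nonagon, with interior outside of it and attached to it only
at the ends. -/
structure Jump (G : SimpleGraph V) (f : ZMod 9 → V) (b z : ZMod 9) (n : ℕ) (W : Set V) :
    Prop where
  arris : Arris G (f b) (f z) n W
  out : ∀ w ∈ W, w ∉ Set.range f
  att : ∀ w ∈ W, ∀ i, G.Adj w (f i) → i = b ∨ i = z

variable {b z : ZMod 9} {n : ℕ} {W : Set V}

theorem Jump.symm (h : Jump G f b z n W) : Jump G f z b n W :=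
  ⟨h.arris.symm, h.out, fun w hw i hi => (h.att w hw i hi).symm⟩

theorem Jump.ne (h : Jump G f b z n W) : b ≠ z := fun e => h.arris.ne (congrArg f e)

theorem Jump.sep (h : Jump G f b z n W) {S : Set (ZMod 9)} (hb : b ∉ S) (hz : z ∉ S) :
    Sep G W (f '' S) := by
  rintro w hw _ ⟨i, hi, rfl⟩
  refine ⟨fun e => h.out w hw ⟨i, e.symm⟩, fun e => ?_⟩
  rcases h.att w hw i e with rfl | rfl
  exacts [hb hi, hz hi]

theorem Jump.sep_singleton (h : Jump G f b z n W) {i : ZMod 9} (hb : i ≠ b) (hz : i ≠ z) :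
    Sep G W {f i} := by
  have := h.sep (S := {i}) (by simpa using hb.symm) (by simpa using hz.symm)
  rwa [Set.image_singleton] at this

theorem left_notMem_arc (b z : ZMod 9) : b ∉ arc b z := by
  rintro ⟨h, -⟩
  simp at h

theorem right_notMem_arc (b z : ZMod 9) : z ∉ arc b z := fun h => lt_irrefl _ h.2

theorem val_add_val {b z : ZMod 9} (h : b ≠ z) : (z - b).val + (b - z).val = 9 := by
  have : ∀ b z : ZMod 9, b ≠ z → (z - b).val + (b - z).val = 9 := by decide +kernel
  exact this b z h

theorem IsNonagon.adj_iff_val (hf : IsNonagon G f) {b z : ZMod 9} :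
    G.Adj (f b) (f z) ↔ (z - b).val = 1 ∨ (z - b).val = 8 := by
  have : ∀ b z : ZMod 9, (z = b + 1 ∨ b = z + 1) ↔ (z - b).val = 1 ∨ (z - b).val = 8 := by
    decide +kernel
  rw [hf.adj_iff]
  exact this b z

theorem Jump.two_le (h : Jump G f b z n W) (hadj : ¬ G.Adj (f b) (f z)) :
    2 ≤ n := by
  by_contra hn
  have := h.arris.one_le
  have e : n = 1 := by omega
  subst e
  exact hadj h.arris.adj_of_one

theorem Jump.length_cases (hG : Good G) (hf : IsNonagon G f) (h : Jump G f b z n W)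
    (hadj : ¬ G.Adj (f b) (f z)) :
    (n + (z - b).val = 9 ∧ (z - b).val ≤ 4) ∨ (n = (z - b).val ∧ 5 ≤ (z - b).val) := by
  have hn := h.two_le hadj
  have hsum := val_add_val h.ne
  have hd := mt hf.adj_iff_val.2 hadj
  have hd0 := val_pos h.ne
  have hd9 := val_pos h.ne.symm
  have k1 := hG.hole h.arris (hf.arris_arc h.ne)
    (h.sep (left_notMem_arc b z) (right_notMem_arc b z)) (fun e => (hadj e).elim) (by omega)
  have k2 := hG.hole h.arris (hf.arris_arc_symm h.ne)
    (h.sep (right_notMem_arc z b) (left_notMem_arc z b)) (fun e => (hadj e).elim) (by omega)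
  rcases Nat.even_or_odd (n + (z - b).val) with ho | ho
  · have := (k2.2 (by grind)).1
    omega
  · have := (k1.2 ho).1
    omega

theorem Jump.adj_cases (hG : Good G) (h : Jump G f b z n W)
    (hadj : G.Adj (f b) (f z)) (hn : n ≠ 1) : n = 8 ∨ Odd n ∧ 9 ≤ n := by
  have h1 := h.arris.one_le
  have h3 : 3 ≤ n := by
    by_contra hlt
    have := hG.nine_le_of_arris h.arris (Arris.edge hadj) (by simp) (by omega)
    omega
  have k := hG.hole h.arris (Arris.edge hadj) sep_empty_right (fun _ => Or.inr rfl) (by omega)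
  rcases Nat.even_or_odd n with ho | ho
  · have := (k.2 (by grind)).1
    omega
  · grind

/-- A jump forming an odd hole with the arc from `b` to `z`, which has length at most four. -/
structure OddJump (G : SimpleGraph V) (f : ZMod 9 → V) (b z : ZMod 9) (W : Set V) : Prop where
  jump : Jump G f b z (9 - (z - b).val) W
  le : (z - b).val ≤ 4

theorem Jump.oddJump (hG : Good G) (hf : IsNonagon G f) (h : Jump G f b z n W)
    (hadj : ¬ G.Adj (f b) (f z)) : OddJump G f b z W ∨ OddJump G f z b W := by
  have hsum := val_add_val h.ne
  rcases h.length_cases hG hf hadj with ⟨h1, h2⟩ | ⟨h1, h2⟩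
  · have e : n = 9 - (z - b).val := by omega
    exact Or.inl ⟨e ▸ h, h2⟩
  · have e : n = 9 - (b - z).val := by omega
    exact Or.inr ⟨e ▸ h.symm, by omega⟩

theorem OddJump.exists_isNonagon (hG : Good G) (hf : IsNonagon G f) (h : OddJump G f b z W) :
    ∃ f', IsNonagon G f' ∧ Set.range f' = {f b, f z} ∪ W ∪ f '' arc b z := by
  have hle := h.le
  have hpos := val_pos h.jump.ne
  refine ((hG.hole h.jump.arris (hf.arris_arc h.jump.ne)
    (h.jump.sep (left_notMem_arc b z) (right_notMem_arc b z)) (fun e => ?_) (by omega)).2 ?_).2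
  · rcases hf.adj_iff_val.1 e with h | h
    · exact Or.inr h
    · omega
  · rw [show 9 - (z - b).val + (z - b).val = 9 by omega]
    decide

theorem tri_of {a b c : ZMod 9} (hab : a ≠ b) (h : (b - a).val < (c - a).val) : Tri a b c :=
  ⟨val_pos hab, h⟩

/-- A leg from an interior vertex of an odd jump to a vertex of the nonagon other than the ends of
the jump ends next to the base, and starts next to the corresponding end of the jump. -/
theorem OddJump.leg (hG : Good G) (hf : IsNonagon G f) (h : OddJump G f b z W) {p : V} {x : ZMod 9}
    {l : ℕ} {L : Set V} (hp : p ∈ W) (hL : Arris G p (f x) l L) (hl : 2 ≤ l) (hxb : x ≠ b)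
    (hxz : x ≠ z) (hout : ∀ i ≠ x, Sep G L {f i}) (hLW : Sep G L (W \ {p})) :
    7 ≤ l ∧ ((x = b - 1 ∧ G.Adj p (f b)) ∨ (x = z + 1 ∧ G.Adj p (f z))) := by
  obtain ⟨n₁, n₂, W₁, W₂, hs⟩ := h.jump.arris.split hp
  have hle := h.le
  have hbz := h.jump.ne
  have hsum := val_add_val hbz
  have hpos := val_pos hbz
  have hlen := hs.len
  have hpW₁ : p ∉ W₁ := hs.left.right_notMem
  have hpW₂ : p ∉ W₂ := hs.right.left_notMem
  have sW₁ : Sep G L W₁ := hLW.mono subset_rfl fun a ha =>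
    ⟨hs.left_subset ha, fun e => hpW₁ (e ▸ ha)⟩
  have sW₂ : Sep G L W₂ := hLW.mono subset_rfl fun a ha =>
    ⟨hs.right_subset ha, fun e => hpW₂ (e ▸ ha)⟩
  have ea : ∀ i, G.Adj p (f i) → (i = b ∧ n₁ = 1) ∨ (i = z ∧ n₂ = 1) := by
    intro i hi
    rcases h.jump.att p hp i hi with rfl | rfl
    · exact Or.inl ⟨rfl, hs.adj_left hi.symm⟩
    · exact Or.inr ⟨rfl, hs.adj_right hi⟩
  have f₁ : ∀ i ≠ b, Sep G W₁ {f i} := by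
    intro i hi
    by_cases hiz : i = z
    · exact hiz ▸ hs.sep_right
    · exact (h.jump.sep_singleton hi hiz).mono hs.left_subset subset_rfl
  have f₂ : ∀ i ≠ z, Sep G W₂ {f i} := by
    intro i hi
    by_cases hib : i = b
    · exact hib ▸ hs.sep_left.symm
    · exact (h.jump.sep_singleton hib hi).mono hs.right_subset subset_rfl
  have seven : ∀ i, G.Adj p (f i) → G.Adj (f i) (f x) → 7 ≤ l := by
    intro i h1 h2
    have := hG.nine_le_of_arris hL (Arris.two h1 h2 hL.ne) (by
      rintro a ha rfl
      have hix : i ≠ x := fun e => h2.ne (congrArg f e)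
      exact (hout i hix _ ha _ rfl).1 rfl) (by omega)
    omega
  rcases lt_or_ge (z - b).val (x - b).val with hx | hx
  · have ht : Tri b z x := tri_of hbz hx
    have := hG.star hf ht hs.left.symm hs.right hL hs.sep sW₁.symm sW₂.symm (h.jump.out p hp)
      (fun i hi => (ea i hi).imp_right Or.inl) f₁ f₂ hout (by
        rw [show (z - b).val + n₂ + n₁ = 9 by omega]; decide)
    have v1 : ∀ i j : ZMod 9, (i - j).val = 1 → i = j + 1 := by decide +kernel
    rcases this with ⟨h1, h2⟩ | ⟨h1, h2⟩
    · subst h1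
      have hx := v1 _ _ h2
      have hadj := hs.right.adj_of_one
      exact ⟨seven z hadj ((hf.adj_iff _ _).2 (Or.inl hx)), Or.inr ⟨hx, hadj⟩⟩
    · subst h2
      have hx := v1 _ _ h1
      have hadj := hs.left.adj_of_one.symm
      exact ⟨seven b hadj ((hf.adj_iff _ _).2 (Or.inr hx)),
        Or.inl ⟨eq_sub_of_add_eq hx.symm, hadj⟩⟩
  · exfalso
    have hne : (x - b).val ≠ (z - b).val := fun e =>
      hxz (sub_left_injective (ZMod.val_injective 9 e))
    have ht : Tri b x z := tri_of hxb.symm (by omega)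
    have hsum' := ht.sum
    rcases Nat.even_or_odd ((x - b).val + l + n₁) with ho | ho
    · have := hG.star hf ht.rot hL hs.right hs.left.symm sW₂ sW₁ hs.sep.symm (h.jump.out p hp)
        (fun i hi => by rcases ea i hi with h | h <;> simp [h]) hout f₂ f₁ (by grind)
      omega
    · have := hG.star hf ht hs.left.symm hL hs.right sW₁.symm hs.sep sW₂ (h.jump.out p hp)
        (fun i hi => by rcases ea i hi with h | h <;> simp [h]) f₁ hout f₂ ho
      omega

theorem Good.crossing_parity (hG : Good G) (hf : IsNonagon G f) {x v y u : ZMod 9} {n₁ n₂ : ℕ}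
    {W₁ W₂ : Set V} (ht : Tri x v y) (ht' : Tri x y u) (h1 : Jump G f u v n₁ W₁)
    (h2 : Jump G f x y n₂ W₂) (hs : Sep G W₁ W₂) (ho1 : Odd ((v - x).val + n₁ + (x - u).val))
    (ho2 : Odd ((v - x).val + n₂ + (y - v).val)) : False := by
  have hxv := ht.ne
  have hvy := ht.rot.ne
  have hyx := ht.rot.rot.ne
  have hyu := ht'.rot.ne
  have hux := ht'.rot.rot.ne
  have ht2 : Tri x v u := ⟨ht.1, ht.2.trans ht'.2⟩
  have hvu := ht2.rot.ne
  have ht3 : Tri v y u := by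
    refine ⟨ht.rot.1, ?_⟩
    have a1 := ht.sum
    have a2 := ht2.sum
    have a3 := ht'.sum
    have a4 := ht'.rot.1
    omega
  have p1 := ht.1
  have p2 := ht3.1
  have p3 := ht'.rot.1
  have p4 := ht'.rot.rot.1
  have s1 := ht.sum
  have s2 := ht2.sum
  have s3 := ht'.sum
  have s4 := ht3.sum
  have s5 := val_add_val hvu
  have s6 := val_add_val hyx
  have s7 := val_add_val hvy
  have s8 := val_add_val hyu
  have s9 := val_add_val hxv
  have s10 := val_add_val hux
  have nuv : ¬ G.Adj (f u) (f v) := by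
    rw [hf.adj_iff_val]
    omega
  have nxy : ¬ G.Adj (f x) (f y) := by
    rw [hf.adj_iff_val]
    omega
  have t1 := h1.two_le nuv
  have t2 := h2.two_le nxy
  have A1 := ht'.rot.rot
  have cfg : K4Cfg G (f x) (f v) (f u) (f y) (v - x).val (u - y).val n₁ n₂ (x - u).val (y - v).val
      (f '' arc x v) (f '' arc y u) W₁ W₂ (f '' arc u x) (f '' arc v y) := {
    aP1 := hf.arris_arc hxv
    aP2 := hf.arris_arc_symm hyu.symm
    aQ1 := h1.arris.symm
    aQ2 := h2.arris
    aL1 := hf.arris_arc_symm hux.symm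
    aL2 := hf.arris_arc hvy
    eP1 := hf.tri_adj ht
    eP2 := fun e => hf.tri_adj ht'.rot e.symm
    eQ1 := fun e => (nuv e.symm).elim
    eQ2 := fun e => (nxy e).elim
    eL1 := fun e => hf.tri_adj A1 e.symm
    eL2 := hf.tri_adj ht3
    cP1 := sep_pair_right.2 ⟨hf.sep_singleton ht2.apart_singleton,
      hf.sep_singleton ht.apart_singleton⟩
    cP2 := sep_pair_right.2 ⟨hf.sep_singleton ht'.rot.apart_singleton,
      hf.sep_singleton ht3.rot.apart_singleton⟩
    cQ1 := sep_pair_right.2 ⟨h1.sep_singleton hux.symm hxv, h1.sep_singleton hyu hvy.symm⟩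
    cQ2 := sep_pair_right.2 ⟨h2.sep_singleton hxv.symm hvy, h2.sep_singleton hux hyu.symm⟩
    cL1 := sep_pair_right.2 ⟨hf.sep_singleton ht2.rot.rot.apart_singleton,
      hf.sep_singleton A1.apart_singleton⟩
    cL2 := sep_pair_right.2 ⟨hf.sep_singleton ht.rot.apart_singleton,
      hf.sep_singleton ht3.apart_singleton⟩
    sP1P2 := hf.sep (ht2.apart.mono subset_rfl (arc_subset_right ht3))
    sP1Q1 := (h1.sep (fun e => by have := e.2; have := ht2.2; omega) (right_notMem_arc _ _)).symm
    sP1Q2 := (h2.sep (left_notMem_arc _ _) (fun e => by have := e.2; omega)).symm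
    sP1L1 := hf.sep ht2.rot.rot.apart.symm
    sP1L2 := hf.sep ht.apart
    sP2Q1 := (h1.sep (right_notMem_arc _ _) (fun e => by have := e.2; omega)).symm
    sP2Q2 := (h2.sep (fun e => by have := e.2; omega) (left_notMem_arc _ _)).symm
    sP2L1 := hf.sep ht'.rot.apart
    sP2L2 := hf.sep ht3.apart.symm
    sQ1Q2 := hs
    sQ1L1 := h1.sep (left_notMem_arc _ _) (fun e => by have := e.2; omega)
    sQ1L2 := h1.sep (fun e => by have := e.2; omega) (left_notMem_arc _ _)
    sQ2L1 := h2.sep (right_notMem_arc _ _) (fun e => by have := e.2; omega)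
    sQ2L2 := h2.sep (fun e => by have := e.2; omega) (right_notMem_arc _ _)
    sL1L2 := hf.sep (ht'.rot.rot.apart.mono subset_rfl (arc_subset_right ht)) }
  have := cfg.dichotomy hG ho1 ho2
  omega

/-- An odd jump cannot be separated from a jump leading from the inside of its base to the
outside. -/
theorem OddJump.not_sep_of_crossing (hG : Good G) (hf : IsNonagon G f) {u v x y : ZMod 9} {m : ℕ}
    {W₁ W₂ : Set V} (h1 : OddJump G f u v W₁) (h2 : Jump G f x y m W₂) (ht : Tri u x v)
    (ht' : Tri u v y) (hs : Sep G W₁ W₂) : False := by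
  have hle := h1.le
  have hpos := val_pos h1.jump.ne
  have htr : Tri u x y := ⟨ht.1, ht.2.trans ht'.2⟩
  have a1 := ht.sum
  have a2 := ht'.sum
  have a3 := htr.sum
  have htx : Tri x v y := by
    refine ⟨ht.rot.1, ?_⟩
    have := ht'.rot.1
    omega
  have a4 := htx.sum
  rcases Nat.even_or_odd ((v - x).val + m + (y - v).val) with ho | ho
  · refine hG.crossing_parity hf ht ht' h2.symm h1.jump hs.symm ?_ ?_
    · grind
    · rw [show (x - u).val + (9 - (v - u).val) + (v - x).val = 9 by omega]
      decide
  · refine hG.crossing_parity hf htx htr.rot h1.jump h2 hs ?_ ho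
    rw [show (v - x).val + (9 - (v - u).val) + (x - u).val = 9 by omega]
    decide

end NineHoles

namespace NineHoles

variable {G : SimpleGraph V} {f : ZMod 9 → V} {b z : ZMod 9} {W : Set V}

/-- `p` belongs to `W` or has a neighbour in it. -/
def Touch (G : SimpleGraph V) (W : Set V) (p : V) : Prop := p ∈ W ∨ ∃ w ∈ W, G.Adj p w

theorem sep_of_not_touch {A W : Set V} (h : ∀ a ∈ A, ¬ Touch G W a) : Sep G A W :=
  fun a ha w hw => ⟨fun e => h a ha (Or.inl (e ▸ hw)), fun e => h a ha (Or.inr ⟨w, hw, e⟩)⟩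

theorem exists_touch {A W : Set V} (h : ¬ Sep G A W) : ∃ a ∈ A, Touch G W a := by
  by_contra hc
  push Not at hc
  exact h (sep_of_not_touch hc)

/-- The first vertex touching `W` on a path starting outside of it. -/
theorem notMem_of_first_touch {x p : V} {k : ℕ} {I : Set V} (hA : Arris G x p k I)
    (hx : ∀ w ∈ W, ¬ G.Adj w x) (hI : ∀ a ∈ I, ¬ Touch G W a) : p ∉ W := by
  intro hp
  by_cases hk : k = 1
  · subst hk
    exact hx p hp hA.adj_of_one.symm
  · obtain ⟨a, ha, hap⟩ := hA.symm.exists_adj hk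
    exact hI a ha (Or.inr ⟨p, hp, hap.symm⟩)

theorem OddJump.not_adj (h : OddJump G f b z W) {x : ZMod 9} (hxb : x ≠ b) (hxz : x ≠ z) :
    ∀ w ∈ W, ¬ G.Adj w (f x) := by
  intro w hw e
  rcases h.jump.att w hw x e with h | h
  exacts [hxb h, hxz h]

theorem OddJump.unique_adj (hG : Good G) (hf : IsNonagon G f) (h : OddJump G f b z W) {p u v : V}
    (hpf : p ∉ Set.range f) (hpW : p ∉ W)
    (hu : u ∈ {f b, f z} ∪ W ∪ f '' arc b z) (hv : v ∈ {f b, f z} ∪ W ∪ f '' arc b z)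
    (hpu : G.Adj p u) (hpv : G.Adj p v) : u = v := by
  obtain ⟨f', hf', hr⟩ := h.exists_isNonagon hG hf
  rw [← hr] at hu hv
  obtain ⟨i, rfl⟩ := hu
  obtain ⟨j, rfl⟩ := hv
  refine congrArg f' (hG.unique_adj hf' ?_ hpu hpv)
  rw [hr]
  rintro ((h | h) | ⟨i, -, rfl⟩)
  · rcases h with rfl | rfl
    exacts [hpf ⟨b, rfl⟩, hpf ⟨z, rfl⟩]
  · exact hpW h
  · exact hpf ⟨i, rfl⟩

/-- A path from a vertex of the nonagon other than the ends of an odd jump to the first vertex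
touching the jump, not otherwise attached to the nonagon. -/
theorem OddJump.first_touch (hG : Good G) (hf : IsNonagon G f) (h : OddJump G f b z W) {p : V}
    {x : ZMod 9} {k : ℕ} {I : Set V} (hA : Arris G (f x) p k I) (hadj : G.Adj (f x) p → k = 1)
    (hxb : x ≠ b) (hxz : x ≠ z) (hpf : p ∉ Set.range f) (hIf : ∀ a ∈ I, a ∉ Set.range f)
    (hpx : ∀ i, G.Adj p (f i) → i = x) (hIx : ∀ a ∈ I, ∀ i, G.Adj a (f i) → i = x)
    (hp : Touch G W p) (hI : ∀ a ∈ I, ¬ Touch G W a) :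
    ∃ n ∈ W, G.Adj p n ∧ 6 ≤ k ∧ ((x = b - 1 ∧ G.Adj n (f b)) ∨ (x = z + 1 ∧ G.Adj n (f z))) := by
  have hpW := notMem_of_first_touch hA (h.not_adj hxb hxz) hI
  obtain ⟨n, hn, hpn⟩ := hp.resolve_left hpW
  have hxn : f x ≠ n := fun e => h.jump.out n hn ⟨x, e⟩
  have hL := hA.append (Arris.edge hpn) hxn sep_empty_right
    ((sep_of_not_touch hI).mono subset_rfl (by simpa using hn)) sep_empty_right hadj
    (fun _ => rfl)
  rw [Set.union_empty] at hL
  have key := h.leg hG hf hn hL.symm (by have := hA.one_le; omega) hxb hxz ?_ ?_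
  · exact ⟨n, hn, hpn, by omega, key.2⟩
  · intro i hi a ha _ hc
    rw [Set.mem_singleton_iff] at hc
    subst hc
    rcases ha with ha | rfl
    · exact ⟨fun e => hIf a ha ⟨i, e.symm⟩, fun e => hi (hIx a ha i e)⟩
    · exact ⟨fun e => hpf ⟨i, e.symm⟩, fun e => hi (hpx i e)⟩
  · rw [sep_union_left]
    refine ⟨(sep_of_not_touch hI).mono subset_rfl Set.sdiff_subset, ?_⟩
    rw [sep_singleton_left]
    refine fun w hw => ⟨fun e => hpW (e ▸ hw.1), fun e => hw.2 ?_⟩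
    exact h.unique_adj hG hf hpf hpW (Or.inl (Or.inr hw.1)) (Or.inl (Or.inr hn)) e hpn

/-- A connected set attached to a single vertex of the nonagon and touching an odd jump. -/
theorem OddJump.conn_touch (hG : Good G) (hf : IsNonagon G f) (h : OddJump G f b z W)
    {x : ZMod 9} {D : Set V} (hD : Conn G D) (hDf : ∀ a ∈ D, a ∉ Set.range f)
    (hDx : ∀ a ∈ D, ∀ i, G.Adj a (f i) → i = x) (hx : ∃ a ∈ D, G.Adj a (f x))
    (hxb : x ≠ b) (hxz : x ≠ z) (ht : ∃ a ∈ D, Touch G W a) :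
    ∃ p ∈ D, ∃ n ∈ W, G.Adj p n ∧
      ((x = b - 1 ∧ G.Adj n (f b)) ∨ (x = z + 1 ∧ G.Adj n (f z))) := by
  obtain ⟨a, ha, hax⟩ := hx
  obtain ⟨q, hq, hqt⟩ := ht
  obtain ⟨p, hp, hpt, k, I, hI, hA, hadj, hfirst⟩ := (hD a ha q hq).exists_first
    (fun hx => hDf _ hx ⟨x, rfl⟩) hax.symm hqt
  obtain ⟨n, hn, hpn, -, h'⟩ := h.first_touch hG hf hA hadj hxb hxz (hDf p hp)
    (fun a ha => hDf a (hI ha)) (hDx p hp) (fun a ha => hDx a (hI ha)) hpt hfirst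
  exact ⟨p, hp, n, hn, hpn, h'⟩

theorem OddJump.jump_touch (hG : Good G) (hf : IsNonagon G f) (h : OddJump G f b z W)
    {x y : ZMod 9} {m : ℕ} {W₂ : Set V} (h₂ : Jump G f x y m W₂) (hxb : x ≠ b) (hxz : x ≠ z)
    (hs : ¬ Sep G W W₂) : x = b - 1 ∨ x = z + 1 := by
  obtain ⟨p, hp, hpt, k, _, I, _, hsp, hfirst⟩ := h₂.arris.exists_first (Touch G W)
    (exists_touch fun e => hs e.symm)
  have hpf := h₂.out p hp
  have hpW := notMem_of_first_touch hsp.left (h.not_adj hxb hxz) hfirst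
  by_cases hpy : G.Adj p (f y)
  · obtain ⟨n, hn, hpn⟩ := hpt.resolve_left hpW
    exfalso
    by_cases hy : f y ∈ {f b, f z} ∪ W ∪ f '' arc b z
    · have := h.unique_adj hG hf hpf hpW hy (Or.inl (Or.inr hn)) hpy hpn
      exact h.jump.out n hn ⟨y, this⟩
    · have hyb : y ≠ b := fun e => hy (by simp [e])
      have hyz : y ≠ z := fun e => hy (by simp [e])
      have := h.leg hG hf hn (Arris.two hpn.symm hpy fun e => h.jump.out n hn ⟨y, e.symm⟩) le_rfl
        hyb hyz ?_ ?_
      · omega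
      · intro i hi
        rw [sep_singleton_left]
        rintro _ rfl
        exact ⟨fun e => hpf ⟨i, e.symm⟩, fun e => hi (hG.unique_adj hf hpf e hpy)⟩
      · rw [sep_singleton_left]
        refine fun w hw => ⟨fun e => hpW (e ▸ hw.1), fun e => hw.2 ?_⟩
        exact h.unique_adj hG hf hpf hpW (Or.inl (Or.inr hw.1)) (Or.inl (Or.inr hn)) e hpn
  · obtain ⟨n, hn, hpn, -, h'⟩ := h.first_touch hG hf hsp.left hsp.adj_left hxb hxz hpf
      (fun a ha => h₂.out a (hsp.left_subset ha))
      (fun i hi => (h₂.att p hp i hi).resolve_right fun e => hpy (e ▸ hi))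
      (fun a ha i hi => (h₂.att a (hsp.left_subset ha) i hi).resolve_right fun e =>
        (hsp.sep_right a ha _ rfl).2 (e ▸ hi)) hpt hfirst
    exact h'.imp And.left And.left

theorem OddJump.not_crossing (hG : Good G) (hf : IsNonagon G f) {x y : ZMod 9} {m : ℕ}
    {W₂ : Set V} (h : OddJump G f b z W) (h₂ : Jump G f x y m W₂) (ht : Tri b x z)
    (ht' : Tri b z y) : False := by
  by_cases hs : Sep G W W₂
  · exact h.not_sep_of_crossing hG hf h₂ ht ht' hs
  · have h1 := h.jump_touch hG hf h₂ ht.ne.symm ht.rot.ne hs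
    have h2 : ∀ b x z : ZMod 9, 0 < (x - b).val → (x - b).val < (z - b).val →
      ¬ (x = b - 1 ∨ x = z + 1) := by decide +kernel
    exact h2 b x z ht.1 ht.2 h1

theorem OddJump.not_adj_ends (h : OddJump G f b z W) (hf : IsNonagon G f)
    (h2 : 2 ≤ (z - b).val) : ¬ G.Adj (f b) (f z) := by
  rw [hf.adj_iff_val]
  have := h.le
  omega

/-- Two odd jumps with consecutive bases sharing an end. -/
theorem OddJump.not_consecutive (hG : Good G) (hf : IsNonagon G f) {u c : ZMod 9} {W₂ : Set V}
    (h : OddJump G f c z W) (h₂ : OddJump G f u c W₂) (hz : 2 ≤ (z - c).val)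
    (hu : 2 ≤ (c - u).val) (hsum : (z - c).val + (c - u).val ≤ 7) : False := by
  have hcz := h.jump.ne
  have huc := h₂.jump.ne
  have hv1 := val_add_val hcz
  have hv2 := val_add_val huc
  have hzu : z ≠ u := by
    rintro rfl
    omega
  have ht : Tri c z u := tri_of hcz (by omega)
  have hts := ht.sum
  by_cases hs : Sep G W W₂
  · have hA := h.jump.arris.symm.append h₂.jump.arris.symm (fun e => hzu (hf.inj e)) hs
      (h.jump.sep_singleton huc hzu.symm) ((h₂.jump.sep_singleton hzu hcz.symm).symm)
      (fun e => (h.not_adj_ends hf hz e.symm).elim) (fun e => (h₂.not_adj_ends hf hu e.symm).elim)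
    have := hG.hole hA (hf.arris_arc hzu) ?_ (fun e => ?_) (by have := h.le; omega)
    · have h3 := this.2 (by grind)
      omega
    · have hcarc : c ∉ arc z u := fun e => by have := e.2; omega
      rw [sep_union_left, sep_union_left]
      refine ⟨⟨h.jump.sep hcarc (left_notMem_arc z u), ?_⟩, h₂.jump.sep (right_notMem_arc z u)
        hcarc⟩
      exact (hf.sep_singleton ht.rot.apart_singleton).symm
    · rw [hf.adj_iff_val] at e
      omega
  · have h1 := h₂.jump_touch hG hf h.jump.symm hzu hcz.symm fun e => hs e.symm
    rcases h1 with rfl | rfl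
    · have : ∀ u : ZMod 9, (u - (u - 1)).val = 1 := by decide +kernel
      have := this u
      omega
    · have : ∀ c : ZMod 9, (c + 1 - c).val = 1 := by decide +kernel
      have := this c
      omega

/-- Two odd jumps whose bases are joined by an edge of the nonagon. -/
theorem OddJump.not_nearly_consecutive (hG : Good G) (hf : IsNonagon G f) {u c : ZMod 9}
    {W₂ : Set V} (h : OddJump G f c z W) (h₂ : OddJump G f u (c - 1) W₂) (hz : 2 ≤ (z - c).val)
    (hu : 2 ≤ (c - 1 - u).val) (hsum : (z - c).val + (c - 1 - u).val ≤ 6) : False := by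
  have hcz := h.jump.ne
  have huc := h₂.jump.ne
  obtain ⟨ht, ht', h1, hcd, hbd⟩ : Tri c z u ∧ Tri z u (c - 1) ∧ z ≠ c - 1 ∧ c ≠ u ∧
      2 ≤ (u - z).val := by
    have : ∀ c z u : ZMod 9, c ≠ z → u ≠ c - 1 → 2 ≤ (c - 1 - u).val →
        (z - c).val + (c - 1 - u).val ≤ 6 → (0 < (z - c).val ∧ (z - c).val < (u - c).val) ∧
        (0 < (u - z).val ∧ (u - z).val < (c - 1 - z).val) ∧ z ≠ c - 1 ∧ c ≠ u ∧
        2 ≤ (u - z).val := by decide +kernel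
    exact this c z u hcz huc hu hsum
  have hzu := ht.rot.ne
  have hts := ht.sum
  have hts' := ht'.sum
  have hv1 := val_add_val hcz
  have hv2 := val_add_val hcd
  have hv3 : (c - 1 - u).val + 1 = (c - u).val := by
    have : ∀ c u : ZMod 9, c ≠ u → (c - 1 - u).val + 1 = (c - u).val := by decide +kernel
    exact this c u hcd
  have hc1 : G.Adj (f c) (f (c - 1)) := (hf.adj_iff _ _).2 (Or.inr (by ring))
  by_cases hs : Sep G W W₂
  · have hA := h.jump.arris.symm.append (Arris.edge hc1) (fun e => h1 (hf.inj e)) sep_empty_right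
      (h.jump.sep_singleton (fun e => hc1.ne (congrArg f e.symm)) h1.symm) sep_empty_right
      (fun e => (h.not_adj_ends hf hz e.symm).elim) (fun _ => rfl)
    rw [Set.union_empty] at hA
    have hB := hA.append h₂.jump.arris.symm (fun e => hzu (hf.inj e)) ?_ ?_
      ((h₂.jump.sep_singleton hzu h1).symm) (fun e => ?_)
      (fun e => (h₂.not_adj_ends hf hu e.symm).elim)
    · have := hG.hole hB (hf.arris_arc hzu) ?_ (fun e => ?_) (by have := h.le; omega)
      · have h3 := this.2 (by grind)
        omega
      · have hcarc : c ∉ arc z u := fun e => by have := e.2; omega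
        have hcarc' : c - 1 ∉ arc z u := fun e => by have := e.2; omega
        simp only [sep_union_left]
        refine ⟨⟨⟨h.jump.sep hcarc (left_notMem_arc z u), ?_⟩, ?_⟩,
          h₂.jump.sep (right_notMem_arc z u) hcarc'⟩
        · exact (hf.sep_singleton ht.rot.apart_singleton).symm
        · exact (hf.sep_singleton ht'.apart_singleton).symm
      · rw [hf.adj_iff_val] at e
        omega
    · rw [sep_union_left]
      exact ⟨hs, (h₂.jump.sep_singleton hcd fun e => hc1.ne (congrArg f e)).symm⟩
    · rw [sep_union_left]
      refine ⟨h.jump.sep_singleton hcd.symm hzu.symm, ?_⟩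
      rw [sep_singleton_left]
      rintro _ rfl
      refine ⟨fun e => hcd (hf.inj e), fun e => ?_⟩
      rw [hf.adj_iff_val] at e
      omega
    · rw [hf.adj_iff_val] at e
      omega
  · have h1 := h₂.jump_touch hG hf h.jump.symm hzu h1 fun e => hs e.symm
    rcases h1 with rfl | rfl
    · have : ∀ u : ZMod 9, (u - (u - 1)).val = 1 := by decide +kernel
      have := this u
      omega
    · simp at hcz

/-- A connected set attached to two vertices of the nonagon contains a jump. -/
theorem Good.exists_jump (hG : Good G) (hf : IsNonagon G f) {D : Set V} (hD : Conn G D)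
    (hDf : ∀ a ∈ D, a ∉ Set.range f) {i j : ZMod 9} (hij : j ≠ i) (hi : ∃ a ∈ D, G.Adj a (f i))
    (hj : ∃ a ∈ D, G.Adj a (f j)) :
    ∃ j' ≠ i, (∃ a ∈ D, G.Adj a (f j')) ∧ ∃ n, ∃ W ⊆ D, Jump G f i j' n W := by
  obtain ⟨a, ha, hai⟩ := hi
  obtain ⟨q, hq, hqj⟩ := hj
  obtain ⟨p, hp, ⟨j', hj', hpj⟩, k, I, hI, hA, hadj, hfirst⟩ := (hD a ha q hq).exists_first
    (fun hx => hDf _ hx ⟨i, rfl⟩) hai.symm (Q := fun a => ∃ j ≠ i, G.Adj a (f j)) ⟨j, hij, hqj⟩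
  push Not at hfirst
  have hB := hA.append (Arris.edge hpj) (fun e => hj' (hf.inj e.symm)) sep_empty_right
    (sep_singleton_right.2 fun b hb => ⟨fun e => hDf b (hI hb) ⟨j', e.symm⟩, hfirst b hb j' hj'⟩)
    sep_empty_right hadj (fun _ => rfl)
  rw [Set.union_empty] at hB
  have hsub : I ∪ {p} ⊆ D := Set.union_subset hI (by simpa using hp)
  refine ⟨j', hj', ⟨p, hp, hpj⟩, _, _, hsub, hB, fun w hw => hDf w (hsub hw), ?_⟩
  rintro w (hw | rfl) l hl
  · by_contra hc
    push Not at hc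
    exact hfirst w hw l hc.1 hl
  · exact Or.inr (hG.unique_adj hf (hDf w hp) hl hpj)

end NineHoles

namespace NineHoles

variable {G : SimpleGraph V} {f : ZMod 9 → V} {b z c : ZMod 9} {W Y : Set V}

/-- The vertices outside `Y` with a neighbour in `Y`. -/
def bd (G : SimpleGraph V) (Y : Set V) : Set V := {u | u ∉ Y ∧ ∃ y ∈ Y, G.Adj u y}

theorem Sep.notMem_bd {A : Set V} (h : Sep G Y A) {a : V} (ha : a ∈ A) : a ∉ bd G Y := by
  rintro ⟨-, y, hy, e⟩
  exact (h y hy a ha).2 e.symm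

theorem Sep.notMem {A B : Set V} (h : Sep G A B) {a : V} (ha : a ∈ B) : a ∉ A :=
  fun h' => (h a h' a ha).1 rfl

theorem Conn.insert {D : Set V} (hD : Conn G D) {a d : V} (hd : d ∈ D) (had : G.Adj a d) :
    Conn G (insert a D) := by
  have hl : ∀ x ∈ Insert.insert a D, Linked G (Insert.insert a D) x d := by
    rintro x (rfl | hx)
    · exact Linked.of_adj had (Set.mem_insert _ _) (Set.mem_insert_of_mem _ hd)
    · exact (hD x hx d hd).mono (Set.subset_insert a D)
  exact fun x hx y hy => (hl x hx).trans (hl y hy).symm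

theorem Conn.union {D E : Set V} (hD : Conn G D) (hE : Conn G E) {d e : V} (hd : d ∈ D)
    (he : e ∈ E) (hde : d = e ∨ G.Adj d e) : Conn G (D ∪ E) := by
  have hl : ∀ x ∈ D ∪ E, Linked G (D ∪ E) x d := by
    have hed : Linked G (D ∪ E) e d := by
      rcases hde with rfl | h
      · exact Linked.refl (Or.inl hd)
      · exact Linked.of_adj h.symm (Or.inr he) (Or.inl hd)
    rintro x (hx | hx)
    · exact (hD x hx d hd).mono Set.subset_union_left
    · exact ((hE x hx e he).mono Set.subset_union_right).trans hed
  exact fun x hx y hy => (hl x hx).trans (hl y hy).symm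

theorem Arris.conn {x y : V} {n : ℕ} {I : Set V} (h : Arris G x y n I) : Conn G I := by
  intro a ha c hc
  obtain ⟨n₁, n₂, I₁, I₂, hs⟩ := h.split ha
  have hc' : c ∈ I₁ ∪ {a} ∪ I₂ := hs.eq ▸ hc
  rcases hc' with (hc' | rfl) | hc'
  · obtain ⟨_, _, _, J, hs'⟩ := hs.left.split hc'
    exact (hs'.right.linked hc ha (hs'.right_subset.trans hs.left_subset)).symm
  · exact Linked.refl hc
  · obtain ⟨_, _, J, _, hs'⟩ := hs.right.split hc'
    exact hs'.left.linked ha hc (hs'.left_subset.trans hs.right_subset)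

/-- A nonagon `f` and a connected set `Y` anticomplete to it, such that every neighbour of `Y` has
a neighbour on every nonagon anticomplete to `Y`. -/
structure Setting (G : SimpleGraph V) (f : ZMod 9 → V) (Y : Set V) : Prop where
  good : Good G
  nonagon : IsNonagon G f
  conn : Conn G Y
  nonempty : Y.Nonempty
  sep : Sep G Y (Set.range f)
  link : ∀ g, Conn G {f (g - 1), f g, f (g + 1)}ᶜ
  third : ∀ i, ∃ s, s ∉ Set.range f ∧ G.Adj (f i) s
  dominate : ∀ f', IsNonagon G f' → Sep G Y (Set.range f') → ∀ u ∈ bd G Y, ∃ i, G.Adj u (f' i)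

/-- Some neighbour of `Y` is adjacent to `f c`. -/
def IsLabel (G : SimpleGraph V) (f : ZMod 9 → V) (Y : Set V) (c : ZMod 9) : Prop :=
  ∃ u ∈ bd G Y, G.Adj u (f c)

theorem Setting.notMem_range (h : Setting G f Y) {u : V} (hu : u ∈ bd G Y) : u ∉ Set.range f :=
  fun hc => h.sep.notMem_bd hc hu

theorem Setting.label_unique (h : Setting G f Y) {u : V} (hu : u ∈ bd G Y) {i j : ZMod 9}
    (hi : G.Adj u (f i)) (hj : G.Adj u (f j)) : i = j :=
  h.good.unique_adj h.nonagon (h.notMem_range hu) hi hj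

theorem Setting.exists_isLabel (h : Setting G f Y) : ∃ c, IsLabel G f Y c := by
  obtain ⟨y, hy⟩ := h.nonempty
  have hYC : ∀ i, y ≠ f i := fun i => (h.sep y hy _ ⟨i, rfl⟩).1
  obtain ⟨p, hp⟩ := h.link 0 y (by simp [hYC]) (f 4) (by
    simp only [Set.mem_compl_iff, Set.mem_insert_iff, Set.mem_singleton_iff, h.nonagon.inj.eq_iff]
    decide)
  have h4Y : f 4 ∉ Y := h.sep.notMem ⟨4, rfl⟩
  obtain ⟨d, -, hd1, hd2⟩ := p.exists_boundary_dart Y hy h4Y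
  have hu : d.snd ∈ bd G Y := ⟨hd2, d.fst, hd1, d.adj.symm⟩
  obtain ⟨i, hi⟩ := h.dominate f h.nonagon h.sep _ hu
  exact ⟨i, _, hu, hi⟩

theorem val_le_of_mem_base {b z i : ZMod 9} (h : i = b ∨ i = z ∨ i ∈ arc b z) :
    (i - b).val ≤ (z - b).val := by
  rcases h with rfl | rfl | h
  · simp
  · exact le_rfl
  · exact h.2.le

/-- All labels lie in the base of an odd jump anticomplete to `Y`. -/
theorem Setting.mem_base (h : Setting G f Y) (hJ : OddJump G f b z W) (hW : Sep G Y W)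
    (hc : IsLabel G f Y c) : (c - b).val ≤ (z - b).val := by
  obtain ⟨u, hu, huc⟩ := hc
  have huf := h.notMem_range hu
  have huW : u ∉ W := fun hc => hW.notMem_bd hc hu
  by_contra hcon
  have hc' : ¬ (c = b ∨ c = z ∨ c ∈ arc b z) := fun e => hcon (val_le_of_mem_base e)
  push Not at hc'
  obtain ⟨f', hf', hr⟩ := hJ.exists_isNonagon h.good h.nonagon
  have hsep : Sep G Y (Set.range f') := by
    rw [hr, sep_union_right, sep_union_right]
    refine ⟨⟨h.sep.mono subset_rfl ?_, hW⟩, h.sep.mono subset_rfl (Set.image_subset_range _ _)⟩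
    rintro _ (rfl | rfl)
    exacts [⟨b, rfl⟩, ⟨z, rfl⟩]
  obtain ⟨j, hj⟩ := h.dominate f' hf' hsep u hu
  have hn : f' j ∈ Set.range f' := ⟨j, rfl⟩
  rw [hr] at hn
  rcases hn with (hn | hn) | ⟨i, hi, hn⟩
  · rcases hn with hn | hn
    · rw [hn] at hj
      exact hc'.1 (h.label_unique hu huc hj)
    · rw [hn] at hj
      exact hc'.2.1 (h.label_unique hu huc hj)
  · have := hJ.leg h.good h.nonagon hn
      (Arris.two hj.symm huc fun e => hJ.jump.out _ hn ⟨c, e.symm⟩) le_rfl hc'.1 hc'.2.1 ?_ ?_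
    · omega
    · intro i hi
      rw [sep_singleton_left]
      rintro _ rfl
      exact ⟨fun e => huf ⟨i, e.symm⟩, fun e => hi (h.label_unique hu e huc)⟩
    · rw [sep_singleton_left]
      refine fun w hw => ⟨fun e => huW (e ▸ hw.1), fun e => hw.2 ?_⟩
      exact hJ.unique_adj h.good h.nonagon huf huW (Or.inl (Or.inr hw.1)) (Or.inl (Or.inr hn)) e hj
  · rw [← hn] at hj
    exact hc'.2.2 (h.label_unique hu huc hj ▸ hi)

theorem Jump.five_le (hG : Good G) (hf : IsNonagon G f) {n : ℕ} (h : Jump G f b z n W)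
    (hn : n ≠ 1) : 5 ≤ n := by
  by_cases hadj : G.Adj (f b) (f z)
  · have := h.adj_cases hG hadj hn
    omega
  · have := h.length_cases hG hf hadj
    omega

theorem Good.jump_of_arris (hG : Good G) (hf : IsNonagon G f) {p : V} {k : ℕ} {I : Set V}
    (hA : Arris G (f b) p k I) (hadj : G.Adj (f b) p → k = 1) (hz : G.Adj p (f z)) (hbz : z ≠ b)
    (hI : ∀ a ∈ I, a ∉ Set.range f) (hIb : ∀ a ∈ I, ∀ i, G.Adj a (f i) → i = b)
    (hp : p ∉ Set.range f) : Jump G f b z (k + 1) (I ∪ {p}) := by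
  have hB := hA.append (Arris.edge hz) (fun e => hbz (hf.inj e.symm)) sep_empty_right
    (sep_singleton_right.2 fun a ha => ⟨fun e => hI a ha ⟨z, e.symm⟩,
      fun e => hbz (hIb a ha z e)⟩)
    sep_empty_right hadj (fun _ => rfl)
  rw [Set.union_empty] at hB
  refine ⟨hB, ?_, ?_⟩
  · rintro w (hw | rfl)
    exacts [hI w hw, hp]
  · rintro w (hw | rfl) l hl
    · exact Or.inl (hIb w hw l hl)
    · exact Or.inr (hG.unique_adj hf hp hl hz)

/-- There is no second nonagon sharing exactly one vertex with the first, which is its only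
attachment, unless that vertex carries the only label. -/
theorem Setting.not_nonagon_at (h : Setting G f Y) {f' : ZMod 9 → V} (hf' : IsNonagon G f')
    (hsep : Sep G Y (Set.range f')) {i₀ x : ZMod 9} (hx : f' i₀ = f x)
    (hout : ∀ i ≠ i₀, f' i ∉ Set.range f) (hatt : ∀ i ≠ i₀, ∀ j, G.Adj (f' i) (f j) → j = x)
    (hc : IsLabel G f Y c) (hcx : c ≠ x) : False := by
  obtain ⟨u, hu, huc⟩ := hc
  have huf := h.notMem_range hu
  have hux : ¬ G.Adj u (f x) := fun e => hcx (h.label_unique hu huc e)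
  have huf' : u ∉ Set.range f' := fun e => hsep.notMem_bd e hu
  obtain ⟨j, hj⟩ := h.dominate f' hf' hsep u hu
  have hjne : j ≠ i₀ := by
    rintro rfl
    exact hux (hx ▸ hj)
  have key : ∀ k S, i₀ ∉ S → j ∉ S → Arris G (f' i₀) (f' j) k (f' '' S) →
      (G.Adj (f' i₀) (f' j) → k = 1) → ∃ W, Jump G f x c (k + 2) W := by
    intro k S hi₀ hjS hA hadj
    rw [hx] at hA hadj
    have hxu : f x ≠ u := fun e => huf ⟨x, e⟩
    have hB := hA.append (Arris.edge hj.symm) hxu sep_empty_right ?_ sep_empty_right hadj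
      (fun _ => rfl)
    · rw [Set.union_empty] at hB
      refine ⟨_, h.good.jump_of_arris h.nonagon hB (fun e => (hux e.symm).elim) huc hcx ?_ ?_ huf⟩
      · rintro a (⟨i, hi, rfl⟩ | rfl)
        exacts [hout i fun e => hi₀ (e ▸ hi), hout j hjne]
      · rintro a (⟨i, hi, rfl⟩ | rfl)
        exacts [hatt i fun e => hi₀ (e ▸ hi), hatt j hjne]
    · rw [sep_singleton_right]
      rintro _ ⟨i, hi, rfl⟩
      exact ⟨fun e => huf' ⟨i, e⟩, fun e =>
        hjS (h.good.unique_adj hf' huf' e.symm hj ▸ hi)⟩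
  by_cases hadj : G.Adj (f' i₀) (f' j)
  · obtain ⟨W, hW⟩ := key 1 ∅ (by simp) (by simp) (by simpa using Arris.edge hadj) (fun _ => rfl)
    have := hW.five_le h.good h.nonagon (by omega)
    omega
  · obtain ⟨W₁, hW₁⟩ := key _ _ (left_notMem_arc _ _) (right_notMem_arc _ _)
      (hf'.arris_arc hjne.symm) (fun e => (hadj e).elim)
    obtain ⟨W₂, hW₂⟩ := key _ _ (right_notMem_arc _ _) (left_notMem_arc _ _)
      (hf'.arris_arc_symm hjne.symm) (fun e => (hadj e).elim)
    have hs := val_add_val hjne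
    by_cases hcadj : G.Adj (f x) (f c)
    · have h1 := hW₁.adj_cases h.good hcadj (by omega)
      have h2 := hW₂.adj_cases h.good hcadj (by omega)
      omega
    · have h1 := hW₁.length_cases h.good h.nonagon hcadj
      have h2 := hW₂.length_cases h.good h.nonagon hcadj
      omega

/-- Given two labels spanning an arc of length between two and four, every other label is next to
that arc. -/
theorem Setting.third_label (h : Setting G f Y) {c₁ c₂ c₃ : ZMod 9} (h₁ : IsLabel G f Y c₁)
    (h₂ : IsLabel G f Y c₂) (h₃ : IsLabel G f Y c₃) (h31 : c₃ ≠ c₁) (h32 : c₃ ≠ c₂)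
    (h2 : 2 ≤ (c₂ - c₁).val) (h4 : (c₂ - c₁).val ≤ 4) : c₃ = c₁ - 1 ∨ c₃ = c₂ + 1 := by
  obtain ⟨u₁, hu₁, hc₁⟩ := h₁
  obtain ⟨u₂, hu₂, hc₂⟩ := h₂
  obtain ⟨u₃, hu₃, hc₃⟩ := h₃
  obtain ⟨-, y₁, hy₁, hy₁'⟩ := id hu₁
  obtain ⟨-, y₂, hy₂, hy₂'⟩ := id hu₂
  obtain ⟨-, y₃, hy₃, hy₃'⟩ := id hu₃
  have hne : c₂ ≠ c₁ := by
    rintro rfl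
    simp at h2
  have hYf : ∀ a ∈ Y, a ∉ Set.range f := fun a ha hc => h.sep.notMem hc ha
  have hYa : ∀ a ∈ Y, ∀ i, ¬ G.Adj a (f i) := fun a ha i => (h.sep a ha _ ⟨i, rfl⟩).2
  have hsum := val_add_val hne
  obtain ⟨j', hj', ⟨a, ha, haj⟩, n, W, hWD, hW⟩ := h.good.exists_jump h.nonagon
    ((h.conn.insert hy₂ hy₂').insert (Set.mem_insert_of_mem _ hy₁) hy₁') (by
      rintro a (rfl | rfl | ha)
      exacts [h.notMem_range hu₁, h.notMem_range hu₂, hYf a ha]) hne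
    ⟨u₁, Or.inl rfl, hc₁⟩ ⟨u₂, Or.inr (Or.inl rfl), hc₂⟩
  have hj'c : j' = c₂ := by
    rcases ha with rfl | rfl | ha
    exacts [(hj' (h.label_unique hu₁ haj hc₁)).elim, h.label_unique hu₂ haj hc₂,
      (hYa a ha _ haj).elim]
  subst hj'c
  have hnadj : ¬ G.Adj (f c₁) (f j') := by
    rw [h.nonagon.adj_iff_val]
    omega
  have hJ : OddJump G f c₁ j' W := (hW.oddJump h.good h.nonagon hnadj).resolve_right fun e => by
    have := e.le
    omega
  obtain ⟨w, hw⟩ : W.Nonempty := by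
    obtain ⟨w, hw, -⟩ := hJ.jump.arris.exists_adj (by omega)
    exact ⟨w, hw⟩
  obtain ⟨_, _, _, _, _, h'⟩ := hJ.conn_touch h.good h.nonagon (h.conn.insert hy₃ hy₃') (by
      rintro a (rfl | ha)
      exacts [h.notMem_range hu₃, hYf a ha]) (x := c₃) (by
      rintro a (rfl | ha) i hi
      exacts [h.label_unique hu₃ hi hc₃, (hYa a ha i hi).elim]) ⟨u₃, Or.inl rfl, hc₃⟩ h31 h32 (by
      rcases hWD hw with rfl | rfl | hwY
      · exact ⟨y₁, Or.inr hy₁, Or.inr ⟨_, hw, hy₁'.symm⟩⟩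
      · exact ⟨y₂, Or.inr hy₂, Or.inr ⟨_, hw, hy₂'.symm⟩⟩
      · exact ⟨w, Or.inr hwY, Or.inl hw⟩)
  exact h'.imp And.left And.left

/-- Exactly one vertex of `W` has a neighbour in `Y`; it is adjacent to `f z`, and so are all
neighbours of `Y` which are adjacent to a vertex of `W`. -/
structure Tied (G : SimpleGraph V) (f : ZMod 9 → V) (Y W : Set V) (z : ZMod 9) (w : V) :
    Prop where
  mem : w ∈ W
  mem_bd : w ∈ bd G Y
  adj : G.Adj w (f z)
  sep : ∀ a ∈ W, a ≠ w → Sep G Y {a}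
  adj_of_adj : ∀ a ∈ W, ∀ u ∈ bd G Y, G.Adj a u → G.Adj u (f z)

theorem Tied.isLabel {w : V} (h : Tied G f Y W z w) : IsLabel G f Y z := ⟨w, h.mem_bd, h.adj⟩

theorem Tied.mono {w : V} (h : Tied G f Y W z w) {W' : Set V} (hW : W' ⊆ W) (hw : w ∈ W') :
    Tied G f Y W' z w :=
  ⟨hw, h.mem_bd, h.adj, fun a ha => h.sep a (hW ha), fun a ha => h.adj_of_adj a (hW ha)⟩

theorem Setting.label_of_tied (h : Setting G f Y) {s e : ZMod 9} (hJ : OddJump G f s e W) {w : V}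
    (hW : Tied G f Y W z w) (hc : IsLabel G f Y c) (hcs : c ≠ s) (hce : c ≠ e) (hcz : c ≠ z) :
    (c = s - 1 ∧ z = s) ∨ (c = e + 1 ∧ z = e) := by
  obtain ⟨u, hu, huc⟩ := hc
  obtain ⟨-, y, hy, huy⟩ := id hu
  obtain ⟨-, y', hy', hwy'⟩ := id hW.mem_bd
  have hYf : ∀ a ∈ Y, a ∉ Set.range f := fun a ha hc => h.sep.notMem hc ha
  have hYa : ∀ a ∈ Y, ∀ i, ¬ G.Adj a (f i) := fun a ha i => (h.sep a ha _ ⟨i, rfl⟩).2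
  obtain ⟨p, hp, n, hn, hpn, h'⟩ := hJ.conn_touch h.good h.nonagon (h.conn.insert hy huy) (by
      rintro a (rfl | ha)
      exacts [h.notMem_range hu, hYf a ha]) (x := c) (by
      rintro a (rfl | ha) i hi
      exacts [h.label_unique hu hi huc, (hYa a ha i hi).elim]) ⟨u, Or.inl rfl, huc⟩ hcs hce
      ⟨y', Or.inr hy', Or.inr ⟨w, hW.mem, hwy'.symm⟩⟩
  rcases hp with rfl | hp
  · exact (hcz (h.label_unique hu huc (hW.adj_of_adj n hn p hu hpn.symm))).elim
  · have hnw : n = w := by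
      by_contra hne
      exact (hW.sep n hn hne p hp n rfl).2 hpn
    subst hnw
    rcases h' with ⟨h1, h2⟩ | ⟨h1, h2⟩
    · exact Or.inl ⟨h1, h.label_unique hW.mem_bd hW.adj h2⟩
    · exact Or.inr ⟨h1, h.label_unique hW.mem_bd hW.adj h2⟩

end NineHoles

namespace NineHoles

variable {G : SimpleGraph V} {f : ZMod 9 → V} {g z c : ZMod 9} {W Y : Set V}

/-- An induced path of length `k` from `f g` to a vertex `q` adjacent to `f z`, attaching to the
nonagon only at `z` and, before reaching `q`, near `g`. -/
structure Reach (G : SimpleGraph V) (f : ZMod 9 → V) (Y : Set V) (g z : ZMod 9) (k : ℕ)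
    (I : Set V) (q : V) : Prop where
  arris : Arris G (f g) q k I
  adj : G.Adj q (f z)
  ne : z ≠ g - 1 ∧ z ≠ g ∧ z ≠ g + 1
  out : ∀ a ∈ I, a ∉ Set.range f
  notMem_range : q ∉ Set.range f
  att : ∀ a ∈ I, ∀ i, G.Adj a (f i) → i = g - 1 ∨ i = g ∨ i = g + 1
  fin : Sep G Y (I ∪ {q}) ∨ Tied G f Y (I ∪ {q}) z q

theorem Good.eq_of_adj (hG : Good G) (hf : IsNonagon G f) {p q : V} (hp : p ∉ Set.range f)
    (hq : q ∉ Set.range f) (hpq : G.Adj p q) {i j : ZMod 9} (hi : G.Adj p (f i))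
    (hj : G.Adj q (f j)) : i = j := by
  by_contra hij
  have hqi : ¬ G.Adj q (f i) := fun e => hij (hG.unique_adj hf hq e hj)
  have hJ := hG.jump_of_arris hf (Arris.two hi.symm hpq fun e => hq ⟨i, e⟩)
    (fun e => (hqi e.symm).elim) hj (Ne.symm hij) (by rintro _ rfl; exact hp)
    (by rintro _ rfl l hl; exact hG.unique_adj hf hp hl hi) hq
  have := hJ.five_le hG hf (by omega)
  omega

theorem Setting.adj_of_adj_bd (h : Setting G f Y) {p u u' : V} (hu : u ∈ bd G Y)
    (hu' : u' ∈ bd G Y) (hz : G.Adj u (f z)) (hpu : G.Adj p u) (hpu' : G.Adj p u')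
    (hp : p ∉ Set.range f) : G.Adj u' (f z) := by
  obtain ⟨z', hz'⟩ := h.dominate f h.nonagon h.sep u' hu'
  suffices e : z' = z from e ▸ hz'
  by_contra hne
  have huf := h.notMem_range hu
  have huf' := h.notMem_range hu'
  by_cases hph : ∃ i, G.Adj p (f i)
  · obtain ⟨i, hi⟩ := hph
    exact hne ((h.good.eq_of_adj h.nonagon hp huf' hpu' hi hz').symm.trans
      (h.good.eq_of_adj h.nonagon hp huf hpu hi hz))
  · push Not at hph
    have huu : u ≠ u' := fun e => hne (h.label_unique hu' hz' (e ▸ hz))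
    have hA := (Arris.two hz.symm hpu.symm fun e => hp ⟨z, e⟩).append (Arris.edge hpu')
      (fun e => huf' ⟨z, e⟩) sep_empty_right
      (by
        rw [sep_singleton_right]
        rintro _ rfl
        exact ⟨huu, fun e => hne (h.good.eq_of_adj h.nonagon huf huf' e hz hz').symm⟩)
      sep_empty_right (fun e => (hph z e.symm).elim) (fun _ => rfl)
    rw [Set.union_empty] at hA
    have hJ := h.good.jump_of_arris h.nonagon hA
      (fun e => (hne (h.label_unique hu' hz' e.symm)).elim) hz' hne (by
        rintro _ (rfl | rfl)
        exacts [huf, hp]) (by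
        rintro _ (rfl | rfl) l hl
        exacts [h.label_unique hu hl hz, (hph l hl).elim]) huf'
    have := hJ.five_le h.good h.nonagon (by omega)
    omega

theorem Setting.exists_reach (h : Setting G f Y)
    (ht : ∀ c, IsLabel G f Y c → c ≠ g - 1 ∧ c ≠ g ∧ c ≠ g + 1) :
    ∃ z k I q, Reach G f Y g z k I q := by
  obtain ⟨s, hs, hgs⟩ := h.third g
  have hD : ∀ i, f i ∈ ({f (g - 1), f g, f (g + 1)}ᶜ : Set V) ↔
      i ≠ g - 1 ∧ i ≠ g ∧ i ≠ g + 1 := by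
    intro i
    simp [h.nonagon.inj.eq_iff]
  have hsD : s ∈ ({f (g - 1), f g, f (g + 1)}ᶜ : Set V) := by
    rintro (e | e | e)
    exacts [hs ⟨_, e.symm⟩, hs ⟨_, e.symm⟩, hs ⟨_, e.symm⟩]
  have h4 : ∀ g : ZMod 9, (g + 4 ≠ g - 1 ∧ g + 4 ≠ g ∧ g + 4 ≠ g + 1) ∧
      (g + 5 ≠ g - 1 ∧ g + 5 ≠ g ∧ g + 5 ≠ g + 1) ∧ g + 5 = g + 4 + 1 := by decide
  have hnext : ∀ g i : ZMod 9, i ≠ g - 1 ∧ i ≠ g ∧ i ≠ g + 1 → ∃ j,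
      (j = i + 1 ∨ i = j + 1) ∧ j ≠ g - 1 ∧ j ≠ g ∧ j ≠ g + 1 := by decide +kernel
  obtain ⟨p, hpD, hQ, n, I, hID, hA, hadj, hI⟩ := (h.link g s hsD (f (g + 4))
    ((hD _).2 (h4 g).1)).exists_first (x := f g) (fun e => ((hD _).1 e).2.1 rfl) hgs
    (Q := fun v => v ∈ Y ∨ v ∈ bd G Y ∨ (∃ i, (i ≠ g - 1 ∧ i ≠ g ∧ i ≠ g + 1) ∧ G.Adj v (f i)) ∨
      ∃ u ∈ bd G Y, G.Adj v u)
    (Or.inr (Or.inr (Or.inl ⟨g + 5, (h4 g).2.1, (h.nonagon.adj_iff _ _).2 (Or.inl (h4 g).2.2)⟩)))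
  push Not at hI
  have hIatt : ∀ a ∈ I, ∀ i, G.Adj a (f i) → i = g - 1 ∨ i = g ∨ i = g + 1 := by
    intro a ha i hi
    by_contra hc
    push Not at hc
    exact (hI a ha).2.2.1 i hc hi
  have hIout : ∀ a ∈ I, a ∉ Set.range f := by
    rintro _ ha ⟨i, rfl⟩
    obtain ⟨j, hij, hj⟩ := hnext g i ((hD i).1 (hID ha))
    exact (hI _ ha).2.2.1 j hj ((h.nonagon.adj_iff _ _).2 hij)
  obtain ⟨b, hb, hpb⟩ : ∃ b, (b = f g ∨ b ∈ I) ∧ G.Adj p b := by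
    by_cases hn : n = 1
    · subst hn
      exact ⟨_, Or.inl rfl, hA.adj_of_one.symm⟩
    · obtain ⟨b, hb, hpb⟩ := hA.symm.exists_adj hn
      exact ⟨b, Or.inr hb, hpb⟩
  have hpY : p ∉ Y := by
    intro hp
    rcases hb with rfl | hb
    · exact (h.sep p hp _ ⟨g, rfl⟩).2 hpb
    · exact (hI b hb).2.1 ⟨(hI b hb).1, p, hp, hpb.symm⟩
  have hpb' : p ∉ bd G Y := by
    intro hp
    rcases hb with rfl | hb
    · exact (ht g ⟨p, hp, hpb⟩).2.1 rfl
    · exact (hI b hb).2.2.2 p hp hpb.symm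
  have hpf : p ∉ Set.range f := by
    rintro ⟨i, rfl⟩
    have hi := (hD i).1 hpD
    rcases hb with rfl | hb
    · rcases (h.nonagon.adj_iff _ _).1 hpb with e | e
      · exact hi.1 (eq_sub_of_add_eq e.symm)
      · exact hi.2.2 e
    · exact (hI b hb).2.2.1 i hi hpb.symm
  have hsep : ∀ a, a ∉ Y → a ∉ bd G Y → Sep G Y {a} := by
    rintro a ha ha' y hy _ rfl
    exact ⟨fun e => ha (e ▸ hy), fun e => ha' ⟨ha, y, hy, e.symm⟩⟩
  have hIp : ∀ a ∈ I ∪ {p}, Sep G Y {a} := by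
    rintro a (ha | rfl)
    exacts [hsep a (hI a ha).1 (hI a ha).2.1, hsep _ hpY hpb']
  by_cases hz : ∃ i, (i ≠ g - 1 ∧ i ≠ g ∧ i ≠ g + 1) ∧ G.Adj p (f i)
  · obtain ⟨z, hzt, hz⟩ := hz
    exact ⟨z, n, I, p, hA, hz, hzt, hIout, hpf, hIatt,
      Or.inl fun y hy a ha => hIp a ha y hy a rfl⟩
  · obtain ⟨u, hu, hpu⟩ := ((hQ.resolve_left hpY).resolve_left hpb').resolve_left hz
    push Not at hz
    obtain ⟨z, huz⟩ := h.dominate f h.nonagon h.sep u hu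
    have huf := h.notMem_range hu
    have hB := hA.append (Arris.edge hpu) (fun e => huf ⟨g, e⟩) sep_empty_right
      (sep_singleton_right.2 fun a ha => ⟨fun e => (hI a ha).2.1 (e ▸ hu),
        (hI a ha).2.2.2 u hu⟩) sep_empty_right hadj (fun _ => rfl)
    rw [Set.union_empty] at hB
    refine ⟨z, n + 1, I ∪ {p}, u, hB, huz, ht z ⟨u, hu, huz⟩, ?_, huf, ?_, Or.inr
      ⟨Or.inr rfl, hu, huz, ?_, ?_⟩⟩
    · rintro a (ha | rfl)
      exacts [hIout a ha, hpf]
    · rintro a (ha | rfl) i hi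
      · exact hIatt a ha i hi
      · by_contra hc
        push Not at hc
        exact hz i hc hi
    · rintro a (ha | ha) hau
      exacts [hIp a ha, (hau ha).elim]
    · rintro a ((ha | rfl) | rfl) u' hu' hau
      · exact ((hI a ha).2.2.2 u' hu' hau).elim
      · exact h.adj_of_adj_bd hu hu' huz hpu hau hpf
      · obtain ⟨z', hz'⟩ := h.dominate f h.nonagon h.sep u' hu'
        exact (h.good.eq_of_adj h.nonagon huf (h.notMem_range hu') hau huz hz') ▸ hz'

variable {k : ℕ} {I : Set V} {q : V}

theorem Reach.sep (h : Reach G f Y g z k I q) : Sep G Y I := by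
  rcases h.fin with h' | h'
  · exact h'.mono subset_rfl Set.subset_union_left
  · intro y hy a ha
    exact h'.sep a (Or.inl ha) (fun e => h.arris.right_notMem (e ▸ ha)) y hy a rfl

theorem Reach.not_adj (h : Reach G f Y g z k I q) (hG : Good G) (hf : IsNonagon G f) :
    ¬ G.Adj (f g) q :=
  fun e => h.ne.2.1 (hG.unique_adj hf h.notMem_range h.adj e.symm)

theorem Reach.two_le (h : Reach G f Y g z k I q) (hG : Good G) (hf : IsNonagon G f) : 2 ≤ k := by
  have h1 := h.arris.one_le
  by_contra hc
  obtain rfl : k = 1 := by omega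
  exact h.not_adj hG hf h.arris.adj_of_one

theorem Reach.arris_succ (h : Reach G f Y g z k I q) (hG : Good G) (hf : IsNonagon G f) :
    Arris G (f g) (f z) (k + 1) (I ∪ {q}) := by
  have hB := h.arris.append (Arris.edge h.adj) (fun e => h.ne.2.1 (hf.inj e.symm)) sep_empty_right
    (sep_singleton_right.2 fun a ha => ⟨fun e => h.out a ha ⟨z, e.symm⟩, fun e => by
      have := h.att a ha z e
      have := h.ne
      tauto⟩)
    sep_empty_right (fun e => (h.not_adj hG hf e).elim) (fun _ => rfl)
  rwa [Set.union_empty] at hB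

/-- The interior of a reach cannot attach to both sides of `g`. -/
theorem Reach.not_both (h : Reach G f Y g z k I q) (hS : Setting G f Y)
    (ht : ∀ c, IsLabel G f Y c → c ≠ g - 1 ∧ c ≠ g ∧ c ≠ g + 1)
    (h₁ : ∃ a ∈ I, G.Adj a (f (g - 1))) (h₂ : ∃ a ∈ I, G.Adj a (f (g + 1))) : False := by
  have hk := h.two_le hS.good hS.nonagon
  have hne : ∀ g : ZMod 9, g - 1 ≠ g ∧ g + 1 ≠ g ∧ g + 1 ≠ g - 1 ∧ (g + 1 - (g - 1)).val = 2 ∧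
      (g - 1 - (g + 1)).val = 7 := by decide
  obtain ⟨a₀, ha₀, hga⟩ := h.arris.exists_adj (by omega)
  obtain ⟨n₁, n₂, I₁, I₂, hs⟩ := h.arris.split ha₀
  obtain rfl := hs.adj_left hga
  obtain rfl := hs.left.eq_empty_of_one
  have key : ∀ i ≠ g, (∃ a ∈ I, G.Adj a (f i)) → ∃ a ∈ I₂, G.Adj a (f i) := by
    rintro i hi ⟨a, ha, hai⟩
    have ha' := ha
    rw [hs.eq] at ha'
    rcases ha' with (ha' | rfl) | ha'
    · exact ha'.elim
    · exact (hi (hS.good.unique_adj hS.nonagon (h.out a ha) hai hga.symm)).elim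
    · exact ⟨a, ha', hai⟩
  obtain ⟨j, hj, ⟨a, ha, haj⟩, n, W, hW, hJ⟩ := hS.good.exists_jump hS.nonagon hs.right.conn
    (fun a ha => h.out a (hs.right_subset ha)) (hne g).2.2.1 (key _ (hne g).1 h₁)
    (key _ (hne g).2.1 h₂)
  rcases h.att a (hs.right_subset ha) j haj with rfl | rfl | rfl
  · exact hj rfl
  · exact (hs.sep_left _ rfl a ha).2 haj.symm
  · rcases hJ.oddJump hS.good hS.nonagon (by rw [hS.nonagon.adj_iff_val, (hne g).2.2.2.1]; omega)
      with hO | hO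
    · obtain ⟨c, hc⟩ := hS.exists_isLabel
      have h1 := hS.mem_base hO (h.sep.mono subset_rfl (hW.trans hs.right_subset)) hc
      have h2 := ht c hc
      rw [(hne g).2.2.2.1] at h1
      have : ∀ g c : ZMod 9, (c - (g - 1)).val ≤ 2 → c = g - 1 ∨ c = g ∨ c = g + 1 := by
        decide +kernel
      have := this g c h1
      tauto
    · have h1 := hO.le
      rw [(hne g).2.2.2.2] at h1
      omega

theorem Setting.even_of_path (h : Setting G f Y) (hc : IsLabel G f Y c) (hcg : c ≠ g)
    (hcg' : c ≠ g + 1) : ∀ n : ℕ, ∀ (a : V) (I : Set V), Arris G (f g) a n I →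
      G.Adj a (f (g + 1)) → (∀ x ∈ I ∪ {a}, x ∉ Set.range f) →
      (∀ x ∈ I ∪ {a}, ∀ i, G.Adj x (f i) → i = g ∨ i = g + 1) → Sep G Y (I ∪ {a}) →
      Even n ∧ 8 ≤ n := by
  have hne : ∀ g : ZMod 9, g + 1 ≠ g ∧ (g + 1 - g).val = 1 := by decide
  intro n
  induction n using Nat.strong_induction_on with
  | _ n ih =>
  intro a I hA hah hout hatt hsep
  have haf : a ∉ Set.range f := hout a (Or.inr rfl)
  have hag : ¬ G.Adj (f g) a := fun e =>
    (hne g).1 (h.good.unique_adj h.nonagon haf hah e.symm)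
  have hn : n ≠ 1 := by
    rintro rfl
    exact hag hA.adj_of_one
  by_cases hI : ∃ b ∈ I, G.Adj b (f (g + 1))
  · obtain ⟨a', ha', hah', n₁, n₂, I₁, I₂, hs, hI₁⟩ := hA.symm.exists_first _ hI
    have hsub : I₂ ∪ {a'} ⊆ I ∪ {a} := by
      rintro x (hx | rfl)
      exacts [Or.inl (hs.right_subset hx), Or.inl ha']
    have hlen := hs.len
    have h1 := hs.left.one_le
    have ih' := ih n₂ (by omega) a' I₂ hs.right.symm hah' (fun x hx => hout x (hsub hx))
      (fun x hx => hatt x (hsub hx)) (hsep.mono subset_rfl hsub)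
    have hI₁' : ∀ x ∈ I₁, ∀ i, ¬ G.Adj x (f i) := by
      intro x hx i hi
      rcases hatt x (Or.inl (hs.left_subset hx)) i hi with rfl | rfl
      exacts [(hs.sep_right x hx _ rfl).2 hi, hI₁ x hx hi]
    have hD := Arris.two hah hah'.symm hs.left.ne
    have hdisj : ∀ x ∈ I₁, x ∉ ({f (g + 1)} : Set V) := by
      rintro x hx rfl
      exact hout _ (Or.inl (hs.left_subset hx)) ⟨_, rfl⟩
    have h9 := h.good.nine_le_of_arris hs.left hD hdisj (by omega)
    have hsepI : Sep G I₁ {f (g + 1)} := sep_singleton_right.2 fun x hx =>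
      ⟨hdisj x hx, hI₁' x hx _⟩
    have hhole := h.good.hole hs.left hD hsepI (fun e => Or.inl (hs.adj_left e)) (by omega)
    have hev : ¬ Odd (n₁ + 2) := by
      intro ho
      obtain ⟨-, f', hf', hr⟩ := hhole.2 ho
      have hmem : ∀ i, f' i = f (g + 1) ∨ f' i = a ∨ f' i = a' ∨ f' i ∈ I₁ := by
        intro i
        have : f' i ∈ Set.range f' := ⟨i, rfl⟩
        rw [hr] at this
        rcases this with ((e | e) | e) | e
        exacts [Or.inr (Or.inl e), Or.inr (Or.inr (Or.inl e)), Or.inr (Or.inr (Or.inr e)),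
          Or.inl e]
      obtain ⟨i₀, hi₀⟩ : f (g + 1) ∈ Set.range f' := by
        rw [hr]
        exact Or.inr rfl
      have hrest : ∀ i ≠ i₀, f' i = a ∨ f' i = a' ∨ f' i ∈ I₁ := fun i hi =>
        (hmem i).resolve_left fun e => hi (hf'.inj (e.trans hi₀.symm))
      have ha'f := hout a' (Or.inl ha')
      refine h.not_nonagon_at hf' ?_ hi₀ ?_ ?_ hc hcg'
      · rintro y hy _ ⟨i, rfl⟩
        rcases hmem i with e | e | e | e
        · exact e ▸ h.sep y hy _ ⟨_, rfl⟩
        · exact e ▸ hsep y hy a (Or.inr rfl)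
        · exact e ▸ hsep y hy a' (Or.inl ha')
        · exact hsep y hy _ (Or.inl (hs.left_subset e))
      · intro i hi
        rcases hrest i hi with e | e | e
        · exact e ▸ haf
        · exact e ▸ ha'f
        · exact hout _ (Or.inl (hs.left_subset e))
      · intro i hi j hj
        rcases hrest i hi with e | e | e
        · exact h.good.unique_adj h.nonagon haf (e ▸ hj) hah
        · exact h.good.unique_adj h.nonagon ha'f (e ▸ hj) hah'
        · exact (hI₁' _ e _ hj).elim
    have := ih'.1
    grind
  · push Not at hI
    have hJ := h.good.jump_of_arris h.nonagon hA (fun e => (hag e).elim) hah (hne g).1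
      (fun x hx => hout x (Or.inl hx))
      (fun x hx i hi => (hatt x (Or.inl hx) i hi).resolve_right fun e => hI x hx (e ▸ hi)) haf
    rcases hJ.adj_cases h.good ((h.nonagon.adj_iff _ _).2 (Or.inl rfl))
      (by have := hA.one_le; omega) with e | e
    · have hO : OddJump G f g (g + 1) (I ∪ {a}) := by
        refine ⟨?_, ?_⟩
        · rw [(hne g).2]
          rw [e] at hJ
          exact hJ
        · rw [(hne g).2]
          omega
      have h1 := h.mem_base hO hsep hc
      rw [(hne g).2] at h1
      have : ∀ g c : ZMod 9, (c - g).val ≤ 1 → c = g ∨ c = g + 1 := by decide +kernel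
      have := this g c h1
      tauto
    · grind

end NineHoles

namespace NineHoles

variable {G : SimpleGraph V} {f : ZMod 9 → V} {g z c : ZMod 9} {W Y : Set V}
  {k : ℕ} {I : Set V} {q : V}

/-- An induced path of odd length from `f g` to `f (g + 2)` attaching only to
`f g, f (g + 1), f (g + 2)`. -/
def Detour (G : SimpleGraph V) (f : ZMod 9 → V) (Y : Set V) (g : ZMod 9) : Prop :=
  ∃ k I, Arris G (f g) (f (g + 2)) k I ∧ Odd k ∧ (∀ a ∈ I, a ∉ Set.range f) ∧
    (∀ a ∈ I, ∀ i, G.Adj a (f i) → i = g ∨ i = g + 1 ∨ i = g + 2) ∧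
    ∃ q, Tied G f Y I (g + 2) q

/-- An odd jump leaving from `f g` or `f (g + 1)`. -/
def Exit (G : SimpleGraph V) (f : ZMod 9 → V) (Y : Set V) (g : ZMod 9) : Prop :=
  ∃ s e W, OddJump G f s e W ∧ (s = g ∨ s = g + 1) ∧ (e ≠ g - 1 ∧ e ≠ g ∧ e ≠ g + 1) ∧
    (Sep G Y W ∨ ∃ w, Tied G f Y W e w) ∧
    (2 ≤ (e - s).val ∨ s = g + 1 ∧ e = g + 2 ∧ (Sep G Y W ∨ Detour G f Y g))

/-- An odd jump arriving at `f g` or `f (g - 1)`. -/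
def Entry (G : SimpleGraph V) (f : ZMod 9 → V) (Y : Set V) (g : ZMod 9) : Prop :=
  Exit G (fun i => f (g + g - i)) Y g

theorem Reach.fin_mono (h : Reach G f Y g z k I q) {W : Set V} (hW : W ⊆ I ∪ {q}) (hq : q ∈ W) :
    Sep G Y W ∨ ∃ w, Tied G f Y W z w :=
  h.fin.imp (fun h' => h'.mono subset_rfl hW) fun h' => ⟨q, h'.mono hW hq⟩

theorem Reach.not_odd (h : Reach G f Y g z k I q) (hG : Good G) (hf : IsNonagon G f)
    (h₁ : ∀ a ∈ I, ¬ G.Adj a (f (g - 1))) (ho : Odd (k + 1 + (g - z).val)) :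
    k + 1 + (g - z).val = 9 := by
  have hne := h.ne
  have hnadj : ¬ G.Adj (f g) (f z) := by
    rw [hf.adj_iff]
    rintro (e | e)
    exacts [hne.2.2 e, hne.1 (eq_sub_of_add_eq e.symm)]
  have harc : ∀ g z i : ZMod 9, z ≠ g - 1 ∧ z ≠ g ∧ z ≠ g + 1 →
      0 < (i - z).val ∧ (i - z).val < (g - z).val → i ≠ g ∧ i ≠ g + 1 ∧ i ≠ z := by decide +kernel
  have hval : ∀ g z : ZMod 9, z ≠ g - 1 ∧ z ≠ g ∧ z ≠ g + 1 → 2 ≤ (g - z).val := by decide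
  have h2 := hval g z hne
  have hk := h.two_le hG hf
  refine ((hG.hole (h.arris_succ hG hf) (hf.arris_arc_symm hne.2.1.symm) ?_
    (fun e => (hnadj e).elim) (by omega)).2 ho).1
  rintro a ha _ ⟨i, hi, rfl⟩
  have hi' := harc g z i hne hi
  rcases ha with ha | rfl
  · refine ⟨fun e => h.out a ha ⟨i, e.symm⟩, fun e => ?_⟩
    rcases h.att a ha i e with rfl | rfl | rfl
    exacts [h₁ a ha e, hi'.1 rfl, hi'.2.1 rfl]
  · exact ⟨fun e => h.notMem_range ⟨i, e.symm⟩,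
      fun e => hi'.2.2 (hG.unique_adj hf h.notMem_range e h.adj)⟩

theorem Reach.exit (h : Reach G f Y g z k I q) (hS : Setting G f Y)
    (ht : ∀ c, IsLabel G f Y c → c ≠ g - 1 ∧ c ≠ g ∧ c ≠ g + 1)
    (h₁ : ∀ a ∈ I, ¬ G.Adj a (f (g - 1))) (h₂ : ∃ a ∈ I, G.Adj a (f (g + 1))) :
    Exit G f Y g := by
  have hG := hS.good
  have hf := hS.nonagon
  have hne := h.ne
  obtain ⟨c, hc⟩ := hS.exists_isLabel
  obtain ⟨a, ha, hah, m, n, T, I₂, hs, hT⟩ := h.arris.symm.exists_first _ h₂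
  have hIatt : ∀ a ∈ I, ∀ i, G.Adj a (f i) → i = g ∨ i = g + 1 := fun a ha i hi =>
    (h.att a ha i hi).resolve_left fun e => h₁ a ha (e ▸ hi)
  have hsub : I₂ ∪ {a} ⊆ I := by
    rintro x (hx | rfl)
    exacts [hs.right_subset hx, ha]
  have hn := hS.even_of_path hc (ht c hc).2.1 (ht c hc).2.2 n a I₂ hs.right.symm hah
    (fun x hx => h.out x (hsub hx)) (fun x hx => hIatt x (hsub hx)) (h.sep.mono subset_rfl hsub)
  have hlen := hs.len
  have hm1 := hs.left.one_le
  have hodd := h.not_odd hG hf h₁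
  have hTatt : ∀ x ∈ T, ∀ i, ¬ G.Adj x (f i) := by
    intro x hx i hi
    rcases hIatt x (hs.left_subset hx) i hi with rfl | rfl
    exacts [(hs.sep_right x hx _ rfl).2 hi, hT x hx hi]
  have haf := h.out a ha
  have hA : Arris G (f (g + 1)) q (1 + m) (∅ ∪ {a} ∪ T) :=
    (Arris.edge hah.symm).append hs.left.symm (fun e => h.notMem_range ⟨_, e⟩) sep_empty_left
      sep_empty_left (by
        rintro _ rfl x hx
        exact ⟨fun e => h.out x (hs.left_subset hx) ⟨_, e⟩, fun e => hTatt x hx _ e.symm⟩)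
      (fun _ => rfl) (fun e => hs.adj_left e.symm)
  have hW : ∅ ∪ {a} ∪ T ∪ {q} ⊆ I ∪ {q} := by
    rintro x (((hx | rfl) | hx) | rfl)
    exacts [hx.elim, Or.inl ha, Or.inl (hs.left_subset hx), Or.inr rfl]
  have hJ := hG.jump_of_arris hf hA
    (fun e => (hne.2.2 (hG.unique_adj hf h.notMem_range h.adj e.symm)).elim) h.adj hne.2.2 (by
      rintro x ((hx | rfl) | hx)
      exacts [hx.elim, haf, h.out x (hs.left_subset hx)]) (by
      rintro x ((hx | rfl) | hx) i hi
      exacts [hx.elim, hG.unique_adj hf haf hi hah, (hTatt x hx i hi).elim]) h.notMem_range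
  have hfin := h.fin_mono hW (Or.inr rfl)
  by_cases hadj : G.Adj (f (g + 1)) (f z)
  · obtain rfl : z = g + 2 := by
      have : ∀ g z : ZMod 9, (z = g + 1 + 1 ∨ g + 1 = z + 1) → z ≠ g → z = g + 2 := by decide
      exact this g z ((hf.adj_iff _ _).1 hadj) hne.2.1
    have hv : ∀ g : ZMod 9, (g - (g + 2)).val = 7 ∧ (g + 2 - (g + 1)).val = 1 := by decide
    rw [(hv g).1] at hodd
    rcases hJ.adj_cases hG hadj (by omega) with e | e
    · have hO : OddJump G f (g + 1) (g + 2) (∅ ∪ {a} ∪ T ∪ {q}) := by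
        refine ⟨?_, ?_⟩
        · rw [(hv g).2]
          rw [e] at hJ
          exact hJ
        · rw [(hv g).2]
          omega
      refine ⟨_, _, _, hO, Or.inr rfl, hne, hfin, Or.inr ⟨rfl, rfl, ?_⟩⟩
      rcases h.fin with h' | h'
      · exact Or.inl (h'.mono subset_rfl hW)
      · refine Or.inr ⟨k + 1, I ∪ {q}, h.arris_succ hG hf, by grind, ?_, ?_, q, h'⟩
        · rintro x (hx | rfl)
          exacts [h.out x hx, h.notMem_range]
        · rintro x (hx | rfl) i hi
          · exact (hIatt x hx i hi).imp_right Or.inl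
          · exact Or.inr (Or.inr (hG.unique_adj hf h.notMem_range hi h.adj))
    · have := hodd (by grind)
      omega
  · rcases hJ.oddJump hG hf hadj with hO | hO
    · refine ⟨_, _, _, hO, Or.inr rfl, hne, hfin, Or.inl ?_⟩
      rw [hf.adj_iff_val] at hadj
      have := val_pos hJ.ne
      omega
    · have hl := hJ.length_cases hG hf hadj
      have hle := hO.le
      have hs9 := val_add_val hJ.ne
      have hv : ∀ g z : ZMod 9, z ≠ g - 1 ∧ z ≠ g ∧ z ≠ g + 1 →
          (g + 1 - z).val = (g - z).val + 1 ∨ (g + 1 - z).val = 0 := by decide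
      have hp := val_pos hJ.ne.symm
      have hv' := hv g z hne
      have := hodd (by grind)
      omega

theorem IsNonagon.reflect (hf : IsNonagon G f) (r : ZMod 9) : IsNonagon G fun i => f (r - i) := by
  refine ⟨fun i j h => sub_right_injective (hf.inj h), fun i j => ?_⟩
  rw [hf.adj_iff]
  have : ∀ r i j : ZMod 9, (r - j = r - i + 1 ∨ r - i = r - j + 1) ↔ (j = i + 1 ∨ i = j + 1) := by
    decide +kernel
  exact this r i j

theorem range_reflect (f : ZMod 9 → V) (r : ZMod 9) :
    Set.range (fun i => f (r - i)) = Set.range f :=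
  Function.Surjective.range_comp (fun i => ⟨r - i, sub_sub_cancel r i⟩) f

theorem Setting.reflect (h : Setting G f Y) (r : ZMod 9) : Setting G (fun i => f (r - i)) Y where
  good := h.good
  nonagon := h.nonagon.reflect r
  conn := h.conn
  nonempty := h.nonempty
  sep := by rw [range_reflect]; exact h.sep
  link g := by
    have := h.link (r - g)
    rw [show r - (g - 1) = r - g + 1 by ring, show r - (g + 1) = r - g - 1 by ring]
    convert this using 2
    ext x
    simp only [Set.mem_insert_iff, Set.mem_singleton_iff]
    tauto
  third i := by rw [range_reflect]; exact h.third _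
  dominate := h.dominate

theorem isLabel_reflect {r : ZMod 9} :
    IsLabel G (fun i => f (r - i)) Y c ↔ IsLabel G f Y (r - c) := Iff.rfl

theorem Jump.of_reflect {r b z : ZMod 9} {n : ℕ} (h : Jump G (fun i => f (r - i)) b z n W) :
    Jump G f (r - b) (r - z) n W := by
  refine ⟨h.arris, by simpa [range_reflect] using h.out, fun w hw i hi => ?_⟩
  have := h.att w hw (r - i) (by simpa using hi)
  grind

theorem OddJump.of_reflect {r b z : ZMod 9} (h : OddJump G (fun i => f (r - i)) b z W) :
    OddJump G f (r - z) (r - b) W := by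
  have e : r - b - (r - z) = z - b := by ring
  refine ⟨?_, ?_⟩
  · rw [e]
    exact h.jump.of_reflect.symm
  · rw [e]
    exact h.le

theorem OddJump.reflect {b z : ZMod 9} (h : OddJump G f b z W) (r : ZMod 9) :
    OddJump G (fun i => f (r - i)) (r - z) (r - b) W :=
  OddJump.of_reflect (r := r) (f := fun i => f (r - i)) (by simpa using h)

theorem Tied.of_reflect {r : ZMod 9} {w : V} (h : Tied G (fun i => f (r - i)) Y W z w) :
    Tied G f Y W (r - z) w :=
  ⟨h.mem, h.mem_bd, h.adj, h.sep, h.adj_of_adj⟩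

theorem Reach.reflect (h : Reach G f Y g z k I q) :
    Reach G (fun i => f (g + g - i)) Y g (g + g - z) k I q where
  arris := by simpa using h.arris
  adj := by simpa using h.adj
  ne := by
    have : ∀ g z : ZMod 9, z ≠ g - 1 ∧ z ≠ g ∧ z ≠ g + 1 →
      g + g - z ≠ g - 1 ∧ g + g - z ≠ g ∧ g + g - z ≠ g + 1 := by decide
    exact this g z h.ne
  out := by rw [range_reflect]; exact h.out
  notMem_range := by rw [range_reflect]; exact h.notMem_range
  att a ha i hi := by
    have := h.att a ha _ hi
    have h' : ∀ g i : ZMod 9, (g + g - i = g - 1 ∨ g + g - i = g ∨ g + g - i = g + 1) →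
      (i = g - 1 ∨ i = g ∨ i = g + 1) := by decide
    exact h' g i this
  fin := h.fin.imp_right fun h' => Tied.of_reflect (r := g + g) (by simpa using h')

/-- If there is no label near `g` then an odd jump leaves from or arrives at `g`. -/
theorem Setting.exit_or_entry (h : Setting G f Y)
    (ht : ∀ c, IsLabel G f Y c → c ≠ g - 1 ∧ c ≠ g ∧ c ≠ g + 1) :
    Exit G f Y g ∨ Entry G f Y g := by
  have ht' : ∀ c, IsLabel G (fun i => f (g + g - i)) Y c → c ≠ g - 1 ∧ c ≠ g ∧ c ≠ g + 1 := by
    intro c hc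
    have h' : ∀ g i : ZMod 9, (g + g - i ≠ g - 1 ∧ g + g - i ≠ g ∧ g + g - i ≠ g + 1) →
      (i ≠ g - 1 ∧ i ≠ g ∧ i ≠ g + 1) := by decide
    exact h' g c (ht _ hc)
  have hgg : g + g - (g - 1) = g + 1 ∧ g + g - (g + 1) = g - 1 ∧ g + g - g = g := by
    refine ⟨?_, ?_, ?_⟩ <;> ring
  obtain ⟨z, k, I, q, hR⟩ := h.exists_reach ht
  by_cases h₁ : ∃ a ∈ I, G.Adj a (f (g - 1))
  · by_cases h₂ : ∃ a ∈ I, G.Adj a (f (g + 1))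
    · exact (hR.not_both h ht h₁ h₂).elim
    · push Not at h₂
      refine Or.inr (hR.reflect.exit (h.reflect _) ht' ?_ ?_)
      · simpa only [hgg] using h₂
      · simpa only [hgg] using h₁
  · by_cases h₂ : ∃ a ∈ I, G.Adj a (f (g + 1))
    · push Not at h₁
      exact Or.inl (hR.exit h ht h₁ h₂)
    · push Not at h₁ h₂
      have hne := hR.ne
      have hJ := h.good.jump_of_arris h.nonagon hR.arris
        (fun e => (hR.not_adj h.good h.nonagon e).elim) hR.adj hne.2.1 hR.out (fun a ha i hi => by
          rcases hR.att a ha i hi with rfl | rfl | rfl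
          exacts [(h₁ a ha hi).elim, rfl, (h₂ a ha hi).elim]) hR.notMem_range
      have hadj : ¬ G.Adj (f g) (f z) := by
        rw [h.nonagon.adj_iff]
        rintro (e | e)
        exacts [hne.2.2 e, hne.1 (eq_sub_of_add_eq e.symm)]
      have hv := hadj
      rw [h.nonagon.adj_iff_val] at hv
      have hp := val_pos hne.2.1
      have hp' := val_pos hne.2.1.symm
      have hs := val_add_val hne.2.1.symm
      have hfin := hR.fin_mono subset_rfl (Or.inr rfl)
      rcases hJ.oddJump h.good h.nonagon hadj with hO | hO
      · exact Or.inl ⟨g, z, _, hO, Or.inl rfl, hne, hfin, Or.inl (by omega)⟩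
      · have hO' := hO.reflect (g + g)
        rw [hgg.2.2] at hO'
        refine Or.inr ⟨g, g + g - z, _, hO', Or.inl rfl, hR.reflect.ne, ?_, Or.inl ?_⟩
        · exact hR.reflect.fin_mono subset_rfl (Or.inr rfl)
        · rw [show g + g - z - g = g - z by ring]
          omega

end NineHoles

namespace NineHoles

variable {G : SimpleGraph V} {f : ZMod 9 → V} {g z c : ZMod 9} {W Y : Set V}

theorem Setting.rotate (h : Setting G f Y) (r : ZMod 9) : Setting G (fun i => f (r + i)) Y := by
  simpa using (h.reflect r).reflect 0

/-- Relations between two bases which exclude the presence of odd jumps over both of them. -/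
def Clash (s e s' e' : ZMod 9) : Prop :=
  (Tri s s' e ∧ Tri s e e') ∨ (Tri s e' e ∧ Tri s e s') ∨
  2 ≤ (e - s).val ∧ 2 ≤ (e' - s').val ∧
    (((s = e' ∨ s' = e) ∧ (e - s).val + (e' - s').val ≤ 7) ∨
      ((e' = s - 1 ∨ e = s' - 1) ∧ (e - s).val + (e' - s').val ≤ 6))

instance (s e s' e' : ZMod 9) : Decidable (Clash s e s' e') := by
  unfold Clash Tri
  infer_instance

theorem Clash.false {s e s' e' : ZMod 9} (h : Clash s e s' e') (hG : Good G) (hf : IsNonagon G f)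
    (h₁ : ∃ W, OddJump G f s e W) (h₂ : ∃ W, OddJump G f s' e' W) : False := by
  obtain ⟨W₁, h₁⟩ := h₁
  obtain ⟨W₂, h₂⟩ := h₂
  rcases h with ⟨h, h'⟩ | ⟨h, h'⟩ | ⟨h2, h2', ⟨rfl | rfl, hs⟩ | ⟨rfl | rfl, hs⟩⟩
  · exact h₁.not_crossing hG hf h₂.jump h h'
  · exact h₁.not_crossing hG hf h₂.jump.symm h h'
  · exact h₁.not_consecutive hG hf h₂ h2 h2' hs
  · exact h₂.not_consecutive hG hf h₁ h2' h2 (by omega)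
  · exact h₁.not_nearly_consecutive hG hf h₂ h2 h2' hs
  · exact h₂.not_nearly_consecutive hG hf h₁ h2' h2 (by omega)

theorem Setting.labels (h : Setting G f Y) {s e : ZMod 9} (hJ : OddJump G f s e W)
    (hse : s = g ∨ s = g + 1) (ht : ∀ c, IsLabel G f Y c → c ≠ g - 1 ∧ c ≠ g ∧ c ≠ g + 1)
    (hW : Sep G Y W ∨ ∃ w, Tied G f Y W e w) :
    (∀ c, IsLabel G f Y c → (c - s).val ≤ (e - s).val) ∨
      IsLabel G f Y e ∧ (∀ c, IsLabel G f Y c → c = e ∨ c = e + 1) ∧ ∃ w, Tied G f Y W e w := by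
  rcases hW with hW | ⟨w, hw⟩
  · exact Or.inl fun c hc => h.mem_base hJ hW hc
  · refine Or.inr ⟨hw.isLabel, fun c hc => ?_, w, hw⟩
    by_contra hcon
    push Not at hcon
    have hcs : c ≠ s := by
      have := ht c hc
      rintro rfl
      tauto
    rcases h.label_of_tied hJ hw hc hcs hcon.1 hcon.1 with ⟨-, e⟩ | ⟨e, -⟩
    exacts [hJ.jump.ne e.symm, hcon.2 e]

/-- The combinatorial content of `Exit`, when `a` and `b` are labels and all labels satisfy `P`. -/
def ExitBase (P : ZMod 9 → Prop) (g a b s e : ZMod 9) : Prop :=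
  (s = g ∨ s = g + 1) ∧ (e ≠ g - 1 ∧ e ≠ g ∧ e ≠ g + 1) ∧ (e - s).val ≤ 4 ∧
    ((a - s).val ≤ (e - s).val ∧ (b - s).val ≤ (e - s).val ∨
      P e ∧ (a = e ∨ a = e + 1) ∧ (b = e ∨ b = e + 1))

instance (P : ZMod 9 → Prop) [DecidablePred P] (g a b s e : ZMod 9) :
    Decidable (ExitBase P g a b s e) := by
  unfold ExitBase
  infer_instance

theorem Exit.exists_base (h : Exit G f Y g) (hS : Setting G f Y) {P : ZMod 9 → Prop}
    (hP : ∀ c, IsLabel G f Y c → P c) (ht : ∀ c, P c → c ≠ g - 1 ∧ c ≠ g ∧ c ≠ g + 1)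
    {a b : ZMod 9} (ha : IsLabel G f Y a) (hb : IsLabel G f Y b) :
    ∃ s e, (∃ W, OddJump G f s e W) ∧ ExitBase P g a b s e := by
  obtain ⟨s, e, W, hJ, hs, he, hW, -⟩ := h
  refine ⟨s, e, ⟨W, hJ⟩, hs, he, hJ.le, ?_⟩
  rcases hS.labels hJ hs (fun c hc => ht c (hP c hc)) hW with h' | ⟨h, h', -⟩
  exacts [Or.inl ⟨h' a ha, h' b hb⟩, Or.inr ⟨hP e h, h' a ha, h' b hb⟩]

theorem ne_of_reflect_ne {g i : ZMod 9} : g + g - i ≠ g - 1 ∧ g + g - i ≠ g ∧ g + g - i ≠ g + 1 →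
    i ≠ g - 1 ∧ i ≠ g ∧ i ≠ g + 1 := by
  revert g i
  decide

theorem Setting.exists_base (h : Setting G f Y) {P : ZMod 9 → Prop}
    (hP : ∀ c, IsLabel G f Y c → P c) (ht : ∀ c, P c → c ≠ g - 1 ∧ c ≠ g ∧ c ≠ g + 1)
    {a b : ZMod 9} (ha : IsLabel G f Y a) (hb : IsLabel G f Y b) :
    ∃ s e, (∃ W, OddJump G f s e W) ∧ (ExitBase P g a b s e ∨
      ExitBase (fun c => P (g + g - c)) g (g + g - a) (g + g - b) (g + g - e) (g + g - s)) := by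
  rcases h.exit_or_entry fun c hc => ht c (hP c hc) with h' | h'
  · obtain ⟨s, e, hJ, hE⟩ := h'.exists_base h hP ht ha hb
    exact ⟨s, e, hJ, Or.inl hE⟩
  · obtain ⟨s, e, ⟨W, hJ⟩, hE⟩ := Exit.exists_base h' (h.reflect _)
      (P := fun c => P (g + g - c)) (fun c hc => hP _ hc) (fun c hc => ne_of_reflect_ne (ht _ hc))
      (a := g + g - a) (b := g + g - b)
      (by simpa [isLabel_reflect] using ha) (by simpa [isLabel_reflect] using hb)
    exact ⟨g + g - e, g + g - s, ⟨W, hJ.of_reflect⟩, Or.inr (by simpa using hE)⟩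

theorem Setting.not_far (h : Setting G f Y) (h0 : IsLabel G f Y 0) {e : ZMod 9}
    (he : IsLabel G f Y e) (h2 : 2 ≤ e.val) (h4 : e.val ≤ 4) : False := by
  have hL : ∀ c, IsLabel G f Y c → c = 0 ∨ c = e ∨ c = 8 ∨ c = e + 1 := by
    intro c hc
    by_contra hcon
    push Not at hcon
    rcases h.third_label h0 he hc hcon.1 hcon.2.1 (by simpa using h2) (by simpa using h4) with
      h' | h'
    · exact hcon.2.2.1 (h'.trans (by decide))
    · exact hcon.2.2.2 h'
  have hev : ∀ e : ZMod 9, 2 ≤ e.val → e.val ≤ 4 → e = 2 ∨ e = 3 ∨ e = 4 := by decide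
  rcases hev e h2 h4 with rfl | rfl | rfl
  · obtain ⟨s, e, hJ, hE⟩ := h.exists_base (g := 5) hL (by decide) h0 he
    obtain ⟨s', e', hJ', hE'⟩ := h.exists_base (g := 6) hL (by decide) h0 he
    exact Clash.false (by clear hJ hJ'; revert s e s' e'; decide +kernel) h.good h.nonagon hJ hJ'
  · obtain ⟨s, e, -, hE⟩ := h.exists_base (g := 6) hL (by decide) h0 he
    revert s e
    decide +kernel
  · obtain ⟨s, e, -, hE⟩ := h.exists_base (g := 2) hL (by decide) h0 he
    revert s e
    decide +kernel

theorem Setting.not_single (h : Setting G f Y) (h0 : IsLabel G f Y 0)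
    (hL : ∀ c, IsLabel G f Y c → c = 0) : False := by
  obtain ⟨s₁, e₁, hJ₁, h₁⟩ := h.exists_base (g := 3) hL (by decide) h0 h0
  obtain ⟨s₂, e₂, hJ₂, h₂⟩ := h.exists_base (g := 6) hL (by decide) h0 h0
  obtain ⟨s₃, e₃, hJ₃, h₃⟩ := h.exists_base (g := 4) hL (by decide) h0 h0
  have k₁ : Clash s₁ e₁ s₂ e₂ ∨ s₁ = 7 ∧ e₁ = 2 ∨ s₂ = 7 ∧ e₂ = 2 := by
    clear hJ₁ hJ₂ hJ₃ h₃ s₃ e₃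
    revert s₁ e₁ s₂ e₂
    decide +kernel
  have k₂ : Clash 7 2 s₃ e₃ := by
    clear hJ₁ hJ₂ hJ₃ h₁ h₂ k₁ s₁ e₁ s₂ e₂
    revert s₃ e₃
    decide +kernel
  rcases k₁ with k | ⟨rfl, rfl⟩ | ⟨rfl, rfl⟩
  · exact k.false h.good h.nonagon hJ₁ hJ₂
  · exact k₂.false h.good h.nonagon hJ₁ hJ₃
  · exact k₂.false h.good h.nonagon hJ₂ hJ₃

theorem Tied.conn_left {w : V} {n : ℕ} (h : Tied G f Y W z w) {x : V} (hf : IsNonagon G f)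
    (hG : Good G) (hA : Arris G x (f z) n W) (hout : ∀ a ∈ W, a ∉ Set.range f)
    (hx : ∃ i ≠ z, x = f i) :
    ∃ D, Conn G D ∧ (∃ a ∈ D, G.Adj a x) ∧ W = insert w D ∧ w ∉ D ∧ Sep G D {f z} := by
  obtain ⟨n₁, n₂, I₁, I₂, hs⟩ := hA.split h.mem
  obtain rfl := hs.adj_right h.adj
  obtain rfl := hs.right.eq_empty_of_one
  refine ⟨I₁, hs.left.conn, ?_, ?_, hs.left.right_notMem, hs.sep_right⟩
  · have hn : n₁ ≠ 1 := by
      rintro rfl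
      obtain ⟨i, hi, rfl⟩ := hx
      exact hi (hG.unique_adj hf (hout w h.mem) hs.left.adj_of_one.symm h.adj)
    obtain ⟨a, ha, hxa⟩ := hs.left.exists_adj hn
    exact ⟨a, ha, hxa.symm⟩
  · rw [hs.eq]
    ext x
    simp

theorem Setting.not_detour (h : Setting G f Y) (h0 : IsLabel G f Y 0) (hJ : OddJump G f 0 4 W)
    {w : V} (hw : Tied G f Y W 0 w) (hD : Detour G f Y 6) : False := by
  obtain ⟨k, I, hA, hk, hIf, hIatt, w', hw'⟩ := hD
  have hG := h.good
  have hf := h.nonagon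
  have h8 : (6 + 2 : ZMod 9) = 8 ∧ (6 + 1 : ZMod 9) = 7 := by decide
  rw [h8.1] at hA hw'
  simp only [h8] at hIatt
  have hWf := hJ.jump.out
  have hI0 : ∀ a ∈ I, ∀ i, (i ≠ 6 ∧ i ≠ 7 ∧ i ≠ 8) → ¬ G.Adj a (f i) := by
    intro a ha i hi e
    have := hIatt a ha i e
    tauto
  by_cases hsep : Sep G W I
  · have hB := hJ.jump.symm.arris.append
      (Arris.edge ((hf.adj_iff 0 8).2 (by decide))) (fun e => absurd (hf.inj e) (by decide))
      sep_empty_right (hJ.jump.sep_singleton (by decide) (by decide)) sep_empty_right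
      (fun e => absurd ((hf.adj_iff _ _).1 e) (by decide)) (fun _ => rfl)
    have h5 : Arris G (f 4) (f 6) 2 {f 5} := Arris.two ((hf.adj_iff _ _).2 (by decide))
      ((hf.adj_iff _ _).2 (by decide)) (fun e => absurd (hf.inj e) (by decide))
    have hfI : ∀ i, (i ≠ 6 ∧ i ≠ 7 ∧ i ≠ 8) → Sep G {f i} I := by
      intro i hi
      rw [sep_singleton_left]
      exact fun a ha => ⟨fun e => hIf a ha ⟨i, e⟩, fun e => hI0 a ha i hi e.symm⟩
    have hff : ∀ i j : ZMod 9, (i ≠ j ∧ j ≠ i + 1 ∧ i ≠ j + 1) → Sep G {f i} {f j} := by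
      intro i j hij
      rw [sep_singleton_left]
      rintro _ rfl
      refine ⟨fun e => hij.1 (hf.inj e), fun e => ?_⟩
      rcases (hf.adj_iff i j).1 e with e | e
      exacts [hij.2.1 e, hij.2.2 e]
    have hC := h5.append hA (fun e => absurd (hf.inj e) (by decide)) (hfI 5 (by decide))
      (hff 5 8 (by decide)) (hfI 4 (by decide))
      (fun e => absurd ((hf.adj_iff _ _).1 e) (by decide))
      (fun e => absurd ((hf.adj_iff _ _).1 e) (by decide))
    rw [Set.union_empty] at hB
    have hv : 9 - ((4 : ZMod 9) - 0).val = 5 := by decide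
    rw [hv] at hB
    have := (hG.hole hB hC (by
      simp only [sep_union_left, sep_union_right]
      exact ⟨⟨⟨hJ.jump.sep_singleton (by decide) (by decide), hff 0 5 (by decide)⟩,
        hJ.jump.sep_singleton (by decide) (by decide), hff 0 6 (by decide)⟩, hsep,
        hfI 0 (by decide)⟩) (fun e => absurd ((hf.adj_iff _ _).1 e) (by decide))
        (by omega)).2 (by grind)
    obtain rfl : k = 1 := by omega
    exact absurd ((hf.adj_iff _ _).1 hA.adj_of_one) (by decide)
  · obtain ⟨D, hDc, ⟨d, hd, hd4⟩, hWD, hwD, hD0⟩ := hw.conn_left hf hG hJ.jump.symm.arris hWf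
      ⟨4, by decide, rfl⟩
    obtain ⟨E, hEc, ⟨e, he, he6⟩, hIE, hwE, hE8⟩ := hw'.conn_left hf hG hA hIf ⟨6, by decide, rfl⟩
    have hDW : D ⊆ W := hWD ▸ Set.subset_insert _ _
    have hEI : E ⊆ I := hIE ▸ Set.subset_insert _ _
    obtain ⟨a, ha, b, hb, hab⟩ : ∃ a ∈ W, ∃ b ∈ I, a = b ∨ G.Adj a b := by
      by_contra hcon
      push Not at hcon
      exact hsep hcon
    have ha' : a ∈ D := by
      rw [hWD] at ha
      refine ha.resolve_left ?_
      rintro rfl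
      rcases hab with rfl | e
      · exact hI0 _ hb 0 (by decide) hw.adj
      · exact absurd (hG.unique_adj hf (hWf _ hw.mem) hw.adj
          (hw'.adj_of_adj b hb _ hw.mem_bd e.symm)) (by decide)
    have hb' : b ∈ E := by
      rw [hIE] at hb
      refine hb.resolve_left ?_
      rintro rfl
      rcases hab with rfl | e
      · exact absurd (hJ.jump.att _ ha 8 hw'.adj) (by decide)
      · exact absurd (hG.unique_adj hf (hIf _ hw'.mem) hw'.adj
          (hw.adj_of_adj a ha _ hw'.mem_bd e)) (by decide)
    obtain ⟨j, hj, ⟨p, hp, hpj⟩, n, W', hW', hJ'⟩ := hG.exists_jump hf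
      (hDc.union hEc ha' hb' hab) (by
        rintro x (hx | hx)
        exacts [hWf x (hDW hx), hIf x (hEI hx)]) (i := 4) (j := 6) (by decide)
      ⟨d, Or.inl hd, hd4⟩ ⟨e, Or.inr he, he6⟩
    have hj' : j = 6 ∨ j = 7 := by
      rcases hp with hp | hp
      · rcases hJ.jump.att p (hDW hp) j hpj with rfl | rfl
        exacts [((hD0 p hp _ rfl).2 hpj).elim, (hj rfl).elim]
      · rcases hIatt p (hEI hp) j hpj with rfl | rfl | rfl
        exacts [Or.inl rfl, Or.inr rfl, ((hE8 p hp _ rfl).2 hpj).elim]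
    have hsepW' : Sep G Y W' := by
      intro y hy x hx
      rcases hW' hx with hx | hx
      · exact hw.sep x (hDW hx) (fun e => hwD (e ▸ hx)) y hy x rfl
      · exact hw'.sep x (hEI hx) (fun e => hwE (e ▸ hx)) y hy x rfl
    have hadj : ¬ G.Adj (f 4) (f j) := by
      rw [hf.adj_iff]
      rcases hj' with rfl | rfl <;> decide
    rcases hJ'.oddJump hG hf hadj with hO | hO
    · have := h.mem_base hO hsepW' h0
      rcases hj' with rfl | rfl <;> exact absurd this (by decide)
    · have := hO.le
      rcases hj' with rfl | rfl <;> exact absurd this (by decide)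

theorem Setting.exit_of_pair (h : Setting G f Y) (h0 : IsLabel G f Y 0) (h8 : IsLabel G f Y 8)
    (hL : ∀ c, IsLabel G f Y c → c = 0 ∨ c = 8) : Exit G f Y 5 := by
  have hG := h.good
  have hf := h.nonagon
  have ht5 : ∀ c : ZMod 9, c = 0 ∨ c = 8 → c ≠ 5 - 1 ∧ c ≠ 5 ∧ c ≠ 5 + 1 := by decide
  have ht6 : ∀ c : ZMod 9, c = 0 ∨ c = 8 → c ≠ 6 - 1 ∧ c ≠ 6 ∧ c ≠ 6 + 1 := by decide
  refine (h.exit_or_entry fun c hc => ht5 c (hL c hc)).resolve_right ?_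
  rintro ⟨s, e, W, hJ, hs, he, hW, -⟩
  obtain ⟨w, hw, rfl, rfl⟩ : ∃ w, Tied G (fun i => f (5 + 5 - i)) Y W e w ∧ s = 6 ∧ e = 1 := by
    have hle := hJ.le
    rcases (h.reflect (5 + 5)).labels hJ hs
      (fun c hc => ne_of_reflect_ne (ht5 _ (hL _ hc))) hW with h' | ⟨h', h'', w, hw⟩
    · exfalso
      have k0 := h' 1 h0
      have k8 := h' 2 h8
      clear hJ hW h'
      revert s e
      decide +kernel
    · refine ⟨w, hw, ?_⟩
      have k0 := h'' 1 h0
      have k8 := h'' 2 h8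
      clear hJ hW h' h'' hw
      revert s e
      decide +kernel
  have hJ₀ : OddJump G f 0 4 W := hJ.of_reflect
  have hw₀ : Tied G f Y W 0 w := hw.of_reflect
  rcases h.exit_or_entry (g := 6) fun c hc => ht6 c (hL c hc) with h' | h'
  · obtain ⟨s, e, W', hJ', hs, he, hW', hd⟩ := h'
    have hlab := h.labels hJ' hs (fun c hc => ht6 c (hL c hc)) hW'
    have hle := hJ'.le
    rcases hd with h2 | ⟨rfl, rfl, h' | h'⟩
    · refine Clash.false (s := 0) (e := 4) (s' := s) (e' := e) ?_ hG hf ⟨W, hJ₀⟩ ⟨W', hJ'⟩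
      have hlab' : ((0 - s).val ≤ (e - s).val ∧ (8 - s).val ≤ (e - s).val) ∨
          (0 = e ∨ 0 = e + 1) ∧ (8 = e ∨ 8 = e + 1) :=
        hlab.imp (fun h => ⟨h 0 h0, h 8 h8⟩) fun h => ⟨h.2.1 0 h0, h.2.1 8 h8⟩
      clear hlab hJ' hW' hJ hJ₀
      revert s e
      decide +kernel
    · exact absurd (h.mem_base hJ' h' h0) (by decide)
    · exact h.not_detour h0 hJ₀ hw₀ h'
  · obtain ⟨s, e, -, hE⟩ := Exit.exists_base h' (h.reflect _)
      (P := fun c => 6 + 6 - c = 0 ∨ 6 + 6 - c = 8) (fun c hc => hL _ hc)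
      (fun c hc => ne_of_reflect_ne (ht6 _ hc)) (a := 6 + 6 - 0) (b := 6 + 6 - 8)
      (by simpa [isLabel_reflect] using h0) (by simpa [isLabel_reflect] using h8)
    revert s e
    decide +kernel

theorem Setting.base_of_pair (h : Setting G f Y) (h0 : IsLabel G f Y 0) (h8 : IsLabel G f Y 8)
    (hL : ∀ c, IsLabel G f Y c → c = 0 ∨ c = 8) :
    ∃ s e, (∃ W, OddJump G f s e W) ∧
      (s = 5 ∧ (e = 0 ∨ e = 8) ∨ s = 6 ∧ (e = 0 ∨ e = 1 ∨ e = 8)) := by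
  obtain ⟨s, e, hJ, hE⟩ := (h.exit_of_pair h0 h8 hL).exists_base h hL (by decide) h0 h8
  refine ⟨s, e, hJ, ?_⟩
  clear hJ
  revert s e
  decide +kernel

theorem Setting.not_pair (h : Setting G f Y) (h0 : IsLabel G f Y 0) (h8 : IsLabel G f Y 8)
    (hL : ∀ c, IsLabel G f Y c → c = 0 ∨ c = 8) : False := by
  obtain ⟨s, e, hJ, hse⟩ := h.base_of_pair h0 h8 hL
  obtain ⟨s', e', ⟨W, hJ'⟩, hse'⟩ := (h.reflect 8).base_of_pair
    (by simpa [isLabel_reflect] using h8) (by simpa [isLabel_reflect] using h0) (fun c hc => by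
      have := hL _ hc
      clear hc
      revert c
      decide)
  refine Clash.false (s := s) (e := e) (s' := 8 - e') (e' := 8 - s') ?_ h.good h.nonagon hJ
    ⟨W, hJ'.of_reflect⟩
  clear hJ hJ'
  revert s e s' e'
  decide +kernel

theorem Setting.false (h : Setting G f Y) : False := by
  have hrot : ∀ {r c}, IsLabel G f Y (r + c) → IsLabel G (fun i => f (r + i)) Y c := id
  have hfar : ∀ c d, IsLabel G f Y c → IsLabel G f Y d → 2 ≤ (d - c).val → (d - c).val ≤ 4 →
      False := fun c d hc hd => (h.rotate c).not_far (hrot (by simpa using hc))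
    (hrot (c := d - c) (by simpa using hd))
  have hpair : ∀ c, IsLabel G f Y c → IsLabel G f Y (c - 1) →
      (∀ d, IsLabel G f Y d → d = c ∨ d = c - 1) → False := by
    intro c hc hc' hL
    have h8 : (8 : ZMod 9) = -1 := by decide
    refine (h.rotate c).not_pair (hrot (by simpa using hc))
      (hrot (by simpa [h8, ← sub_eq_add_neg] using hc')) fun d hd => ?_
    rcases hL _ hd with e | e
    · exact Or.inl (by simpa using e)
    · exact Or.inr (by simpa [h8, sub_eq_add_neg] using e)
  obtain ⟨c, hc⟩ := h.exists_isLabel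
  have hnear : ∀ d, IsLabel G f Y d → d = c - 1 ∨ d = c ∨ d = c + 1 := by
    intro d hd
    by_contra hcon
    have : ∀ c d : ZMod 9, ¬ (d = c - 1 ∨ d = c ∨ d = c + 1) →
        2 ≤ (d - c).val ∧ (d - c).val ≤ 4 ∨ 2 ≤ (c - d).val ∧ (c - d).val ≤ 4 := by decide
    rcases this c d hcon with ⟨k, k'⟩ | ⟨k, k'⟩
    exacts [hfar c d hc hd k k', hfar d c hd hc k k']
  by_cases h₁ : IsLabel G f Y (c - 1) <;> by_cases h₂ : IsLabel G f Y (c + 1)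
  · have : ∀ c : ZMod 9, (c + 1 - (c - 1)).val = 2 := by decide
    exact hfar _ _ h₁ h₂ (this c).ge (by rw [this]; decide)
  · refine hpair c hc h₁ fun d hd => ?_
    rcases hnear d hd with rfl | rfl | rfl
    exacts [Or.inr rfl, Or.inl rfl, (h₂ hd).elim]
  · refine hpair (c + 1) h₂ (by simpa using hc) fun d hd => ?_
    rcases hnear d hd with rfl | rfl | rfl
    exacts [(h₁ hd).elim, Or.inr (by simp), Or.inl rfl]
  · refine (h.rotate c).not_single (hrot (by simpa using hc)) fun d hd => ?_
    rcases hnear _ hd with e | e | e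
    · exact (h₁ (e ▸ hd)).elim
    · simpa using e
    · exact (h₂ (e ▸ hd)).elim

end NineHoles

namespace NineHoles

variable {G : SimpleGraph V} {f : ZMod 9 → V}

theorem good_of_memGFam (hG : MemGFam G 4) (ho : ¬ HasOddK4 G) (hb : ¬ HasBalancedK4 G) :
    Good G where
  nine_le v w hw := by
    have := hw.girth_le_length
    rw [hG.1] at this
    exact this
  eq_nine v w hw := by
    have h1 := hw.1.1.girth_le_length
    have h2 := hG.2 v w hw
    have h3 := hw.2
    rw [hG.1] at h1
    grind
  not_odd := ho
  not_balanced := hb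

theorem exists_isHole_of_girth (hg : G.girth = 9) :
    ∃ (v : V) (w : G.Walk v v), IsHole G w ∧ w.length = 9 := by
  have hac : ¬ G.IsAcyclic := by
    intro h
    rw [← girth_eq_zero] at h
    omega
  obtain ⟨v, w, hw, hl⟩ := exists_girth_eq_length.2 hac
  refine ⟨v, w, ⟨hw, by omega, fun a ha b hb hab => ?_⟩, by omega⟩
  by_contra hcon
  classical
  have hw' : (w.rotate a ha).IsCycle := hw.rotate ha
  obtain ⟨p, q, hpq⟩ := Walk.mem_support_iff_exists_append.1
    ((w.mem_support_rotate_iff a ha).2 hb)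
  have hlen : (w.rotate a ha).length = w.length := by simp
  have hedge : s(a, b) ∉ p.edges ∧ s(a, b) ∉ q.edges := by
    have := (w.rotate_edges a ha).mem_iff (a := s(a, b))
    rw [hpq, Walk.edges_append, List.mem_append] at this
    tauto
  rw [hpq] at hw' hlen
  rw [Walk.length_append] at hlen
  have hp := hw'.isPath_of_append_left (Walk.not_nil_of_ne hab.ne')
  have hq := hw'.isPath_of_append_right (Walk.not_nil_of_ne hab.ne)
  have h1 := ((Walk.cons_isCycle_iff p hab.symm).2 ⟨hp, Sym2.eq_swap ▸ hedge.1⟩).girth_le_length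
  have h2 := ((Walk.cons_isCycle_iff q hab).2 ⟨hq, hedge.2⟩).girth_le_length
  rw [Walk.length_cons] at h1 h2
  omega

theorem conn_compl_of_preconnected {S : Set V} (h : (G.induce Sᶜ).Preconnected) : Conn G Sᶜ := by
  intro a ha b hb
  obtain ⟨p⟩ := h ⟨a, ha⟩ ⟨b, hb⟩
  refine ⟨p.map (Embedding.induce Sᶜ).toHom, fun v hv => ?_⟩
  have hv := Walk.support_map (Embedding.induce Sᶜ).toHom p ▸ hv
  obtain ⟨x, -, rfl⟩ := List.mem_map.1 hv
  exact x.2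

theorem IsNonagon.link (hf : IsNonagon G f) (hP : ¬ HasP3Cut G) (g : ZMod 9) :
    Conn G {f (g - 1), f g, f (g + 1)}ᶜ := by
  by_contra hcon
  have h1 : ∀ g : ZMod 9, g - 1 ≠ g + 1 ∧ ¬ (g + 1 = g - 1 + 1 ∨ g - 1 = g + 1 + 1) := by decide
  exact hP ⟨f (g - 1), f g, f (g + 1), hf.inj.ne (h1 g).1, (hf.adj_iff _ _).2 (by simp),
    (hf.adj_iff _ _).2 (by simp), fun e => (h1 g).2 ((hf.adj_iff _ _).1 e),
    fun h => hcon (conn_compl_of_preconnected h)⟩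

theorem IsNonagon.third (hf : IsNonagon G f) (hd : ∀ u, (G.neighborSet u).ncard ≠ 2)
    (i : ZMod 9) : ∃ s, s ∉ Set.range f ∧ G.Adj (f i) s := by
  by_contra hcon
  push Not at hcon
  have h1 : ∀ i : ZMod 9, i + 1 ≠ i - 1 := by decide
  refine hd (f i) ?_
  rw [← Set.ncard_pair (hf.inj.ne (h1 i))]
  congr 1
  ext s
  simp only [mem_neighborSet, Set.mem_insert_iff, Set.mem_singleton_iff]
  constructor
  · intro hs
    by_cases hr : s ∈ Set.range f
    · obtain ⟨j, rfl⟩ := hr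
      rcases (hf.adj_iff _ _).1 hs with rfl | rfl
      exacts [Or.inl rfl, Or.inr (by simp)]
    · exact (hcon s hr hs).elim
  · rintro (rfl | rfl) <;> exact (hf.adj_iff _ _).2 (by simp)

theorem Good.exists_sep_singleton (hG : Good G) (hf : IsNonagon G f)
    (hl : ∀ g, Conn G {f (g - 1), f g, f (g + 1)}ᶜ)
    (ht : ∀ i, ∃ s, s ∉ Set.range f ∧ G.Adj (f i) s) : ∃ y, Sep G {y} (Set.range f) := by
  obtain ⟨s, hs, has⟩ := ht 0
  obtain ⟨y, hy, hsy⟩ : ∃ y ∉ Set.range f, G.Adj s y := by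
    obtain ⟨p, hp⟩ := hl 0 s (by
      rintro (rfl | rfl | rfl) <;> exact hs ⟨_, rfl⟩) (f 4) (by
      simp only [Set.mem_compl_iff, Set.mem_insert_iff, Set.mem_singleton_iff, hf.inj.eq_iff]
      decide)
    cases p with
    | nil => exact (hs ⟨_, rfl⟩).elim
    | @cons _ y _ hsy q =>
      refine ⟨y, ?_, hsy⟩
      rintro ⟨i, rfl⟩
      obtain rfl := hG.unique_adj hf hs has.symm hsy
      exact hp (f 0) (by simp) (by simp)
  refine ⟨y, ?_⟩
  rw [sep_singleton_left]
  rintro _ ⟨i, rfl⟩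
  refine ⟨fun e => hy ⟨i, e.symm⟩, fun e => ?_⟩
  obtain rfl := hG.eq_of_adj hf hs hy hsy has.symm e
  exact not_triangle hG has hsy e.symm

theorem Good.exists_setting [Finite V] (hG : Good G) (hf : IsNonagon G f) (hP : ¬ HasP3Cut G)
    (hd : ∀ u, (G.neighborSet u).ncard ≠ 2) : ∃ f' Y, Setting G f' Y := by
  obtain ⟨y, hy⟩ := hG.exists_sep_singleton hf (hf.link hP) (hf.third hd)
  obtain ⟨Y, -, ⟨hY, hne, f', hf', hsep⟩, hmax⟩ := Finite.exists_le_maximal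
    (p := fun Y : Set V => Conn G Y ∧ Y.Nonempty ∧
      ∃ f', IsNonagon G f' ∧ Sep G Y (Set.range f'))
    (a := {y}) ⟨by rintro _ rfl _ rfl; exact Linked.refl rfl, ⟨y, rfl⟩, f, hf, hy⟩
  refine ⟨f', Y, hG, hf', hY, hne, hsep, hf'.link hP, hf'.third hd, ?_⟩
  rintro f'' hf'' hsep'' u ⟨huY, d, hd, hud⟩
  by_contra hcon
  push Not at hcon
  refine huY (hmax (y := insert u Y) ⟨hY.insert hd hud, ⟨u, Or.inl rfl⟩, f'', hf'', ?_⟩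
    (Set.subset_insert _ _) (Set.mem_insert _ _))
  rintro x (rfl | hx) _ ⟨i, rfl⟩
  · exact ⟨fun e => (hsep'' d hd _ ⟨i, rfl⟩).2 (e ▸ hud.symm), hcon i⟩
  · exact hsep'' x hx _ ⟨i, rfl⟩

end NineHoles

/-- If `G ∈ 𝒢₄` has no 2-edge-cut and no `K2`-cut, then `G` has an
odd `K4`-subdivision, or a balanced `K4`-subdivision of type `(1,2)`, or a `P3`-cut,
or a vertex of degree 2. -/
theorem structure_of_G4_graphs {V : Type*} [Fintype V]
    (G : SimpleGraph V) (hG : MemGFam G 4)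
    (h2e : ¬ Has2EdgeCut G) (hK2 : ¬ HasK2Cut G) :
    HasOddK4 G ∨ HasBalancedK4 G ∨ HasP3Cut G ∨
      ∃ u : V, (G.neighborSet u).ncard = 2 := by
  by_contra hcon
  push Not at hcon
  obtain ⟨ho, hb, hP, hd⟩ := hcon
  have hgood := NineHoles.good_of_memGFam hG ho hb
  obtain ⟨v, w, hw, h9⟩ := NineHoles.exists_isHole_of_girth (G := G) hG.1
  obtain ⟨f, hf, -⟩ := NineHoles.exists_isNonagon hw h9
  obtain ⟨f', Y, hS⟩ := hgood.exists_setting hf hP hd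
  exact hS.false
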